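/- Suppose d ≥ 1, 0 < α < d and α < min{1, d/3}. Then the critical cluster-size tail has mean-field behaviour: there are constants 0 < c₁ ≤ C₁ < ∞ (depending only on d, α, c, C) such that c₁ n^{−1/2} ≤ ℙ_{β_c}(|K| ≥ n) ≤ C₁ n^{−1/2} for every n ≥ 1. -/

import Mathlib

open MeasureTheory ENNReal

namespace LRP

/-- The vertex set `ℤ^d`. -/
abbrev V (d : ℕ) : Type := Fin d → ℤ

/-- The `ℓ^∞` norm of a lattice point, as a natural number. -/
def normInf {d : ℕ} (x : V d) : ℕ := Finset.univ.sup fun i => (x i).natAbs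

/-- A percolation configuration: each (unordered) pair of vertices is open or closed. -/
abbrev Config (d : ℕ) : Type := Sym2 (V d) → Bool

/-- The probability `1 - exp (-β J(x,y))` that the edge `e = {x,y}` is open
(the symmetrization `(J x y + J y x)/2` equals `J x y` for symmetric `J`). -/
noncomputable def edgeProb {d : ℕ} (J : V d → V d → ℝ) (β : ℝ) (e : Sym2 (V d)) : ℝ≥0∞ :=
  ENNReal.ofReal (1 - Real.exp (-β *
    Sym2.lift ⟨fun x y => (J x y + J y x) / 2, fun x y => by dsimp only; rw [add_comm]⟩ e))

/-- `IsLRP J P` asserts that for each `β`, `P β` is the law of long-range percolation on `ℤ^d`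
with kernel `J` at inverse temperature `β`: distinct edges are open independently, edge `{x,y}`
being open with probability `1 - exp (-β J(x,y))`.  This is expressed by prescribing the
probability of every finite cylinder event, which characterizes the measure uniquely. -/
def IsLRP {d : ℕ} (J : V d → V d → ℝ) (P : ℝ → Measure (Config d)) : Prop :=
  ∀ (β : ℝ) (s : Finset (Sym2 (V d))) (f : Sym2 (V d) → Bool),
    P β {ω | ∀ e ∈ s, ω e = f e} =
      ∏ e ∈ s, (if f e then edgeProb J β e else 1 - edgeProb J β e)

/-- Two vertices are adjacent if they are distinct and the edge between them is open. -/
def adj {d : ℕ} (ω : Config d) (x y : V d) : Prop := x ≠ y ∧ ω s(x, y) = true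

/-- `x ↔ y`: the vertices are connected by a path of open edges. -/
def conn {d : ℕ} (ω : Config d) (x y : V d) : Prop := Relation.ReflTransGen (adj ω) x y

/-- `x ↔ y` inside `A`: connected by an open path all of whose vertices lie in `A`. -/
def connIn {d : ℕ} (ω : Config d) (A : Set (V d)) (x y : V d) : Prop :=
  x ∈ A ∧ y ∈ A ∧ Relation.ReflTransGen (fun a b => a ∈ A ∧ b ∈ A ∧ adj ω a b) x y

/-- The cluster of `x`. -/
def cluster {d : ℕ} (ω : Config d) (x : V d) : Set (V d) := {y | conn ω x y}

/-- The critical point `β_c`. -/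
noncomputable def betaC {d : ℕ} (P : ℝ → Measure (Config d)) : ℝ :=
  sInf {β : ℝ | 0 ≤ β ∧ 0 < P β {ω | ∃ x, (cluster ω x).Infinite}}

/-- The two-point function `ℙ_β(x ↔ y)`. -/
noncomputable def twoPoint {d : ℕ} (P : ℝ → Measure (Config d)) (β : ℝ) (x y : V d) : ℝ≥0∞ :=
  P β {ω | conn ω x y}

/-- The susceptibility `χ(β) = Σ_x ℙ_β(0 ↔ x)`. -/
noncomputable def chi {d : ℕ} (P : ℝ → Measure (Config d)) (β : ℝ) : ℝ≥0∞ :=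
  ∑' x : V d, twoPoint P β 0 x

/-- `Σ_{x ∈ [-n,n]^d} ℙ_β(0 ↔ x)`. -/
noncomputable def boxSum {d : ℕ} (P : ℝ → Measure (Config d)) (β : ℝ) (n : ℕ) : ℝ≥0∞ :=
  ∑' x : V d, if normInf x ≤ n then twoPoint P β 0 x else 0

/-- The correlation length `ξ(β) = inf {r ≥ 1 : Σ_{x ∈ [-r,r]^d} ℙ_β(0↔x) ≥ χ(β)/2}`
(`= ∞` if no such `r` exists). -/
noncomputable def xi {d : ℕ} (P : ℝ → Measure (Config d)) (β : ℝ) : ℝ≥0∞ :=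
  sInf {r : ℝ≥0∞ | ∃ n : ℕ, r = (n : ℝ≥0∞) ∧ 1 ≤ n ∧ chi P β ≤ 2 * boxSum P β n}

/-- The triangle diagram `∇_β`. -/
noncomputable def triangle {d : ℕ} (P : ℝ → Measure (Config d)) (β : ℝ) : ℝ≥0∞ :=
  ∑' x : V d, ∑' y : V d, twoPoint P β 0 x * twoPoint P β x y * twoPoint P β y 0

/-- The standing assumptions on the kernel `J`: symmetric, integrable, translation-invariant,
with `c ‖x-y‖^{-d-α} ≤ J(x,y) ≤ C ‖x-y‖^{-d-α}` for distinct `x, y`, where `0 < α < d`. -/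
structure KernelHyp (d : ℕ) (J : V d → V d → ℝ) (α c C : ℝ) : Prop where
  d_pos : 1 ≤ d
  symm : ∀ x y, J x y = J y x
  transInv : ∀ x y z : V d, J (x + z) (y + z) = J x y
  nonneg : ∀ x y, 0 ≤ J x y
  integrable : Summable fun x : V d => J 0 x
  alpha_pos : 0 < α
  alpha_lt_d : α < (d : ℝ)
  c_pos : 0 < c
  c_le_C : c ≤ C
  lower : ∀ x y : V d, x ≠ y → c * (normInf (x - y) : ℝ) ^ (-(d : ℝ) - α) ≤ J x y
  upper : ∀ x y : V d, x ≠ y → J x y ≤ C * (normInf (x - y) : ℝ) ^ (-(d : ℝ) - α)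

open ENNReal (ofReal ofReal_le_ofReal ofReal_one ofReal_sub ofReal_prod_of_nonneg ofReal_mul ofReal_sum_of_nonneg ofReal_add tsum_set_one finsetSum_iSup_of_monotone ofReal_coe_nnreal sum_le_tsum tsum_le_tsum summable tsum_comm one_ne_top tsum_eq_iSup_sum natCast_ne_top ofReal_tsum_of_nonneg ofReal_div_of_pos ofReal_ne_top tendsto_ofReal mul_ne_top add_ne_top tsum_prod ofReal_pow tsum_add ofReal_natCast ofReal_le_ofReal_iff ofReal_toReal inv_ne_top ofReal_zero mul_iSup toReal_nonneg ofReal_le_one toReal_mono ofReal_pos le_tsum one_le_ofReal toReal_le_of_le_ofReal tsum_eq_zero toReal_pos toReal_add toReal_mul)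
open Finset (mul_sum sum_le_sum sum_image mem_coe le_sup range sum_const sum_congr sum_nonneg sum_add_distrib induction_on sum_insert sum_mul mem_product coe_image mem_filter Ico mem_Ico)
open Set (mem_inter_iff mem_prod univ mem_ofPred_eq mem_empty_iff_false mem_iUnion indicator encard_le_encard subset_univ encard_union_le indicator_of_notMem encard_coe_eq_coe_finsetCard indicator_of_mem iUnion_subset sdiff_subset inter_comm)
open Real (exp exp_le_one_iff exp_pos exp_le_exp sqrt sq_sqrt sqrt_nonneg sqrt_mul)
open Filter (tendsto_id atTop eventually_atTop)
set_option linter.all false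
set_option linter.deprecated false
set_option linter.unusedVariables false
set_option linter.style.haveILetI false
open scoped Classical in
noncomputable def wt {d : ℕ} (J : V d → V d → ℝ) (e : Sym2 (V d)) : ℝ :=
  Sym2.lift ⟨fun x y => (J x y + J y x) / 2, fun x y => by dsimp only; rw [add_comm]⟩ e
section Framework
variable {d : ℕ} {J : V d → V d → ℝ} {α c C : ℝ} {P : ℝ → Measure (Config d)} {β : ℝ}
theorem edgeProb_eq (e : Sym2 (V d)) :
    edgeProb J β e = ofReal (1 - exp (-β * wt J e)) := rfl
theorem KernelHyp.wt_mk (hJ : KernelHyp d J α c C) (x y : V d) : wt J s(x, y) = J x y := by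
  simp [wt, hJ.symm y x]
theorem KernelHyp.wt_nonneg (hJ : KernelHyp d J α c C) (e : Sym2 (V d)) : 0 ≤ wt J e := by
  induction e with | _ x y => rw [hJ.wt_mk]; exact hJ.nonneg x y
theorem KernelHyp.edgeProb_le (hJ : KernelHyp d J α c C) (e : Sym2 (V d)) :
    edgeProb J β e ≤ ofReal (β * wt J e) := by
  rw [edgeProb_eq]
  apply ofReal_le_ofReal
  have := Real.add_one_le_exp (-β * wt J e)
  linarith
theorem KernelHyp.one_sub_edgeProb (hJ : KernelHyp d J α c C) (hβ : 0 ≤ β) (e : Sym2 (V d)) :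
    1 - edgeProb J β e = ofReal (exp (-β * wt J e)) := by
  rw [edgeProb_eq, ← ofReal_one, ← ofReal_sub]
  · ring_nf
  · have : exp (-β * wt J e) ≤ 1 := exp_le_one_iff.2 (by
      have := mul_nonneg hβ (hJ.wt_nonneg e); linarith)
    linarith
theorem edgeProb_le_one (e : Sym2 (V d)) : edgeProb J β e ≤ 1 := by
  rw [edgeProb_eq, ← ofReal_one]
  exact ofReal_le_ofReal (by have := exp_pos (-β * wt J e); linarith)
theorem IsLRP.prob (hP : IsLRP J P) (β : ℝ) : IsProbabilityMeasure (P β) :=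
  ⟨by simpa using hP β ∅ (fun _ => true)⟩
theorem IsLRP.open_eq (hP : IsLRP J P) (e : Sym2 (V d)) :
    P β {ω | ω e = true} = edgeProb J β e := by
  simpa using hP β {e} (fun _ => true)
theorem IsLRP.closed_eq' (hP : IsLRP J P) (s : Finset (Sym2 (V d))) :
    P β {ω | ∀ e ∈ s, ω e = false} = ∏ e ∈ s, (1 - edgeProb J β e) := by
  simpa using hP β s (fun _ => false)
theorem IsLRP.closed_eq (hJ : KernelHyp d J α c C) (hP : IsLRP J P) (hβ : 0 ≤ β)
    (s : Finset (Sym2 (V d))) :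
    P β {ω | ∀ e ∈ s, ω e = false} = ofReal (exp (-β * ∑ e ∈ s, wt J e)) := by
  rw [hP.closed_eq', mul_sum, Real.exp_sum, ofReal_prod_of_nonneg
    (fun _ _ => (exp_pos _).le)]
  exact Finset.prod_congr rfl fun e _ => hJ.one_sub_edgeProb hβ e
theorem ext_closed {μ ν : Measure (Config d)} [IsProbabilityMeasure μ] [IsProbabilityMeasure ν]
    (h : ∀ s : Finset (Sym2 (V d)), μ {ω | ∀ e ∈ s, ω e = false} = ν {ω | ∀ e ∈ s, ω e = false}) :
    μ = ν := by
  refine ext_of_generate_finite (Set.range fun s : Finset (Sym2 (V d)) =>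
    {ω : Config d | ∀ e ∈ s, ω e = false}) ?_ ?_ ?_ (by simp)
  · apply le_antisymm
    · rw [MeasurableSpace.pi, iSup_le_iff]
      intro e
      rw [← measurable_iff_comap_le]
      apply @measurable_to_bool
      have : (fun ω : Config d => ω e) ⁻¹' {true} =
          ({ω : Config d | ∀ e' ∈ ({e} : Finset _), ω e' = false})ᶜ := by
        ext ω; simp
      rw [this]
      exact MeasurableSet.compl (MeasurableSpace.measurableSet_generateFrom ⟨{e}, rfl⟩)
    · apply MeasurableSpace.generateFrom_le
      rintro _ ⟨s, rfl⟩
      have : {ω : Config d | ∀ e ∈ s, ω e = false} = ⋂ e ∈ s, (fun ω => ω e) ⁻¹' {false} := by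
        ext; simp
      simp only [this]
      exact Finset.measurableSet_biInter _ fun e _ => measurable_pi_apply e (measurableSet_singleton _)
  · rintro _ ⟨s, rfl⟩ _ ⟨t, rfl⟩ _
    classical
    refine ⟨s ∪ t, ?_⟩
    ext ω; simp only [Finset.mem_union, Set.mem_setOf_eq, mem_inter_iff]
    grind
  · rintro _ ⟨s, rfl⟩; exact h s
theorem measurableSet_closed (s : Finset (Sym2 (V d))) :
    MeasurableSet {ω : Config d | ∀ e ∈ s, ω e = false} := by
  have : {ω : Config d | ∀ e ∈ s, ω e = false} = ⋂ e ∈ s, (fun ω => ω e) ⁻¹' {false} := by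
    ext; simp
  rw [this]
  exact Finset.measurableSet_biInter _ fun e _ => measurable_pi_apply e (measurableSet_singleton _)
theorem measurableSet_open (e : Sym2 (V d)) : MeasurableSet {ω : Config d | ω e = true} := by
  have : {ω : Config d | ω e = true} = (fun ω => ω e) ⁻¹' {true} := by ext; simp
  rw [this]
  exact measurable_pi_apply e (measurableSet_singleton true)
theorem IsLRP.iIndep (hP : IsLRP J P) (β : ℝ) :
    ProbabilityTheory.iIndep (fun e : Sym2 (V d) => MeasurableSpace.comap (fun ω : Config d => ω e)
      inferInstance) (P β) := by
  haveI := hP.prob β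
  let ν : Sym2 (V d) → Measure Bool := fun e =>
    edgeProb J β e • Measure.dirac true + (1 - edgeProb J β e) • Measure.dirac false
  haveI : ∀ e, IsProbabilityMeasure (ν e) := fun e => ⟨by
    simp [ν, add_tsub_cancel_of_le (edgeProb_le_one e)]⟩
  have : P β = Measure.infinitePi ν := by
    apply ext_closed
    intro s
    rw [hP.closed_eq']
    have : {ω : Config d | ∀ e ∈ s, ω e = false} = Set.pi s (fun _ => {false}) := by
      ext; simp [Set.mem_pi]
    rw [this, Measure.infinitePi_pi _ (fun _ _ => measurableSet_singleton _)]
    simp [ν]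
  rw [this]
  exact ProbabilityTheory.iIndepFun_infinitePi (P := ν) (X := fun _ x => x) (fun _ => measurable_id)
open scoped Classical in
theorem measurable_of_dependsOn {S : Set (Sym2 (V d))} {f : Config d → ℝ≥0∞} (hf : Measurable f)
    (hS : DependsOn f S) :
    Measurable[⨆ e ∈ S, MeasurableSpace.comap (fun ω : Config d => ω e) inferInstance] f := by
  let ρ : Config d → Config d := fun ω e => if e ∈ S then ω e else false
  have h1 : f = f ∘ ρ := by
    ext ω; exact hS fun e he => by simp [ρ, he]
  rw [h1]
  refine @Measurable.comp _ _ _ (_) MeasurableSpace.pi _ _ _ hf ?_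
  rw [@measurable_pi_iff]
  intro e
  by_cases he : e ∈ S
  · simp only [ρ, he, if_true]
    rw [measurable_iff_comap_le]
    exact le_iSup₂_of_le e he le_rfl
  · simp only [ρ, he, if_false]
    exact measurable_const
theorem IsLRP.indep (hP : IsLRP J P) {S T : Set (Sym2 (V d))} (hST : Disjoint S T)
    {f g : Config d → ℝ≥0∞} (hf : Measurable f) (hg : Measurable g)
    (hfS : DependsOn f S) (hgT : DependsOn g T) :
    ∫⁻ ω, f ω * g ω ∂P β = (∫⁻ ω, f ω ∂P β) * ∫⁻ ω, g ω ∂P β := by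
  have hle : ∀ e : Sym2 (V d), MeasurableSpace.comap (fun ω : Config d => ω e) inferInstance ≤
    MeasurableSpace.pi := fun e => measurable_iff_comap_le.1 (measurable_pi_apply e)
  exact ProbabilityTheory.lintegral_mul_eq_lintegral_mul_lintegral_of_independent_measurableSpace
    (iSup₂_le fun e _ => hle e) (iSup₂_le fun e _ => hle e)
    (ProbabilityTheory.indep_iSup_of_disjoint hle (hP.iIndep β) hST)
    (measurable_of_dependsOn hf hfS) (measurable_of_dependsOn hg hgT)
def Dep (A : Set (Config d)) (S : Set (Sym2 (V d))) : Prop :=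
  ∀ ω ω' : Config d, (∀ e ∈ S, ω e = ω' e) → (ω ∈ A ↔ ω' ∈ A)
theorem Dep.mono {A : Set (Config d)} {S T : Set (Sym2 (V d))} (h : Dep A S) (hST : S ⊆ T) :
    Dep A T := fun ω ω' hh => h ω ω' fun e he => hh e (hST he)
theorem Dep.inter {A B : Set (Config d)} {S T : Set (Sym2 (V d))} (h : Dep A S) (h' : Dep B T) :
    Dep (A ∩ B) (S ∪ T) := fun ω ω' hh =>
  and_congr (h ω ω' fun e he => hh e (Or.inl he)) (h' ω ω' fun e he => hh e (Or.inr he))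
theorem Dep.indicator {A : Set (Config d)} {S : Set (Sym2 (V d))} (h : Dep A S) :
    DependsOn (A.indicator (fun _ => (1 : ℝ≥0∞))) S := by
  intro ω ω' hh
  have := h ω ω' hh
  by_cases h1 : ω ∈ A
  · simp [h1, this.1 h1]
  · simp [h1, mt this.2 h1]
theorem IsLRP.indep_set (hP : IsLRP J P) {S T : Set (Sym2 (V d))} (hST : Disjoint S T)
    {A B : Set (Config d)} (hA : MeasurableSet A) (hB : MeasurableSet B)
    (hAS : Dep A S) (hBT : Dep B T) : P β (A ∩ B) = P β A * P β B := by
  have := hP.indep (β := β) hST (measurable_const.indicator hA) (measurable_const.indicator hB)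
    hAS.indicator hBT.indicator
  rw [lintegral_indicator_const hA, lintegral_indicator_const hB, one_mul, one_mul] at this
  rw [← this, ← lintegral_indicator_one (hA.inter hB)]
  congr 1; ext ω
  by_cases h1 : ω ∈ A <;> by_cases h2 : ω ∈ B <;> simp [h1, h2]
theorem IsLRP.indep_set_fun (hP : IsLRP J P) {S T : Set (Sym2 (V d))} (hST : Disjoint S T)
    {A : Set (Config d)} {g : Config d → ℝ≥0∞} (hA : MeasurableSet A) (hg : Measurable g)
    (hAS : Dep A S) (hgT : DependsOn g T) :
    ∫⁻ ω in A, g ω ∂P β = P β A * ∫⁻ ω, g ω ∂P β := by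
  have := hP.indep (β := β) hST (measurable_const.indicator hA) hg
    hAS.indicator hgT
  rw [lintegral_indicator_const hA, one_mul] at this
  rw [← this, ← lintegral_indicator hA]
  congr 1; ext ω
  by_cases h1 : ω ∈ A <;> simp [h1]
theorem dep_open (e : Sym2 (V d)) : Dep {ω : Config d | ω e = true} {e} := by
  intro ω ω' h; simp [h e rfl]
theorem measurableSet_of_dep (s : Finset (Sym2 (V d))) {A : Set (Config d)} (h : Dep A s) :
    MeasurableSet A := by
  classical
  let r : Config d → (s → Bool) := fun ω e => ω e
  have : A = r ⁻¹' (r '' A) := by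
    ext ω
    refine ⟨fun h => ⟨ω, h, rfl⟩, ?_⟩
    rintro ⟨ω', h', h2⟩
    exact (h ω' ω fun e he => congrFun h2 ⟨e, he⟩).1 h'
  rw [this]
  exact (measurable_pi_iff.2 fun e => measurable_pi_apply _) (Set.toFinite _).measurableSet
def Inc (A : Set (Config d)) : Prop :=
  ∀ ω ω' : Config d, (∀ e, ω e = true → ω' e = true) → ω ∈ A → ω' ∈ A
def cor (p : Config d × Config d) : Config d := fun e => p.1 e || p.2 e
theorem measurable_cor : Measurable (cor (d := d)) := by
  rw [measurable_pi_iff]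
  intro e
  have h1 : Measurable fun p : Config d × Config d => (p.1 e, p.2 e) :=
    ((measurable_pi_apply e).comp measurable_fst).prodMk ((measurable_pi_apply e).comp measurable_snd)
  exact (measurable_of_countable (fun q : Bool × Bool => q.1 || q.2)).comp h1
theorem IsLRP.coupling (hJ : KernelHyp d J α c C) (hP : IsLRP J P) {ε : ℝ} (hβ : 0 ≤ β)
    (hε : 0 ≤ ε) : P (β + ε) = ((P β).prod (P ε)).map cor := by
  haveI := hP.prob
  haveI : IsProbabilityMeasure (((P β).prod (P ε)).map cor) :=
    Measure.isProbabilityMeasure_map measurable_cor.aemeasurable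
  apply ext_closed
  intro s
  rw [Measure.map_apply measurable_cor (measurableSet_closed s)]
  have : cor ⁻¹' {ω : Config d | ∀ e ∈ s, ω e = false} =
      {ω : Config d | ∀ e ∈ s, ω e = false} ×ˢ {ω : Config d | ∀ e ∈ s, ω e = false} := by
    ext p
    simp only [cor, Set.mem_preimage, Set.mem_setOf_eq, Bool.or_eq_false_iff, mem_prod]
    grind
  rw [this, Measure.prod_prod, hP.closed_eq hJ hβ, hP.closed_eq hJ hε,
    hP.closed_eq hJ (add_nonneg hβ hε), ← ofReal_mul (exp_pos _).le, ← Real.exp_add]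
  ring_nf
theorem IsLRP.mono (hJ : KernelHyp d J α c C) (hP : IsLRP J P) {β' : ℝ} (hβ : 0 ≤ β)
    (hε : β ≤ β') {A : Set (Config d)} (hA : Inc A) (hm : MeasurableSet A) : P β A ≤ P β' A := by
  haveI := hP.prob
  have h := hP.coupling hJ (ε := β' - β) hβ (by linarith)
  rw [add_sub_cancel] at h
  rw [h, Measure.map_apply measurable_cor hm]
  calc P β A = (P β).prod (P (β' - β)) (A ×ˢ univ) := by simp
    _ ≤ _ := measure_mono fun p hp => hA p.1 _ (fun e he => by simp [cor, he]) hp.1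
theorem IsLRP.lip (hJ : KernelHyp d J α c C) (hP : IsLRP J P) {β' : ℝ} (hβ : 0 ≤ β)
    (hε : β ≤ β') (s : Finset (Sym2 (V d))) {A : Set (Config d)} (hA : Dep A s) :
    P β' A ≤ P β A + ofReal ((β' - β) * ∑ e ∈ s, wt J e) := by
  haveI := hP.prob
  have hm := measurableSet_of_dep s hA
  have h := hP.coupling hJ (ε := β' - β) hβ (by linarith)
  rw [add_sub_cancel] at h
  rw [h, Measure.map_apply measurable_cor hm]
  have h2 : P (β' - β) {ω | ∃ e ∈ s, ω e = true} ≤ ofReal ((β' - β) * ∑ e ∈ s, wt J e) := by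
    have : {ω : Config d | ∃ e ∈ s, ω e = true} = ⋃ e ∈ s, {ω | ω e = true} := by ext; simp
    rw [this]
    refine (measure_biUnion_finset_le _ _).trans ?_
    rw [mul_sum, ofReal_sum_of_nonneg fun e _ => mul_nonneg (by linarith) (hJ.wt_nonneg e)]
    exact sum_le_sum fun e _ => (hP.open_eq e).trans_le (hJ.edgeProb_le e)
  calc (P β).prod (P (β' - β)) (cor ⁻¹' A)
      ≤ (P β).prod (P (β' - β)) (A ×ˢ univ ∪ univ ×ˢ {ω | ∃ e ∈ s, ω e = true}) := by
        apply measure_mono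
        intro p hp
        by_cases h3 : ∃ e ∈ s, p.2 e = true
        · exact Or.inr ⟨trivial, h3⟩
        · refine Or.inl ⟨?_, trivial⟩
          push Not at h3
          exact (hA _ _ fun e he => by simp [cor, h3 e he]).1 hp
    _ ≤ P β A + P (β' - β) {ω | ∃ e ∈ s, ω e = true} := by
        refine (measure_union_le _ _).trans ?_
        simp
    _ ≤ _ := by gcongr
def shift (z : V d) (ω : Config d) : Config d := fun e => ω (Sym2.map (· + z) e)
theorem measurable_shift (z : V d) : Measurable (shift z) :=
  measurable_pi_iff.2 fun _ => measurable_pi_apply _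
theorem IsLRP.map_shift (hJ : KernelHyp d J α c C) (hP : IsLRP J P) (hβ : 0 ≤ β) (z : V d) :
    (P β).map (shift z) = P β := by
  haveI := hP.prob β
  haveI := Measure.isProbabilityMeasure_map (μ := P β) (measurable_shift z).aemeasurable
  apply ext_closed
  intro s
  classical
  rw [Measure.map_apply (measurable_shift z) (measurableSet_closed s)]
  have : shift z ⁻¹' {ω : Config d | ∀ e ∈ s, ω e = false} =
      {ω : Config d | ∀ e ∈ s.image (Sym2.map (· + z)), ω e = false} := by
    ext ω; simp [shift]
  rw [this, hP.closed_eq hJ hβ, hP.closed_eq hJ hβ, sum_image]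
  · congr 4
    ext e
    induction e with | _ x y => rw [Sym2.map_mk, hJ.wt_mk, hJ.wt_mk, hJ.transInv]
  · exact (Sym2.map.injective (add_left_injective z)).injOn
theorem IsLRP.open_lower (hJ : KernelHyp d J α c C) (hP : IsLRP J P) (hβ : 0 ≤ β)
    (T : Finset (Sym2 (V d))) {s : ℝ} (hs0 : 0 ≤ s) (hs : s ≤ β * ∑ e ∈ T, wt J e) :
    ofReal s ≤ P β {ω | ∃ e ∈ T, ω e = true} + ofReal (s ^ 2) := by
  haveI := hP.prob β
  have h1 : {ω : Config d | ∃ e ∈ T, ω e = true} = {ω : Config d | ∀ e ∈ T, ω e = false}ᶜ := by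
    ext; simp
  rw [h1, prob_compl_eq_one_sub (measurableSet_closed T), hP.closed_eq hJ hβ, ← ofReal_one,
    ← ofReal_sub _ (exp_pos _).le, ← ofReal_add _ (sq_nonneg s)]
  · apply ofReal_le_ofReal
    have h2 : exp (-β * ∑ e ∈ T, wt J e) ≤ exp (-s) := exp_le_exp.2 (by linarith)
    have h3 : exp (-s) ≤ 1 - s + s ^ 2 := by
      by_cases h : s ≤ 1
      · have := Real.abs_exp_sub_one_sub_id_le (x := -s) (by rw [abs_neg, abs_of_nonneg hs0]; exact h)
        rw [abs_le] at this
        nlinarith [this.2]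
      · have : exp (-s) ≤ 1 := exp_le_one_iff.2 (by linarith)
        nlinarith
    linarith
  · have h2 : exp (-β * ∑ e ∈ T, wt J e) ≤ 1 := exp_le_one_iff.2 (by linarith)
    linarith
end Framework
theorem rtg_mono {X : Type*} {r p : X → X → Prop} (h : ∀ a b, r a b → p a b) {a b : X}
    (hab : Relation.ReflTransGen r a b) : Relation.ReflTransGen p a b :=
  Relation.ReflTransGen.mono h _ _ hab
section Conn
variable {d : ℕ} {J : V d → V d → ℝ} {α c C : ℝ} {P : ℝ → Measure (Config d)} {β : ℝ}
variable {ω ω' : Config d} {S T : Set (V d)} {x y z : V d}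
theorem adj.symm (h : adj ω x y) : adj ω y x := ⟨h.1.symm, by rw [Sym2.eq_swap]; exact h.2⟩
theorem connIn.refl (hx : x ∈ S) : connIn ω S x x := ⟨hx, hx, .refl⟩
theorem connIn.trans (h : connIn ω S x y) (h' : connIn ω S y z) : connIn ω S x z :=
  ⟨h.1, h'.2.1, h.2.2.trans h'.2.2⟩
theorem connIn.symm (h : connIn ω S x y) : connIn ω S y x := by
  refine ⟨h.2.1, h.1, ?_⟩
  have h1 := Relation.reflTransGen_swap.2 h.2.2
  refine rtg_mono ?_ h1
  rintro a b ⟨ha, hb, hab⟩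
  exact ⟨hb, ha, hab.symm⟩
theorem connIn.step (hx : x ∈ S) (hy : y ∈ S) (h : adj ω x y) : connIn ω S x y :=
  ⟨hx, hy, .single ⟨hx, hy, h⟩⟩
theorem connIn.mono (h : connIn ω S x y) (hST : S ⊆ T) : connIn ω T x y :=
  ⟨hST h.1, hST h.2.1, rtg_mono (fun _ _ hh => ⟨hST hh.1, hST hh.2.1, hh.2.2⟩) h.2.2⟩
theorem connIn.inc (h : connIn ω S x y) (hh : ∀ e, ω e = true → ω' e = true) : connIn ω' S x y :=
  ⟨h.1, h.2.1, rtg_mono (fun _ _ h' => ⟨h'.1, h'.2.1, h'.2.2.1, hh _ h'.2.2.2⟩) h.2.2⟩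
theorem connIn_univ : connIn ω univ x y ↔ conn ω x y := by
  simp [connIn, conn]
theorem connIn_induction {p : V d → Prop} (h : connIn ω S x y) (h0 : p x)
    (hs : ∀ a b, connIn ω S x a → p a → b ∈ S → adj ω a b → p b) : p y := by
  obtain ⟨hx, -, h⟩ := h
  have : connIn ω S x y ∧ p y := by
    induction h with
    | refl => exact ⟨.refl hx, h0⟩
    | tail _ hab ih =>
      exact ⟨ih.1.trans (.step hab.1 hab.2.1 hab.2.2), hs _ _ ih.1 ih.2 hab.2.1 hab.2.2⟩
  exact this.2
def Cl (ω : Config d) (S : Set (V d)) (x : V d) : Set (V d) := {y | connIn ω S x y}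
theorem mem_Cl : y ∈ Cl ω S x ↔ connIn ω S x y := Iff.rfl
theorem Cl_subset : Cl ω S x ⊆ S := fun _ h => h.2.1
theorem Cl_univ : Cl ω univ x = cluster ω x := by
  ext y; exact connIn_univ
theorem Cl_eq_of_mem (h : y ∈ Cl ω S x) : Cl ω S y = Cl ω S x := by
  ext w; exact ⟨fun h' => connIn.trans h h', fun h' => connIn.trans (connIn.symm h) h'⟩
def Ein (S : Set (V d)) : Set (Sym2 (V d)) := {e | ∀ x ∈ e, x ∈ S}
theorem mk_mem_Ein : s(x, y) ∈ Ein S ↔ x ∈ S ∧ y ∈ S := by simp [Ein]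
theorem connIn.congr (h : connIn ω S x y) (hh : ∀ e ∈ Ein S, ω e = ω' e) : connIn ω' S x y :=
  ⟨h.1, h.2.1, rtg_mono (fun _ _ h' => ⟨h'.1, h'.2.1, h'.2.2.1, by
    rw [← hh _ (mk_mem_Ein.2 ⟨h'.1, h'.2.1⟩)]; exact h'.2.2.2⟩) h.2.2⟩
theorem Dep_connIn (S : Set (V d)) (x y : V d) : Dep {ω | connIn ω S x y} (Ein S) :=
  fun _ _ hh => ⟨fun h => connIn.congr h hh, fun h => connIn.congr h fun e he => (hh e he).symm⟩
theorem Inc_connIn (S : Set (V d)) (x y : V d) : Inc {ω | connIn ω S x y} :=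
  fun _ _ hh h => connIn.inc h hh
theorem Dep_Cl (S : Set (V d)) (z : V d) (C : Set (V d)) :
    Dep {ω | Cl ω S z = C} (Ein S \ Ein Cᶜ) := by
  have key : ∀ ω ω' : Config d, (∀ e ∈ Ein S \ Ein Cᶜ, ω e = ω' e) → Cl ω S z = C →
      Cl ω' S z = C := by
    intro ω ω' hh h
    have hagree : ∀ a b, a ∈ C → a ∈ S → b ∈ S → ω s(a, b) = ω' s(a, b) := by
      intro a b ha haS hb
      exact hh _ ⟨mk_mem_Ein.2 ⟨haS, hb⟩, fun h' => (mk_mem_Ein.1 h').1 ha⟩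
    apply Set.Subset.antisymm
    · intro y hy
      refine connIn_induction hy ?_ ?_
      · rw [← h]; exact connIn.refl hy.1
      · intro a b ha haC hb hab
        rw [← h] at haC ⊢
        refine connIn.trans haC (.step haC.2.1 hb ⟨hab.1, ?_⟩)
        rw [hagree a b (h ▸ haC) haC.2.1 hb]; exact hab.2
    · intro y hy
      rw [← h] at hy
      refine connIn_induction (p := fun y => y ∈ Cl ω' S z) hy (connIn.refl hy.1) ?_
      intro a b ha haC hb hab
      refine connIn.trans haC (.step ha.2.1 hb ⟨hab.1, ?_⟩)
      rw [← hagree a b (h ▸ ha) ha.2.1 hb]; exact hab.2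
  exact fun ω ω' hh => ⟨key _ _ hh, key _ _ fun e he => (hh e he).symm⟩
theorem measurableSet_connIn (S : Set (V d)) (x y : V d) :
    MeasurableSet {ω : Config d | connIn ω S x y} := by
  by_cases hx : x ∈ S
  swap
  · convert MeasurableSet.empty; simp [connIn, hx]
  by_cases hy : y ∈ S
  swap
  · convert MeasurableSet.empty; simp [connIn, hy]
  let R : ℕ → V d → Set (Config d) := fun n => Nat.rec (fun y => {ω | x = y})
    (fun _ r y => ⋃ a, r a ∩ {ω | a ∈ S ∧ y ∈ S ∧ adj ω a y}) n
  have hR : ∀ n y, MeasurableSet (R n y) := by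
    intro n
    induction n with
    | zero => intro y; exact MeasurableSet.const _
    | succ n ih =>
      intro y
      refine MeasurableSet.iUnion fun a => (ih a).inter ?_
      by_cases h : a ∈ S ∧ y ∈ S ∧ a ≠ y
      · convert measurableSet_open s(a, y) using 1
        ext ω; simp [adj, h]
      · convert MeasurableSet.empty
        ext ω; simp only [adj, mem_ofPred_eq, mem_empty_iff_false, iff_false]; tauto
  have : {ω : Config d | connIn ω S x y} = ⋃ n, R n y := by
    ext ω
    simp only [connIn, hx, hy, true_and, mem_ofPred_eq, mem_iUnion]
    constructor
    · intro h
      clear hy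
      induction h with
      | refl => exact ⟨0, rfl⟩
      | @tail b y _ hab ih =>
        obtain ⟨n, hn⟩ := ih
        exact ⟨n + 1, mem_iUnion.2 ⟨b, hn, hab⟩⟩
    · rintro ⟨n, hn⟩
      clear hy
      revert hn
      revert y
      induction n with
      | zero => intro y hn; cases (show x = y from hn); exact .refl
      | succ n ih =>
        intro y hn
        obtain ⟨a, ha, ha'⟩ := mem_iUnion.1 hn
        exact (ih a ha).tail ha'
  rw [this]
  exact MeasurableSet.iUnion fun n => hR n y
theorem measurableSet_Cl (S : Set (V d)) (z : V d) (C : Set (V d)) :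
    MeasurableSet {ω | Cl ω S z = C} := by
  have : {ω : Config d | Cl ω S z = C} = ⋂ y, {ω | connIn ω S z y ↔ y ∈ C} := by
    ext ω; simp [Set.ext_iff, mem_Cl]
  rw [this]
  refine MeasurableSet.iInter fun y => ?_
  by_cases hy : y ∈ C
  · simpa [hy] using measurableSet_connIn S z y
  · simp only [hy, iff_false]; exact (measurableSet_connIn S z y).compl
theorem last_exit (K : Set (V d)) (h : connIn ω S z x) (hz : z ∈ K) (hx : x ∉ K) :
    ∃ u v, u ∈ K ∧ u ∈ S ∧ v ∉ K ∧ v ∈ S ∧ adj ω u v ∧ connIn ω (S \ K) v x := by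
  obtain ⟨-, hxS, h⟩ := h
  have : connIn ω (S \ K) z x ∨
      ∃ u v, u ∈ K ∧ u ∈ S ∧ v ∉ K ∧ v ∈ S ∧ adj ω u v ∧ connIn ω (S \ K) v x := by
    clear hz
    induction h using Relation.ReflTransGen.head_induction_on with
    | refl => exact Or.inl (connIn.refl (S := S \ K) ⟨hxS, hx⟩)
    | @head a b hab _ ih =>
      rcases ih with ih | ih
      · by_cases ha : a ∈ K
        · exact Or.inr ⟨a, b, ha, hab.1, ih.1.2, hab.2.1, hab.2.2, ih⟩
        · exact Or.inl ((connIn.step (S := S \ K) ⟨hab.1, ha⟩ ih.1 hab.2.2).trans ih)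
      · exact Or.inr ih
  rcases this with h | h
  · exact absurd hz h.1.2
  · exact h
theorem connIn_iUnion {F : ℕ → Set (V d)} (hF : Monotone F) :
    connIn ω (⋃ n, F n) x y ↔ ∃ n, connIn ω (F n) x y := by
  constructor
  · intro h
    obtain ⟨hx, -⟩ := id h
    obtain ⟨n0, hn0⟩ := mem_iUnion.1 hx
    refine connIn_induction (p := fun y => ∃ n, connIn ω (F n) x y) h ⟨n0, .refl hn0⟩ ?_
    rintro a b - ⟨n, hn⟩ hb hab
    obtain ⟨m, hm⟩ := mem_iUnion.1 hb
    refine ⟨max n m, (hn.mono (hF (le_max_left _ _))).trans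
      (.step (hF (le_max_left _ _) hn.2.1) (hF (le_max_right _ _) hm) hab)⟩
  · rintro ⟨n, hn⟩
    exact hn.mono (Set.subset_iUnion _ _)
noncomputable def Bx (d r : ℕ) : Finset (V d) := Finset.Icc (fun _ => -(r : ℤ)) (fun _ => (r : ℤ))
theorem mem_Bx {r : ℕ} : x ∈ Bx d r ↔ normInf x ≤ r := by
  simp only [Bx, Finset.mem_Icc, Pi.le_def, normInf, Finset.sup_le_iff, Finset.mem_univ, true_imp_iff]
  rw [← forall_and]
  refine forall_congr' fun i => ?_
  omega
theorem card_Bx (d r : ℕ) : (Bx d r).card = (2 * r + 1) ^ d := by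
  rw [Bx, Pi.card_Icc]
  simp only [Int.card_Icc, Finset.prod_const, Finset.card_univ, Fintype.card_fin]
  congr 1; omega
theorem Bx_mono {r s : ℕ} (h : r ≤ s) : (Bx d r : Set (V d)) ⊆ Bx d s := by
  intro x; simp only [mem_coe, mem_Bx]; omega
theorem iUnion_Bx : (⋃ r, (Bx d r : Set (V d))) = univ := by
  ext x; simp only [mem_iUnion, mem_coe, mem_Bx, Set.mem_univ, iff_true]; exact ⟨_, le_rfl⟩
theorem conn_iff_Bx : connIn ω univ x y ↔ ∃ n, connIn ω (Bx d n) x y := by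
  rw [← iUnion_Bx]; exact connIn_iUnion fun _ _ h => Bx_mono h
theorem Ein_finset (B : Finset (V d)) : Ein (B : Set (V d)) = (B.sym2 : Set (Sym2 (V d))) := by
  ext e; simp only [Ein, mem_coe, Finset.mem_sym2_iff]; rfl
noncomputable def tp (P : ℝ → Measure (Config d)) (β : ℝ) (S : Set (V d)) (x y : V d) : ℝ≥0∞ :=
  P β {ω | connIn ω S x y}
theorem tp_mono (hST : S ⊆ T) : tp P β S x y ≤ tp P β T x y :=
  measure_mono fun _ h => connIn.mono h hST
theorem tp_comm : tp P β S x y = tp P β S y x := by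
  unfold tp; congr 1; ext ω; exact ⟨connIn.symm, connIn.symm⟩
theorem tp_zero (h : y ∉ S) : tp P β S x y = 0 := by
  have : {ω : Config d | connIn ω S x y} = ∅ := by ext; simp [connIn, h]
  rw [tp, this, measure_empty]
theorem IsLRP.tp_le_one (hP : IsLRP J P) : tp P β S x y ≤ 1 := by
  have := hP.prob β
  exact prob_le_one
theorem IsLRP.tp_self (hP : IsLRP J P) (h : x ∈ S) : tp P β S x x = 1 := by
  have := hP.prob β
  have h1 : {ω : Config d | connIn ω S x x} = univ := by ext; simp [connIn.refl h]
  rw [tp, h1, measure_univ]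
theorem IsLRP.tp_beta_mono (hJ : KernelHyp d J α c C) (hP : IsLRP J P) {β' : ℝ} (hβ : 0 ≤ β)
    (h : β ≤ β') : tp P β S x y ≤ tp P β' S x y :=
  hP.mono hJ hβ h (Inc_connIn S x y) (measurableSet_connIn S x y)
theorem twoPoint_eq : twoPoint P β x y = tp P β univ x y := by
  unfold twoPoint tp; congr 1; ext ω; exact connIn_univ.symm
theorem connIn_shift {w : V d} :
    connIn (shift w ω) S x y ↔ connIn ω ((· + w) '' S) (x + w) (y + w) := by
  have hadj : ∀ a b, adj (shift w ω) a b ↔ adj ω (a + w) (b + w) := by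
    intro a b; simp [adj, shift]
  constructor
  · intro h
    refine connIn_induction (p := fun y => connIn ω ((· + w) '' S) (x + w) (y + w)) h
      (.refl ⟨x, h.1, rfl⟩) ?_
    intro a b ha ha' hb hab
    exact ha'.trans (.step ⟨a, ha.2.1, rfl⟩ ⟨b, hb, rfl⟩ ((hadj a b).1 hab))
  · intro h
    have : connIn (shift w ω) S x (y + w - w) := by
      have hx : x ∈ S := by obtain ⟨x', hx', h'⟩ := h.1; rwa [← add_right_cancel h']
      refine connIn_induction (p := fun y' => connIn (shift w ω) S x (y' - w)) h
        (by simpa using connIn.refl hx) ?_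
      rintro a b ha ha' ⟨b', hb, rfl⟩ hab
      refine ha'.trans (.step ha'.2.1 (by simpa using hb) ?_)
      rw [hadj]; simpa using hab
    simpa using this
theorem IsLRP.lintegral_shift (hJ : KernelHyp d J α c C) (hP : IsLRP J P) (hβ : 0 ≤ β) (w : V d)
    {f : Config d → ℝ≥0∞} (hf : Measurable f) : ∫⁻ ω, f (shift w ω) ∂P β = ∫⁻ ω, f ω ∂P β := by
  conv_rhs => rw [← hP.map_shift hJ hβ w]
  rw [lintegral_map hf (measurable_shift w)]
theorem IsLRP.tp_shift (hJ : KernelHyp d J α c C) (hP : IsLRP J P) (hβ : 0 ≤ β) (w : V d) :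
    tp P β ((· + w) '' S) (x + w) (y + w) = tp P β S x y := by
  unfold tp
  conv_rhs => rw [← hP.map_shift hJ hβ w]
  rw [Measure.map_apply (measurable_shift w) (measurableSet_connIn _ _ _)]
  congr 1; ext ω; exact connIn_shift.symm
theorem IsLRP.tp_univ_shift (hJ : KernelHyp d J α c C) (hP : IsLRP J P) (hβ : 0 ≤ β) (w : V d) :
    tp P β univ (x + w) (y + w) = tp P β univ x y := by
  rw [← hP.tp_shift hJ hβ w (x := x)]
  congr 1; ext y; exact ⟨fun _ => ⟨y - w, trivial, by simp⟩, fun _ => trivial⟩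
theorem IsLRP.tp_univ_zero (hJ : KernelHyp d J α c C) (hP : IsLRP J P) (hβ : 0 ≤ β) :
    tp P β univ x y = tp P β univ 0 (y - x) := by
  rw [← hP.tp_univ_shift hJ hβ x (x := 0)]; simp
noncomputable def sz (ω : Config d) (S : Set (V d)) (x : V d) : ℝ≥0∞ := ((Cl ω S x).encard : ℝ≥0∞)
theorem sz_eq_tsum : sz ω S x = ∑' y, indicator {ω | connIn ω S x y} (fun _ => 1) ω := by
  rw [sz, ← tsum_set_one, tsum_subtype (Cl ω S x) (fun _ => (1 : ℝ≥0∞))]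
  rfl
theorem measurable_sz (S : Set (V d)) (x : V d) : Measurable fun ω => sz ω S x := by
  simp only [sz_eq_tsum]
  exact Measurable.ennreal_tsum fun y => measurable_const.indicator (measurableSet_connIn S x y)
theorem lintegral_sz : ∫⁻ ω, sz ω S x ∂P β = ∑' y, tp P β S x y := by
  simp only [sz_eq_tsum]
  rw [lintegral_tsum fun y => (measurable_const.indicator (measurableSet_connIn S x y)).aemeasurable]
  congr 1; ext y
  rw [lintegral_indicator_const (measurableSet_connIn S x y), one_mul, tp]
theorem sz_mono (hST : S ⊆ T) : sz ω S x ≤ sz ω T x := by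
  unfold sz; gcongr; exact fun y hy => connIn.mono hy hST
theorem sz_shift {w : V d} : sz (shift w ω) S x = sz ω ((· + w) '' S) (x + w) := by
  have : Cl ω ((· + w) '' S) (x + w) = (· + w) '' Cl (shift w ω) S x := by
    ext y
    simp only [Set.mem_image, mem_Cl, connIn_shift]
    constructor
    · intro h; exact ⟨y - w, by simpa using h, by simp⟩
    · rintro ⟨y, h, rfl⟩; exact h
  rw [sz, sz, this, (add_left_injective w).encard_image]
def Appr (A : Set (Config d)) : Prop :=
  ∃ F : ℕ → Set (Config d), Monotone F ∧ A = (⋃ n, F n) ∧ ∀ n, ∃ s : Finset (Sym2 (V d)), Dep (F n) s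
theorem Appr_connIn (x y : V d) : Appr {ω | connIn ω univ x y} := by
  refine ⟨fun n => {ω | connIn ω (Bx d n) x y}, ?_, ?_, ?_⟩
  · intro m n hmn ω h; exact connIn.mono h (Bx_mono hmn)
  · ext ω; simp [conn_iff_Bx]
  · intro n; exact ⟨(Bx d n).sym2, by rw [← Ein_finset]; exact Dep_connIn _ _ _⟩
theorem le_sz_iff {k : ℕ} : (k : ℝ≥0∞) ≤ sz ω univ x ↔ ∃ n, (k : ℝ≥0∞) ≤ sz ω (Bx d n) x := by
  constructor
  · intro h
    have h' : (k : ℕ∞) ≤ (Cl ω univ x).encard := by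
      unfold sz at h; exact_mod_cast h
    obtain ⟨t, ht, htk⟩ := Set.exists_subset_encard_eq h'
    have hfin : t.Finite := Set.finite_of_encard_eq_coe htk
    have : ∀ y ∈ t, ∃ n, connIn ω (Bx d n) x y := fun y hy => conn_iff_Bx.1 (ht hy)
    choose! f hf using this
    refine ⟨hfin.toFinset.sup f, ?_⟩
    have h2 : t ⊆ Cl ω (Bx d (hfin.toFinset.sup f)) x := fun y hy =>
      (hf y hy).mono (Bx_mono (le_sup (f := f) (hfin.mem_toFinset.2 hy)))
    have h3 := encard_le_encard h2
    rw [htk] at h3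
    unfold sz; exact_mod_cast h3
  · rintro ⟨n, hn⟩
    exact hn.trans (sz_mono (subset_univ _))
theorem sz_congr (hh : ∀ e ∈ Ein S, ω e = ω' e) : sz ω S x = sz ω' S x := by
  have : Cl ω S x = Cl ω' S x := by
    ext y; exact Dep_connIn _ _ _ ω ω' hh
  simp [sz, this]
theorem Dep_sz (k : ℝ≥0∞) (S : Set (V d)) (x : V d) : Dep {ω | k ≤ sz ω S x} (Ein S) :=
  fun ω ω' hh => by simp [sz_congr hh]
theorem Inc_sz (k : ℝ≥0∞) (S : Set (V d)) (x : V d) : Inc {ω | k ≤ sz ω S x} := by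
  intro ω ω' hh h
  refine le_trans (show k ≤ sz ω S x from h) ?_
  unfold sz; gcongr; exact fun y hy => connIn.inc hy hh
theorem measurableSet_sz (k : ℝ≥0∞) (S : Set (V d)) (x : V d) : MeasurableSet {ω | k ≤ sz ω S x} :=
  measurableSet_le measurable_const (measurable_sz S x)
theorem Appr_sz (k : ℕ) (x : V d) : Appr {ω | (k : ℝ≥0∞) ≤ sz ω univ x} := by
  refine ⟨fun n => {ω | (k : ℝ≥0∞) ≤ sz ω (Bx d n) x}, ?_, ?_, ?_⟩
  · intro m n hmn ω h; exact h.trans (sz_mono (Bx_mono hmn))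
  · ext ω
    simp only [mem_ofPred_eq, mem_iUnion, le_sz_iff]
  · intro n
    exact ⟨(Bx d n).sym2, by rw [← Ein_finset]; exact Dep_sz _ _ _⟩
theorem min_sz (n : ℕ) : min (sz ω S x) n =
    ∑ k ∈ range n, indicator {ω | ((k + 1 : ℕ) : ℝ≥0∞) ≤ sz ω S x} (fun _ => (1 : ℝ≥0∞)) ω := by
  have hT : ∀ m : ℕ, min (m : ℝ≥0∞) n = ∑ k ∈ range n, if k + 1 ≤ m then (1 : ℝ≥0∞) else 0 := by
    intro m
    rw [← (Nat.mono_cast (α := ℝ≥0∞)).map_min, Finset.sum_ite, Finset.sum_const_zero, add_zero, sum_const, nsmul_one]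
    congr 1
    have : (range n).filter (fun k => k + 1 ≤ m) = range (min m n) := by
      ext; simp; omega
    rw [this, Finset.card_range]
  have h2 : ∀ k : ℕ, indicator {ω | ((k + 1 : ℕ) : ℝ≥0∞) ≤ sz ω S x} (fun _ => (1 : ℝ≥0∞)) ω =
      if ((k + 1 : ℕ) : ℕ∞) ≤ (Cl ω S x).encard then 1 else 0 := by
    intro k
    have : ((k + 1 : ℕ) : ℝ≥0∞) ≤ sz ω S x ↔ ((k + 1 : ℕ) : ℕ∞) ≤ (Cl ω S x).encard := by
      unfold sz; exact_mod_cast Iff.rfl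
    simp only [indicator, mem_ofPred_eq, this]
  simp only [h2]
  unfold sz
  generalize (Cl ω S x).encard = m
  cases m with
  | top => simp
  | coe m =>
    rw [show ((m : ℕ∞) : ℝ≥0∞) = (m : ℝ≥0∞) by simp, hT m]
    norm_cast
noncomputable def Fn (P : ℝ → Measure (Config d)) (β : ℝ) (S : Set (V d)) (x : V d) (n : ℕ) : ℝ≥0∞ :=
  ∫⁻ ω, min (sz ω S x) n ∂P β
theorem Fn_eq (n : ℕ) : Fn P β S x n =
    ∑ k ∈ range n, P β {ω | ((k + 1 : ℕ) : ℝ≥0∞) ≤ sz ω S x} := by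
  simp only [Fn, min_sz]
  rw [lintegral_finset_sum _ fun k _ => measurable_const.indicator (measurableSet_sz _ _ _)]
  refine sum_congr rfl fun k _ => ?_
  rw [lintegral_indicator_const (measurableSet_sz _ _ _), one_mul]
theorem IsLRP.left_lim (hJ : KernelHyp d J α c C) (hP : IsLRP J P) {ι : Type*} (I : Finset ι)
    (A : ι → Set (Config d)) (hA : ∀ i, Appr (A i)) {βT : ℝ} (hβT : 0 < βT) {M : ℝ≥0∞}
    (h : ∀ β, 0 ≤ β → β < βT → ∑ i ∈ I, P β (A i) ≤ M) : ∑ i ∈ I, P βT (A i) ≤ M := by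
  choose F hF hAF s hs using hA
  have h1 : ∀ i β, P β (A i) = ⨆ n, P β (F i n) := by
    intro i β; rw [hAF i, (hF i).measure_iUnion]
  simp only [h1]
  rw [finsetSum_iSup_of_monotone (fun i m n hmn => measure_mono (hF i hmn))]
  refine iSup_le fun n => ?_
  refine ENNReal.le_of_forall_pos_le_add fun ε hε _ => ?_
  set W : ℝ := ∑ i ∈ I, ∑ e ∈ s i n, wt J e
  have hW : 0 ≤ W := sum_nonneg fun i _ => sum_nonneg fun e _ => hJ.wt_nonneg e
  set δ : ℝ := min (βT / 2) (ε / (W + 1))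
  have hδ : 0 < δ := lt_min (by linarith) (div_pos (by exact_mod_cast hε) (by linarith))
  have hδ' : δ ≤ βT / 2 := min_le_left _ _
  calc ∑ i ∈ I, P βT (F i n)
      ≤ ∑ i ∈ I, (P (βT - δ) (F i n) + ofReal (δ * ∑ e ∈ s i n, wt J e)) := by
        refine sum_le_sum fun i _ => ?_
        have := hP.lip hJ (β := βT - δ) (β' := βT) (by linarith) (by linarith) _ (hs i n)
        simpa using this
    _ ≤ ∑ i ∈ I, P (βT - δ) (A i) + ofReal (δ * W) := by
        rw [sum_add_distrib]
        gcongr with i hi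
        · rw [hAF i]; exact Set.subset_iUnion _ _
        · rw [← ofReal_sum_of_nonneg, ← mul_sum]
          exact fun i _ => mul_nonneg hδ.le (sum_nonneg fun e _ => hJ.wt_nonneg e)
    _ ≤ M + ε := by
        gcongr
        · exact h _ (by linarith) (by linarith)
        · rw [← ofReal_coe_nnreal]
          apply ofReal_le_ofReal
          calc δ * W ≤ (ε / (W + 1)) * (W + 1) := by
                gcongr
                · exact min_le_right _ _
                · linarith
            _ = ε := by field_simp
end Conn
section BK
variable {d : ℕ} {J : V d → V d → ℝ} {α c C : ℝ} {P : ℝ → Measure (Config d)} {β : ℝ}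
variable {ω ω' : Config d} {S T : Set (V d)} {x y z : V d}
def box (A B : Set (Config d)) : Set (Config d) :=
  {ω | ∃ ω1 ω2 : Config d, (∀ e, ω1 e = true → ω e = true) ∧ (∀ e, ω2 e = true → ω e = true) ∧
    (∀ e, ω1 e = true → ω2 e = false) ∧ ω1 ∈ A ∧ ω2 ∈ B}
theorem box_mono {A B A' B' : Set (Config d)} (hA : A ⊆ A') (hB : B ⊆ B') : box A B ⊆ box A' B' := by
  rintro ω ⟨ω1, ω2, h1, h2, h3, h4, h5⟩
  exact ⟨ω1, ω2, h1, h2, h3, hA h4, hB h5⟩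
theorem Inc_box (A B : Set (Config d)) : Inc (box A B) := by
  rintro ω ω' hh ⟨ω1, ω2, h1, h2, h3, h4, h5⟩
  exact ⟨ω1, ω2, fun e he => hh e (h1 e he), fun e he => hh e (h2 e he), h3, h4, h5⟩
open scoped Classical in
theorem Dep_box {A B : Set (Config d)} {s : Set (Sym2 (V d))} (hA : Dep A s) (hB : Dep B s) :
    Dep (box A B) s := by
  have key : ∀ ω ω' : Config d, (∀ e ∈ s, ω e = ω' e) → ω ∈ box A B → ω' ∈ box A B := by
    rintro ω ω' hh ⟨ω1, ω2, h1, h2, h3, h4, h5⟩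
    refine ⟨fun e => if e ∈ s then ω1 e else false, fun e => if e ∈ s then ω2 e else false,
      ?_, ?_, ?_, ?_, ?_⟩
    · intro e he
      by_cases h : e ∈ s
      · simp [h] at he; rw [← hh e h]; exact h1 e he
      · simp [h] at he
    · intro e he
      by_cases h : e ∈ s
      · simp [h] at he; rw [← hh e h]; exact h2 e he
      · simp [h] at he
    · intro e he
      by_cases h : e ∈ s
      · simp [h] at he ⊢; exact h3 e he
      · simp [h]
    · exact (hA _ _ fun e he => by simp [he]).1 h4
    · exact (hB _ _ fun e he => by simp [he]).1 h5
  exact fun ω ω' hh => ⟨key _ _ hh, key _ _ fun e he => (hh e he).symm⟩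
open scoped Classical in
def sl (e : Sym2 (V d)) (b : Bool) (A : Set (Config d)) : Set (Config d) :=
  {ω | Function.update ω e b ∈ A}
open scoped Classical in
theorem Dep_sl {e : Sym2 (V d)} {b : Bool} {A : Set (Config d)} {s : Finset (Sym2 (V d))}
    (hA : Dep A (insert e s : Finset (Sym2 (V d)))) : Dep (sl e b A) s := by
  intro ω ω' hh
  refine hA _ _ fun e' he' => ?_
  by_cases h : e' = e
  · subst h; simp
  · simp only [Function.update_of_ne h]
    apply hh
    simpa [h] using he'
theorem Inc_sl {e : Sym2 (V d)} {b : Bool} {A : Set (Config d)} (hA : Inc A) : Inc (sl e b A) := by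
  intro ω ω' hh h
  refine hA _ _ (fun e' he' => ?_) h
  by_cases h : e' = e
  · subst h; simpa using he'
  · rw [Function.update_of_ne h] at he' ⊢; exact hh _ he'
open scoped Classical in
theorem IsLRP.slice (hP : IsLRP J P) {e : Sym2 (V d)} {s : Finset (Sym2 (V d))} (he : e ∉ s)
    {A : Set (Config d)} (hA : Dep A (insert e s : Finset (Sym2 (V d)))) :
    P β A = P β {ω | ω e = false} * P β (sl e false A) + P β {ω | ω e = true} * P β (sl e true A) := by
  have hd : Disjoint ({e} : Set (Sym2 (V d))) (s : Set (Sym2 (V d))) := by simpa using he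
  have h0 : Dep {ω : Config d | ω e = false} {e} := by intro ω ω' h; simp [h e rfl]
  have m0 : MeasurableSet {ω : Config d | ω e = false} :=
    measurableSet_of_dep {e} (by simpa using h0)
  rw [← hP.indep_set hd m0 (measurableSet_of_dep s (Dep_sl hA)) h0 (Dep_sl hA),
    ← hP.indep_set hd (measurableSet_open e) (measurableSet_of_dep s (Dep_sl hA)) (dep_open e)
      (Dep_sl hA)]
  rw [← measure_inter_add_sdiff A m0]
  congr 2
  · ext ω
    simp only [mem_inter_iff, mem_ofPred_eq, sl]
    constructor
    · rintro ⟨h1, h2⟩; refine ⟨h2, ?_⟩; rw [← h2, Function.update_eq_self]; exact h1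
    · rintro ⟨h1, h2⟩; rw [← h1, Function.update_eq_self] at h2; exact ⟨h2, h1⟩
  · ext ω
    simp only [mem_inter_iff, mem_ofPred_eq, sl, Set.mem_sdiff, Bool.not_eq_false]
    constructor
    · rintro ⟨h1, h2⟩; refine ⟨h2, ?_⟩; rw [← h2, Function.update_eq_self]; exact h1
    · rintro ⟨h1, h2⟩; rw [← h1, Function.update_eq_self] at h2; exact ⟨h2, h1⟩
theorem sl_box_false (e : Sym2 (V d)) (A B : Set (Config d)) :
    sl e false (box A B) ⊆ box (sl e false A) (sl e false B) := by
  rintro ω ⟨ω1, ω2, h1, h2, h3, h4, h5⟩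
  have e1 : ω1 e = false := by
    by_contra h; simpa using h1 e (by simpa using h)
  have e2 : ω2 e = false := by
    by_contra h; simpa using h2 e (by simpa using h)
  refine ⟨ω1, ω2, ?_, ?_, h3, ?_, ?_⟩
  · intro e' he'
    have hne : e' ≠ e := by rintro rfl; simp [e1] at he'
    simpa [Function.update_of_ne hne] using h1 e' he'
  · intro e' he'
    have hne : e' ≠ e := by rintro rfl; simp [e2] at he'
    simpa [Function.update_of_ne hne] using h2 e' he'
  · change Function.update ω1 e false ∈ A
    rw [← e1, Function.update_eq_self]; exact h4
  · change Function.update ω2 e false ∈ B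
    rw [← e2, Function.update_eq_self]; exact h5
theorem sl_box_true (e : Sym2 (V d)) (A B : Set (Config d)) (hB : Inc B) :
    sl e true (box A B) ⊆ box (sl e true A) (sl e false B) ∪ box (sl e false A) (sl e true B) := by
  classical
  rintro ω ⟨ω1, ω2, h1, h2, h3, h4, h5⟩
  by_cases e1 : ω1 e = true
  · left
    have e2 := h3 e e1
    refine ⟨Function.update ω1 e false, ω2, ?_, ?_, ?_, ?_, ?_⟩
    · intro e' he'
      have hne : e' ≠ e := by rintro rfl; simp at he'
      rw [Function.update_of_ne hne] at he'
      simpa [Function.update_of_ne hne] using h1 e' he'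
    · intro e' he'
      have hne : e' ≠ e := by rintro rfl; simp [e2] at he'
      simpa [Function.update_of_ne hne] using h2 e' he'
    · intro e' he'
      have hne : e' ≠ e := by rintro rfl; simp at he'
      rw [Function.update_of_ne hne] at he'
      exact h3 e' he'
    · change Function.update _ e true ∈ A
      rw [Function.update_idem, ← e1, Function.update_eq_self]; exact h4
    · change Function.update ω2 e false ∈ B
      rw [← e2, Function.update_eq_self]; exact h5
  · right
    have e1' : ω1 e = false := by simpa using e1
    refine ⟨ω1, Function.update ω2 e false, ?_, ?_, ?_, ?_, ?_⟩
    · intro e' he'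
      have hne : e' ≠ e := by rintro rfl; simp [e1'] at he'
      simpa [Function.update_of_ne hne] using h1 e' he'
    · intro e' he'
      have hne : e' ≠ e := by rintro rfl; simp at he'
      rw [Function.update_of_ne hne] at he'
      simpa [Function.update_of_ne hne] using h2 e' he'
    · intro e' he'
      have hne : e' ≠ e := by rintro rfl; simp [e1'] at he'
      rw [Function.update_of_ne hne]
      exact h3 e' he'
    · change Function.update ω1 e false ∈ A
      rw [← e1', Function.update_eq_self]; exact h4
    · change Function.update _ e true ∈ B
      rw [Function.update_idem]
      refine hB ω2 _ (fun e' he' => ?_) h5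
      by_cases h : e' = e
      · subst h; simp
      · rw [Function.update_of_ne h]; exact he'
theorem IsLRP.bk (hP : IsLRP J P) (s : Finset (Sym2 (V d))) : ∀ (A B : Set (Config d)),
    Inc A → Inc B → Dep A s → Dep B s → P β (box A B) ≤ P β A * P β B := by
  classical
  have := hP.prob β
  induction s using induction_on with
  | empty =>
    intro A B iA iB dA dB
    by_cases h : (box A B).Nonempty
    · obtain ⟨ω, ω1, ω2, -, -, -, h4, h5⟩ := h
      have hA : A = univ := by ext ω'; simpa using (dA ω1 ω' (by simp)).1 h4
      have hB : B = univ := by ext ω'; simpa using (dB ω2 ω' (by simp)).1 h5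
      rw [hA, hB, measure_univ, one_mul]; exact prob_le_one
    · rw [Set.not_nonempty_iff_eq_empty.1 h]; simp
  | insert e s he ih =>
    intro A B iA iB dA dB
    set a0 := P β (sl e false A)
    set a1 := P β (sl e true A)
    set b0 := P β (sl e false B)
    set b1 := P β (sl e true B)
    set q := P β {ω | ω e = false}
    set p := P β {ω | ω e = true}
    have hpq : q + p = 1 := by
      have h1 : {ω : Config d | ω e = true} = {ω : Config d | ω e = false}ᶜ := by ext; simp
      have m0 : MeasurableSet {ω : Config d | ω e = false} :=
        measurableSet_of_dep {e} (by intro ω ω' h; simp [h e (by simp)])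
      have := measure_add_measure_compl (μ := P β) m0
      rw [← h1, measure_univ] at this
      exact this
    have dA0 : Dep (sl e false A) s := Dep_sl dA
    have dA1 : Dep (sl e true A) s := Dep_sl dA
    have dB0 : Dep (sl e false B) s := Dep_sl dB
    have dB1 : Dep (sl e true B) s := Dep_sl dB
    have mono01 : ∀ {A : Set (Config d)}, Inc A → sl e false A ⊆ sl e true A := by
      intro A hA ω hω
      refine hA _ _ (fun e' he' => ?_) hω
      by_cases h : e' = e
      · subst h; simp
      · rw [Function.update_of_ne h] at he' ⊢; exact he'
    set U := box (sl e true A) (sl e false B) ∪ box (sl e false A) (sl e true B)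
    set Z := box (sl e false A) (sl e false B)
    have hU1 : P β U + P β Z ≤ a1 * b0 + a0 * b1 := by
      have hZ : Z ⊆ box (sl e true A) (sl e false B) ∩ box (sl e false A) (sl e true B) :=
        Set.subset_inter (box_mono (mono01 iA) subset_rfl) (box_mono subset_rfl (mono01 iB))
      calc P β U + P β Z ≤ P β U + P β (box (sl e true A) (sl e false B) ∩ box (sl e false A) (sl e true B)) := by
            gcongr
        _ = P β (box (sl e true A) (sl e false B)) + P β (box (sl e false A) (sl e true B)) :=
            measure_union_add_inter _ (measurableSet_of_dep s (Dep_box dA0 dB1))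
        _ ≤ _ := add_le_add (ih _ _ (Inc_sl iA) (Inc_sl iB) dA1 dB0)
            (ih _ _ (Inc_sl iA) (Inc_sl iB) dA0 dB1)
    have hU2 : P β U ≤ a1 * b1 := by
      refine le_trans (measure_mono ?_) (ih _ _ (Inc_sl iA) (Inc_sl iB) dA1 dB1)
      exact Set.union_subset (box_mono subset_rfl (mono01 iB)) (box_mono (mono01 iA) subset_rfl)
    have hZ : P β Z ≤ a0 * b0 := ih _ _ (Inc_sl iA) (Inc_sl iB) dA0 dB0
    rw [hP.slice he (Dep_box dA dB), hP.slice he dA, hP.slice he dB]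
    calc q * P β (sl e false (box A B)) + p * P β (sl e true (box A B))
        ≤ q * P β Z + p * P β U := by
          gcongr
          · exact sl_box_false e A B
          · exact sl_box_true e A B iB
      _ = (q + p) * (q * P β Z + p * P β U) := by rw [hpq, one_mul]
      _ = q * q * P β Z + p * q * (P β U + P β Z) + p * p * P β U := by ring
      _ ≤ q * q * (a0 * b0) + p * q * (a1 * b0 + a0 * b1) + p * p * (a1 * b1) := by gcongr
      _ = (q * a0 + p * a1) * (q * b0 + p * b1) := by ring
def gr (ω : Config d) (S : Set (V d)) : SimpleGraph (V d) where
  Adj x y := x ∈ S ∧ y ∈ S ∧ adj ω x y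
  symm := ⟨fun _ _ h => ⟨h.2.1, h.1, h.2.2.symm⟩⟩
  loopless := ⟨fun _ h => h.2.2.1 rfl⟩
theorem gr_walk_conn {u v : V d} (p : (gr ω S).Walk u v) (hu : u ∈ S)
    (h : ∀ e ∈ p.edges, ω' e = true) : connIn ω' S u v := by
  induction p with
  | nil => exact .refl hu
  | cons hab p ih =>
    simp only [SimpleGraph.Walk.edges_cons, List.mem_cons, forall_eq_or_imp] at h
    exact (connIn.step hab.1 hab.2.1 ⟨hab.2.2.1, h.1⟩).trans (ih hab.2.1 h.2)
open scoped Classical in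
theorem tree_det {u a : V d} (h : connIn ω S u a) (n : ℕ) : ∃ W : Finset (V d), (W : Set (V d)) ⊆ S ∧
    (min (sz ω S u) n ≤ ∑ w ∈ W, ∑ k ∈ range n, if ω ∈ box {ω | connIn ω S u w}
      (box {ω | connIn ω S w a} {ω | ((k + 1 : ℕ) : ℝ≥0∞) ≤ sz ω S w}) then 1 else 0) := by
  obtain ⟨p0⟩ := (SimpleGraph.reachable_iff_reflTransGen (G := gr ω S) u a).2 h.2.2
  set p := p0.bypass
  have hp : p.IsPath := p0.bypass_isPath
  have hmemω : ∀ e ∈ p.edges, ω e = true := by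
    intro e he
    have := p.edges_subset_edgeSet he
    induction e with | _ x y => exact ((gr ω S).mem_edgeSet.1 this).2.2.2
  have hsuppS : ∀ w ∈ p.support, w ∈ S := by
    intro w hw
    exact (gr_walk_conn (p.takeUntil w hw) h.1 fun e he =>
      hmemω e (p.edges_takeUntil_subset_edges hw he)).2.1
  set ω3 : Config d := fun e => if e ∈ p.edges then false else ω e
  have hω3 : ∀ e, ω3 e = true → ω e = true ∧ e ∉ p.edges := by
    intro e he
    by_cases h' : e ∈ p.edges
    · simp [ω3, h'] at he
    · simp [ω3, h'] at he; exact ⟨he, h'⟩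
  refine ⟨p.support.toFinset, fun w hw => hsuppS w (by simpa using hw), ?_⟩
  have hcover : Cl ω S u ⊆ ⋃ w ∈ p.support.toFinset, Cl ω3 S w := by
    intro y hy
    refine connIn_induction (p := fun y => y ∈ ⋃ w ∈ p.support.toFinset, Cl ω3 S w) hy ?_ ?_
    · simp only [mem_iUnion, List.mem_toFinset]
      exact ⟨u, p.start_mem_support, connIn.refl h.1⟩
    · intro a b ha hpa hb hab
      simp only [mem_iUnion, List.mem_toFinset] at hpa ⊢
      obtain ⟨w, hw, hwa⟩ := hpa
      by_cases he : s(a, b) ∈ p.edges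
      · exact ⟨b, p.snd_mem_support_of_mem_edges he, connIn.refl hb⟩
      · refine ⟨w, hw, connIn.trans hwa (.step ha.2.1 hb ⟨hab.1, ?_⟩)⟩
        simp [ω3, he, hab.2]
  have hsz : min (sz ω S u) n ≤ ∑ w ∈ p.support.toFinset, min (sz ω3 S w) n := by
    have h1 : sz ω S u ≤ ∑ w ∈ p.support.toFinset, sz ω3 S w := by
      simp only [sz]
      have h2 : (Cl ω S u).encard ≤ ∑ w ∈ p.support.toFinset, (Cl ω3 S w).encard := by
        refine (encard_le_encard hcover).trans ?_
        generalize p.support.toFinset = F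
        induction F using induction_on with
        | empty => simp
        | insert a F ha ih =>
          rw [sum_insert ha, Finset.set_biUnion_insert]
          exact (encard_union_le _ _).trans (by gcongr)
      have h3 : ((Cl ω S u).encard : ℝ≥0∞) ≤ ((∑ w ∈ p.support.toFinset, (Cl ω3 S w).encard : ℕ∞) : ℝ≥0∞) :=
        by exact_mod_cast h2
      refine h3.trans (le_of_eq ?_)
      exact map_sum ENat.toENNRealRingHom _ _
    refine le_trans (min_le_min_right _ h1) ?_
    generalize p.support.toFinset = F
    induction F using induction_on with
    | empty => simp
    | insert a F ha ih =>
      rw [sum_insert ha, sum_insert ha]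
      refine le_trans ?_ (add_le_add_right ih _)
      rw [min_add_distrib']
      exact min_le_left _ _
  refine hsz.trans (sum_le_sum fun w hw => ?_)
  rw [List.mem_toFinset] at hw
  rw [min_sz]
  refine sum_le_sum fun k _ => ?_
  by_cases hk : ((k + 1 : ℕ) : ℝ≥0∞) ≤ sz ω3 S w
  swap
  · rw [indicator_of_notMem (by simpa using hk)]; exact zero_le
  rw [if_pos]
  · exact Set.indicator_le_self' (fun _ _ => zero_le_one) _
  have hnd : (p.takeUntil w hw).edges.Disjoint (p.dropUntil w hw).edges := by
    have := hp.isTrail.edges_nodup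
    rw [← p.take_spec hw, SimpleGraph.Walk.edges_append] at this
    exact List.disjoint_of_nodup_append this
  refine ⟨fun e => decide (e ∈ (p.takeUntil w hw).edges), fun e => if e ∈ (p.dropUntil w hw).edges then true
    else ω3 e, ?_, ?_, ?_, ?_, ?_⟩
  · intro e he
    exact hmemω e (p.edges_takeUntil_subset_edges hw (by simpa using he))
  · intro e he
    by_cases h' : e ∈ (p.dropUntil w hw).edges
    · exact hmemω e (p.edges_dropUntil_subset_edges hw h')
    · simp [h'] at he; exact (hω3 e he).1
  · intro e he
    have he' : e ∈ (p.takeUntil w hw).edges := by simpa using he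
    beta_reduce
    rw [if_neg (hnd he')]
    simp [ω3, p.edges_takeUntil_subset_edges hw he']
  · exact gr_walk_conn (p.takeUntil w hw) h.1 fun e he => by simpa using he
  · refine ⟨fun e => decide (e ∈ (p.dropUntil w hw).edges), ω3, ?_, ?_, ?_, ?_, hk⟩
    · intro e he
      have he' : e ∈ (p.dropUntil w hw).edges := by simpa using he
      simp [he']
    · intro e he; simp [he]
    · intro e he
      have he' : e ∈ (p.dropUntil w hw).edges := by simpa using he
      simp [ω3, p.edges_dropUntil_subset_edges hw he']
    · exact gr_walk_conn (p.dropUntil w hw) (hsuppS w hw) fun e he => by simpa using he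
theorem IsLRP.tree_fin (hP : IsLRP J P) (S : Finset (V d)) (u a : V d) (n : ℕ) :
    ∫⁻ ω in {ω | connIn ω S u a}, min (sz ω S u) n ∂P β ≤
      ∑ w ∈ S, tp P β S u w * tp P β S w a * Fn P β S w n := by
  classical
  have hdep := fun x y => Dep_connIn (S : Set (V d)) x y
  have hdep' := fun k x => Dep_sz k (S : Set (V d)) x
  rw [Ein_finset] at hdep hdep'
  have hb := fun w k => Dep_box (hdep u w) (Dep_box (hdep w a) (hdep' ((k + 1 : ℕ) : ℝ≥0∞) w))
  calc ∫⁻ ω in {ω | connIn ω S u a}, min (sz ω S u) n ∂P β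
      ≤ ∫⁻ ω in {ω | connIn ω S u a}, ∑ w ∈ S, ∑ k ∈ range n,
          (box {ω | connIn ω S u w} (box {ω | connIn ω S w a}
            {ω | ((k + 1 : ℕ) : ℝ≥0∞) ≤ sz ω S w})).indicator (fun _ => (1 : ℝ≥0∞)) ω ∂P β := by
        refine setLIntegral_mono' (measurableSet_connIn _ _ _) fun ω hω => ?_
        obtain ⟨W, hW, h⟩ := tree_det hω n
        refine h.trans ?_
        refine (Finset.sum_le_sum_of_subset (Finset.coe_subset.1 hW)).trans ?_
        exact le_of_eq rfl
    _ ≤ ∫⁻ ω, ∑ w ∈ S, ∑ k ∈ range n,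
          (box {ω | connIn ω S u w} (box {ω | connIn ω S w a}
            {ω | ((k + 1 : ℕ) : ℝ≥0∞) ≤ sz ω S w})).indicator (fun _ => (1 : ℝ≥0∞)) ω ∂P β :=
        setLIntegral_le_lintegral _ _
    _ = ∑ w ∈ S, ∑ k ∈ range n, P β (box {ω | connIn ω S u w} (box {ω | connIn ω S w a}
            {ω | ((k + 1 : ℕ) : ℝ≥0∞) ≤ sz ω S w})) := by
        have hm := fun w k => measurableSet_of_dep _ (hb w k)
        rw [lintegral_finset_sum _ fun w _ => Finset.measurable_sum _ fun k _ =>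
          measurable_const.indicator (hm w k)]
        refine sum_congr rfl fun w _ => ?_
        rw [lintegral_finset_sum _ fun k _ => measurable_const.indicator (hm w k)]
        refine sum_congr rfl fun k _ => ?_
        rw [lintegral_indicator_const (hm w k), one_mul]
    _ ≤ ∑ w ∈ S, ∑ k ∈ range n, tp P β S u w * (tp P β S w a *
            P β {ω | ((k + 1 : ℕ) : ℝ≥0∞) ≤ sz ω S w}) := by
        refine sum_le_sum fun w _ => sum_le_sum fun k _ => ?_
        refine (hP.bk S.sym2 _ _ (Inc_connIn _ _ _) (Inc_box _ _) (hdep u w)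
          (Dep_box (hdep w a) (hdep' _ w))).trans ?_
        gcongr
        · exact le_rfl
        · exact hP.bk S.sym2 _ _ (Inc_connIn _ _ _) (Inc_sz _ _ _) (hdep w a) (hdep' _ w)
    _ = _ := by
        refine sum_congr rfl fun w _ => ?_
        rw [Fn_eq, mul_sum]
        refine sum_congr rfl fun k _ => ?_
        ring
theorem setLIntegral_min_sz (A : Set (Config d)) (n : ℕ) : ∫⁻ ω in A, min (sz ω S x) n ∂P β =
    ∑ k ∈ range n, P β ({ω | ((k + 1 : ℕ) : ℝ≥0∞) ≤ sz ω S x} ∩ A) := by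
  simp only [min_sz]
  rw [lintegral_finset_sum _ fun k _ => measurable_const.indicator (measurableSet_sz _ _ _)]
  refine sum_congr rfl fun k _ => ?_
  rw [lintegral_indicator_const (measurableSet_sz _ _ _), one_mul,
    Measure.restrict_apply (measurableSet_sz _ _ _)]
theorem Fn_mono (hST : S ⊆ T) (n : ℕ) : Fn P β S x n ≤ Fn P β T x n :=
  lintegral_mono fun _ => min_le_min_right _ (sz_mono hST)
theorem IsLRP.tree (hP : IsLRP J P) (u a : V d) (n : ℕ) :
    ∫⁻ ω in {ω | connIn ω univ u a}, min (sz ω univ u) n ∂P β ≤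
      ∑' w, tp P β univ u w * tp P β univ w a * Fn P β univ w n := by
  rw [setLIntegral_min_sz]
  have h1 : ∀ k : ℕ, P β ({ω | (k : ℝ≥0∞) ≤ sz ω univ u} ∩ {ω | connIn ω univ u a}) =
      ⨆ N, P β ({ω | (k : ℝ≥0∞) ≤ sz ω (Bx d N) u} ∩ {ω | connIn ω (Bx d N) u a}) := by
    intro k
    rw [← Monotone.measure_iUnion]
    · congr 1; ext ω
      simp only [mem_inter_iff, mem_ofPred_eq, mem_iUnion, le_sz_iff, conn_iff_Bx]
      constructor
      · rintro ⟨⟨m, hm⟩, n, hn⟩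
        exact ⟨max m n, hm.trans (sz_mono (Bx_mono (le_max_left _ _))),
          hn.mono (Bx_mono (le_max_right _ _))⟩
      · rintro ⟨m, h, h'⟩; exact ⟨⟨m, h⟩, m, h'⟩
    · intro m n hmn ω h
      exact ⟨le_trans (show (k : ℝ≥0∞) ≤ sz ω (Bx d m) u from h.1) (sz_mono (Bx_mono hmn)),
        connIn.mono h.2 (Bx_mono hmn)⟩
  simp only [h1]
  rw [finsetSum_iSup_of_monotone]
  · refine iSup_le fun N => ?_
    rw [← setLIntegral_min_sz]
    refine (hP.tree_fin (Bx d N) u a n).trans ?_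
    refine le_trans ?_ (sum_le_tsum (Bx d N))
    gcongr <;> first | exact tp_mono (subset_univ _) | exact Fn_mono (subset_univ _) _
  · intro k m n hmn
    refine measure_mono fun ω h => ⟨le_trans h.1 (sz_mono (Bx_mono hmn)), connIn.mono h.2 (Bx_mono hmn)⟩
theorem sz_le_card (S : Finset (V d)) (x : V d) : sz ω S x ≤ S.card := by
  have := encard_le_encard (Cl_subset (ω := ω) (S := (S : Set (V d))) (x := x))
  rw [encard_coe_eq_coe_finsetCard] at this
  unfold sz; exact_mod_cast this
theorem IsLRP.sq_le (hP : IsLRP J P) (S : Finset (V d)) {X : ℝ≥0∞} 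
    (hX : ∀ w ∈ S, ∫⁻ ω, sz ω S w ∂P β ≤ X) {z : V d} (hz : z ∈ S) :
    ∫⁻ ω, sz ω S z * sz ω S z ∂P β ≤ X ^ 3 := by
  have hmin : ∀ ω w, min (sz ω S w) (S.card : ℝ≥0∞) = sz ω S w := fun ω w => min_eq_left (sz_le_card S w)
  calc ∫⁻ ω, sz ω S z * sz ω S z ∂P β
      = ∫⁻ ω, ∑' a, indicator {ω | connIn ω S z a} (fun ω => sz ω S z) ω ∂P β := by
        congr 1; ext ω
        conv_lhs => rw [sz_eq_tsum, ← ENNReal.tsum_mul_right, ← sz_eq_tsum]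
        congr 1; ext a
        by_cases h : connIn ω S z a <;> simp [h]
    _ = ∑' a, ∫⁻ ω in {ω | connIn ω S z a}, sz ω S z ∂P β := by
        rw [lintegral_tsum fun a => ((measurable_sz _ _).indicator (measurableSet_connIn _ _ _)).aemeasurable]
        congr 1; ext a
        rw [lintegral_indicator (measurableSet_connIn _ _ _)]
    _ ≤ ∑' a, ∑ w ∈ S, tp P β S z w * tp P β S w a * X := by
        refine tsum_le_tsum fun a => ?_
        have := hP.tree_fin (β := β) S z a S.card
        simp only [hmin, Fn] at this
        refine this.trans (sum_le_sum fun w hw => ?_)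
        gcongr; exact hX w hw
    _ = ∑ w ∈ S, tp P β S z w * (∑' a, tp P β S w a) * X := by
        rw [Summable.tsum_finsetSum (fun _ _ => summable)]
        refine sum_congr rfl fun w _ => ?_
        rw [← ENNReal.tsum_mul_left, ← ENNReal.tsum_mul_right]
    _ ≤ ∑ w ∈ S, tp P β S z w * X * X := by
        refine sum_le_sum fun w hw => ?_
        gcongr; rw [← lintegral_sz]; exact hX w hw
    _ ≤ X ^ 3 := by
        rw [← sum_mul, ← sum_mul, pow_succ, pow_two]
        gcongr
        refine (sum_le_tsum S).trans ?_
        rw [← lintegral_sz]; exact hX z hz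
end BK
section SimonLieb
variable {d : ℕ} {J : V d → V d → ℝ} {α c C : ℝ} {P : ℝ → Measure (Config d)} {β : ℝ}
variable {ω ω' : Config d} {S T : Set (V d)} {x y z : V d}
theorem sum_Cl (S : Set (V d)) (z : V d) (μ : Measure (Config d)) (f : Config d → ℝ≥0∞) :
    ∑' D : Finset (V d), ∫⁻ ω in {ω | Cl ω S z = D}, f ω ∂μ =
      ∫⁻ ω in {ω | (Cl ω S z).Finite}, f ω ∂μ := by
  rw [← lintegral_iUnion]
  · congr 2; ext ω
    simp only [mem_iUnion, mem_ofPred_eq]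
    exact ⟨fun ⟨D, hD⟩ => hD ▸ D.finite_toSet, fun h => ⟨h.toFinset, by simp⟩⟩
  · exact fun D => measurableSet_Cl S z D
  · intro D D' hD
    refine Set.disjoint_left.2 fun ω h h' => hD ?_
    have h1 : Cl ω S z = D := h
    have h2 : Cl ω S z = D' := h'
    exact_mod_cast h1.symm.trans h2
open scoped Classical in
theorem sum_Cl_mem (S : Set (V d)) (z u : V d) :
    ∑' D : Finset (V d), (if u ∈ D then P β {ω | Cl ω S z = D} else 0) ≤ tp P β S z u := by
  have h1 : ∀ D : Finset (V d), (if u ∈ D then P β {ω | Cl ω S z = D} else 0) ≤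
      ∫⁻ ω in {ω | Cl ω S z = D}, indicator {ω | connIn ω S z u} (fun _ => 1) ω ∂P β := by
    intro D
    split_ifs with h
    · rw [← setLIntegral_one]
      refine setLIntegral_mono' (measurableSet_Cl S z D) fun ω hω => ?_
      have : u ∈ Cl ω S z := by
        rw [show Cl ω S z = D from hω]; exact h
      rw [indicator_of_mem (by exact this)]
    · exact zero_le
  refine (tsum_le_tsum h1).trans ?_
  rw [sum_Cl]
  refine (setLIntegral_le_lintegral _ _).trans ?_
  rw [lintegral_indicator_const (measurableSet_connIn _ _ _), one_mul, tp]
open scoped Classical in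
noncomputable def kout (J : V d → V d → ℝ) (β : ℝ) (S : Set (V d)) (u v : V d) : ℝ≥0∞ :=
  if v ∈ S then 0 else ofReal (β * J u v)
theorem IsLRP.simon (hJ : KernelHyp d J α c C) (hP : IsLRP J P) (hS : S.Finite)
    (hz : z ∈ S) (x : V d) : tp P β univ z x ≤
      tp P β S z x + ∑' u, ∑' v, tp P β S z u * kout J β S u v * tp P β univ v x := by
  classical
  let E : Finset (V d) → V d → V d → Set (Config d) := fun D u v =>
    if u ∈ D ∧ v ∉ S then {ω | Cl ω S z = D} ∩ ({ω | ω s(u, v) = true} ∩ {ω | connIn ω (D : Set (V d))ᶜ v x})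
    else ∅
  have hsub : {ω | connIn ω univ z x} ⊆ {ω | connIn ω S z x} ∪ ⋃ D, ⋃ u, ⋃ v, E D u v := by
    intro ω h
    by_cases hx : connIn ω S z x
    · exact Or.inl hx
    right
    have hfin : (Cl ω S z).Finite := hS.subset Cl_subset
    obtain ⟨u, v, hu, -, hv, -, hadj, hvx⟩ := last_exit (Cl ω S z) h (connIn.refl hz) hx
    simp only [mem_iUnion]
    refine ⟨hfin.toFinset, u, v, ?_⟩
    have hvS : v ∉ S := fun hvS => hv (connIn.trans hu (.step (Cl_subset hu) hvS hadj))
    simp only [E, hfin.mem_toFinset, hu, hvS, not_false_eq_true, and_self, if_true]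
    refine ⟨by simp, hadj.2, ?_⟩
    refine hvx.mono ?_
    intro y hy; simpa using hy.2
  have hE : ∀ D u v, P β (E D u v) ≤ (if u ∈ D then P β {ω | Cl ω S z = D} else 0) *
      (kout J β S u v * tp P β univ v x) := by
    intro D u v
    by_cases h : u ∈ D ∧ v ∉ S
    swap
    · simp [E, h]
    simp only [E, h, not_false_eq_true, and_self, if_true, kout, if_false]
    have hd1 : Disjoint ({s(u, v)} : Set (Sym2 (V d))) (Ein (D : Set (V d))ᶜ) := by
      rw [Set.disjoint_singleton_left, mk_mem_Ein]
      exact fun hh => hh.1 h.1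
    have hd2 : Disjoint (Ein S \ Ein (D : Set (V d))ᶜ) ({s(u, v)} ∪ Ein (D : Set (V d))ᶜ) := by
      rw [Set.disjoint_union_right]
      refine ⟨?_, Set.disjoint_sdiff_left⟩
      rw [Set.disjoint_singleton_right]
      exact fun hh => h.2 (mk_mem_Ein.1 hh.1).2
    rw [hP.indep_set hd2 (measurableSet_Cl _ _ _)
      ((measurableSet_open _).inter (measurableSet_connIn _ _ _)) (Dep_Cl _ _ _)
      ((dep_open _).inter (Dep_connIn _ _ _)),
      hP.indep_set hd1 (measurableSet_open _) (measurableSet_connIn _ _ _) (dep_open _)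
      (Dep_connIn _ _ _), hP.open_eq]
    gcongr
    · exact (hJ.edgeProb_le _).trans_eq (by rw [hJ.wt_mk])
    · exact tp_mono (subset_univ _)
  calc tp P β univ z x ≤ P β ({ω | connIn ω S z x} ∪ ⋃ D, ⋃ u, ⋃ v, E D u v) := measure_mono hsub
    _ ≤ tp P β S z x + ∑' D, ∑' u, ∑' v, P β (E D u v) := by
        refine (measure_union_le _ _).trans ?_
        gcongr
        · exact le_rfl
        refine (measure_iUnion_le _).trans (tsum_le_tsum fun D => ?_)
        refine (measure_iUnion_le _).trans (tsum_le_tsum fun u => ?_)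
        exact measure_iUnion_le _
    _ ≤ tp P β S z x + ∑' (D : Finset (V d)) (u : V d) (v : V d), (if u ∈ D then P β {ω | Cl ω S z = D} else 0) *
      (kout J β S u v * tp P β univ v x) := by
        gcongr with D u v
        exact hE D u v
    _ = tp P β S z x + ∑' (u : V d) (v : V d), (∑' D : Finset (V d), if u ∈ D then P β {ω | Cl ω S z = D} else 0) *
      (kout J β S u v * tp P β univ v x) := by
        congr 1
        rw [tsum_comm]
        congr 1; ext u
        rw [tsum_comm]
        congr 1; ext v
        rw [ENNReal.tsum_mul_right]
    _ ≤ _ := by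
        refine add_le_add le_rfl (tsum_le_tsum fun u => tsum_le_tsum fun v => ?_)
        rw [mul_assoc]; exact mul_le_mul' (sum_Cl_mem S z u) le_rfl
theorem IsLRP.simon_sum (hJ : KernelHyp d J α c C) (hP : IsLRP J P) (hβ : 0 ≤ β) (hS : S.Finite)
    (h0 : 0 ∈ S) (B : Finset (V d)) (z : V d) : ∑ x ∈ B, tp P β univ z x ≤
      ∑ x ∈ B, tp P β S 0 (x - z) +
      ∑' u, ∑' v, tp P β S 0 u * kout J β S u v * ∑ x ∈ B, tp P β univ (z + v) x := by
  calc ∑ x ∈ B, tp P β univ z x = ∑ x ∈ B, tp P β univ 0 (x - z) := by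
        simp only [hP.tp_univ_zero hJ hβ (x := z)]
    _ ≤ ∑ x ∈ B, (tp P β S 0 (x - z) + ∑' u, ∑' v, tp P β S 0 u * kout J β S u v *
          tp P β univ v (x - z)) := sum_le_sum fun x _ => hP.simon hJ hS h0 _
    _ = _ := by
        rw [sum_add_distrib]
        congr 1
        rw [← Summable.tsum_finsetSum (fun _ _ => summable)]
        congr 1; ext u
        rw [← Summable.tsum_finsetSum (fun _ _ => summable)]
        congr 1; ext v
        rw [mul_sum]
        refine sum_congr rfl fun x _ => ?_
        rw [hP.tp_univ_zero hJ hβ (x := z + v), hP.tp_univ_zero hJ hβ (x := v)]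
        congr 2; abel
theorem absorb {g M φ : ℝ≥0∞} (hg : g ≠ ⊤) (hφ : φ < 1) (h : g ≤ M + φ * g) : g ≤ M * (1 - φ)⁻¹ := by
  have h1 : (1 - φ) * g ≤ M := by
    rw [ENNReal.sub_mul (fun _ _ => hg), one_mul]
    exact tsub_le_iff_right.2 h
  have h2 : 1 - φ ≠ 0 := (tsub_pos_of_lt hφ).ne'
  have h3 : 1 - φ ≠ ⊤ := ne_top_of_le_ne_top one_ne_top tsub_le_self
  calc g = (1 - φ) * g * (1 - φ)⁻¹ := by
        rw [mul_comm (1 - φ), mul_assoc, ENNReal.mul_inv_cancel h2 h3, mul_one]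
    _ ≤ _ := by gcongr
noncomputable def phi (J : V d → V d → ℝ) (P : ℝ → Measure (Config d)) (β : ℝ) (S : Set (V d)) : ℝ≥0∞ :=
  ∑' u, ∑' v, tp P β S 0 u * kout J β S u v
noncomputable def ch (P : ℝ → Measure (Config d)) (β : ℝ) : ℝ≥0∞ := ∑' x, tp P β univ 0 x
theorem IsLRP.ch_le_of_phi (hJ : KernelHyp d J α c C) (hP : IsLRP J P) (hβ : 0 ≤ β) (S : Finset (V d))
    (h0 : 0 ∈ S) (hφ : phi J P β S < 1) : ch P β ≤ S.card * (1 - phi J P β S)⁻¹ := by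
  rw [ch, tsum_eq_iSup_sum]
  refine iSup_le fun B => ?_
  set g : ℝ≥0∞ := ⨆ z, ∑ x ∈ B, tp P β univ z x
  have hgB : g ≤ B.card := by
    refine iSup_le fun z => ?_
    calc ∑ x ∈ B, tp P β univ z x ≤ ∑ x ∈ B, 1 := sum_le_sum fun x _ => hP.tp_le_one
      _ = _ := by simp
  refine (le_iSup (fun z => ∑ x ∈ B, tp P β univ z x) 0).trans ?_
  refine absorb (ne_top_of_le_ne_top (natCast_ne_top _) hgB) hφ ?_
  refine iSup_le fun z => (hP.simon_sum hJ hβ S.finite_toSet h0 B z).trans ?_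
  gcongr
  · classical
    calc ∑ x ∈ B, tp P β S 0 (x - z) = ∑ y ∈ B.image (· - z), tp P β S 0 y := by
          rw [sum_image (fun a _ b _ h => by simpa using h)]
      _ ≤ ∑' y, tp P β S 0 y := sum_le_tsum _
      _ = ∑ y ∈ S, tp P β S 0 y := tsum_eq_sum fun y hy => tp_zero (by simpa using hy)
      _ ≤ ∑ y ∈ S, 1 := sum_le_sum fun x _ => hP.tp_le_one
      _ = _ := by simp
  · rw [phi, ← ENNReal.tsum_mul_right]
    refine tsum_le_tsum fun u => ?_
    rw [← ENNReal.tsum_mul_right]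
    refine tsum_le_tsum fun v => ?_
    gcongr
    exact le_iSup (fun z => ∑ x ∈ B, tp P β univ z x) (z + v)
theorem IsLRP.ch_mono (hJ : KernelHyp d J α c C) (hP : IsLRP J P) {β' : ℝ} (hβ : 0 ≤ β)
    (h : β ≤ β') : ch P β ≤ ch P β' :=
  tsum_le_tsum fun _ => hP.tp_beta_mono hJ hβ h
noncomputable def Jn (J : V d → V d → ℝ) : ℝ := ∑' x : V d, J 0 x
theorem KernelHyp.Jn_nonneg (hJ : KernelHyp d J α c C) : 0 ≤ Jn J := tsum_nonneg fun x => hJ.nonneg 0 x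
theorem KernelHyp.J_zero (hJ : KernelHyp d J α c C) (x y : V d) : J x y = J 0 (y - x) := by
  rw [← hJ.transInv 0 (y - x) x]; simp
theorem KernelHyp.tsum_J (hJ : KernelHyp d J α c C) (hβ : 0 ≤ β) (u : V d) :
    ∑' v, ofReal (β * J u v) = ofReal (β * Jn J) := by
  simp only [hJ.J_zero u]
  have := (Equiv.subRight u).tsum_eq (fun v => ofReal (β * J 0 v))
  simp only [Equiv.subRight_apply] at this
  rw [this, Jn, ← tsum_mul_left,
    ofReal_tsum_of_nonneg (fun v => mul_nonneg hβ (hJ.nonneg _ _)) (hJ.integrable.mul_left β)]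
theorem kout_le (u v : V d) : kout J β S u v ≤ ofReal (β * J u v) := by
  unfold kout; split_ifs <;> simp
theorem IsLRP.ch_small (hJ : KernelHyp d J α c C) (hP : IsLRP J P) (hβ : 0 ≤ β)
    (h : β ≤ 1 / (2 * Jn J + 1)) : ch P β ≤ 2 := by
  have hj := hJ.Jn_nonneg
  have hphi : phi J P β ({0} : Finset (V d)) ≤ 1 / 2 := by
    rw [phi, tsum_eq_single 0 (fun u hu => by simp [tp_zero (y := u) (x := 0) (S := ({0} : Set (V d))) (P := P) (β := β) (by simpa using hu)])]
    calc ∑' v, tp P β ({0} : Finset (V d)) 0 0 * kout J β ({0} : Finset (V d)) 0 v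
        ≤ ∑' v, 1 * ofReal (β * J 0 v) := by
          gcongr
          · exact hP.tp_le_one
          · exact kout_le _ _
      _ = ofReal (β * Jn J) := by simp only [one_mul]; rw [hJ.tsum_J hβ]
      _ ≤ ofReal (1 / 2) := by
          apply ofReal_le_ofReal
          calc β * Jn J ≤ 1 / (2 * Jn J + 1) * Jn J := by gcongr
            _ ≤ 1 / 2 := by rw [div_mul_eq_mul_div, div_le_div_iff₀ (by linarith) (by norm_num)]; linarith
      _ = 1 / 2 := by rw [ofReal_div_of_pos (by norm_num)]; simp
  have h12 : (1 / 2 : ℝ≥0∞) < 1 := by simpa using ENNReal.one_half_lt_one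
  refine (hP.ch_le_of_phi hJ hβ {0} (by simp) (hphi.trans_lt h12)).trans ?_
  calc _ ≤ ((({0} : Finset (V d)).card : ℕ) : ℝ≥0∞) * (1 - 1 / 2)⁻¹ := by gcongr
    _ = 2 := by simp
theorem IsLRP.phi_cont (hJ : KernelHyp d J α c C) (hP : IsLRP J P) (hβ : 0 ≤ β) (S : Finset (V d))
    (h : phi J P β S < 1) : ∃ β' > β, phi J P β' S < 1 := by
  classical
  let K : V d → ℝ≥0∞ := fun u => ∑' v, kout J 1 S u v
  have hK : ∀ u, K u ≠ ⊤ := fun u => ne_top_of_le_ne_top ofReal_ne_top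
    ((tsum_le_tsum fun v => kout_le u v).trans_eq (hJ.tsum_J zero_le_one u))
  have hphi : ∀ β, 0 ≤ β → phi J P β S = ∑ u ∈ S, tp P β S 0 u * (ofReal β * K u) := by
    intro β hβ
    rw [phi, tsum_eq_sum (s := S) (fun u hu => by simp [tp_zero (y := u) (x := 0) (S := (S : Set (V d))) (P := P) (β := β) (by simpa using hu)])]
    refine sum_congr rfl fun u _ => ?_
    rw [ENNReal.tsum_mul_left]
    congr 1
    rw [← ENNReal.tsum_mul_left]
    congr 1; ext v
    unfold kout
    split_ifs
    · simp
    · rw [one_mul, ← ofReal_mul hβ]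
  set W := ∑ e ∈ S.sym2, wt J e
  have htend : Filter.Tendsto (fun δ : ℝ => ∑ u ∈ S, (tp P β S 0 u + ofReal (δ * W)) *
      (ofReal (β + δ) * K u)) (nhds 0) (nhds (∑ u ∈ S, (tp P β S 0 u + ofReal (0 * W)) *
      (ofReal (β + 0) * K u))) := by
    refine tendsto_finset_sum _ fun u _ => ?_
    have h1 : Filter.Tendsto (fun δ : ℝ => tp P β S 0 u + ofReal (δ * W)) (nhds 0)
        (nhds (tp P β S 0 u + ofReal (0 * W))) :=
      Filter.Tendsto.const_add _ (tendsto_ofReal (Filter.Tendsto.mul_const _ tendsto_id))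
    have h2 : Filter.Tendsto (fun δ : ℝ => ofReal (β + δ) * K u) (nhds 0)
        (nhds (ofReal (β + 0) * K u)) :=
      ENNReal.Tendsto.mul_const (tendsto_ofReal (Filter.Tendsto.const_add _ tendsto_id))
        (Or.inr (hK u))
    refine ENNReal.Tendsto.mul h1 (Or.inr ?_) h2 (Or.inr ?_)
    · exact mul_ne_top ofReal_ne_top (hK u)
    · exact add_ne_top.2 ⟨ne_top_of_le_ne_top one_ne_top hP.tp_le_one, ofReal_ne_top⟩
  have hlim : (∑ u ∈ S, (tp P β S 0 u + ofReal (0 * W)) *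
      (ofReal (β + 0) * K u)) < 1 := by
    simpa [← hphi β hβ] using h
  have hev := htend.eventually (gt_mem_nhds hlim)
  obtain ⟨δ, hδ, hδ0⟩ := ((hev.filter_mono nhdsWithin_le_nhds).and
    (self_mem_nhdsWithin (s := Set.Ioi (0:ℝ)))).exists
  have hδ0 : 0 < δ := hδ0
  refine ⟨β + δ, by simpa using hδ0, ?_⟩
  rw [hphi _ (by linarith)]
  refine lt_of_le_of_lt (sum_le_sum fun u _ => ?_) hδ
  gcongr
  have := hP.lip hJ hβ (show β ≤ β + δ by linarith) S.sym2 (A := {ω | connIn ω S 0 u})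
    (by rw [← Ein_finset]; exact Dep_connIn _ _ _)
  simpa [tp, W] using this
end SimonLieb
section Merge
variable {d : ℕ} {J : V d → V d → ℝ} {α c C : ℝ} {P : ℝ → Measure (Config d)} {β : ℝ}
variable {ω ω' : Config d} {S T : Set (V d)} {x y z : V d}
theorem sum_Cl_fun (hS : S.Finite) (z : V d) (g : ℝ≥0∞ → ℝ≥0∞) :
    ∑' D : Finset (V d), P β {ω | Cl ω S z = D} * g D.card = ∫⁻ ω, g (sz ω S z) ∂P β := by
  have h1 : {ω : Config d | (Cl ω S z).Finite} = univ := by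
    ext ω; simpa using hS.subset Cl_subset
  rw [← setLIntegral_univ, ← h1, ← sum_Cl]
  congr 1; ext D
  rw [setLIntegral_congr_fun (g := fun _ => g D.card) (measurableSet_Cl _ _ _) ?_, setLIntegral_const, mul_comm]
  intro ω hω
  have h2 : Cl ω S z = D := hω
  simp only [sz, h2, encard_coe_eq_coe_finsetCard]
  simp
theorem dep_exists (T : Finset (Sym2 (V d))) : Dep {ω : Config d | ∃ e ∈ T, ω e = true} T := by
  intro ω ω' h
  exact ⟨fun ⟨e, he, h1⟩ => ⟨e, he, by rw [← h e he]; exact h1⟩, fun ⟨e, he, h1⟩ => ⟨e, he, by rw [h e he]; exact h1⟩⟩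
theorem Ein_disjoint (h : Disjoint S T) : Disjoint (Ein S) (Ein T) := by
  refine Set.disjoint_left.2 fun e => ?_
  induction e with
  | _ x y => exact fun h1 h2 => Set.disjoint_left.1 h (mk_mem_Ein.1 h1).1 (mk_mem_Ein.1 h2).1
theorem IsLRP.merge (hJ : KernelHyp d J α c C) (hP : IsLRP J P) (hβ : 0 ≤ β) {B1 B2 : Finset (V d)}
    (hB : Disjoint B1 B2) (h1 : (B1 : Set (V d)) ⊆ S) (h2 : (B2 : Set (V d)) ⊆ S) {s : ℝ} (hs : 0 ≤ s)
    (hsJ : ∀ u ∈ B1, ∀ v ∈ B2, s ≤ β * J u v) (hz : z ∈ B1) (hx : x ∈ B2) :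
    ofReal s * (∫⁻ ω, sz ω B1 z ∂P β) * (∫⁻ ω, sz ω B2 x ∂P β) ≤
      tp P β S z x + ofReal s ^ 2 * (∫⁻ ω, sz ω B1 z * sz ω B1 z ∂P β) *
        (∫⁻ ω, sz ω B2 x * sz ω B2 x ∂P β) := by
  classical
  have hB' : Disjoint (B1 : Set (V d)) B2 := by exact_mod_cast hB
  let T : Finset (V d) → Finset (V d) → Finset (Sym2 (V d)) := fun D D' =>
    (D ×ˢ D').image fun p => s(p.1, p.2)
  let E : Finset (V d) → Finset (V d) → Set (Config d) := fun D D' =>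
    {ω | Cl ω B1 z = D} ∩ ({ω | Cl ω B2 x = D'} ∩ {ω | ∃ e ∈ T D D', ω e = true})
  have hmE : ∀ D D', MeasurableSet (E D D') := fun D D' => (measurableSet_Cl _ _ _).inter
    ((measurableSet_Cl _ _ _).inter (measurableSet_of_dep _ (dep_exists _)))
  have hsum : ∑' D, ∑' D', P β (E D D') ≤ tp P β S z x := by
    rw [← tsum_prod, ← measure_iUnion]
    · refine measure_mono (iUnion_subset fun p ω hω => ?_)
      obtain ⟨hω1, hω2, e, he, heo⟩ := hω
      have hω1 : Cl ω B1 z = p.1 := hω1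
      have hω2 : Cl ω B2 x = p.2 := hω2
      simp only [T, Finset.mem_image, mem_product] at he
      obtain ⟨⟨u, v⟩, ⟨hu, hv⟩, rfl⟩ := he
      have hu' : connIn ω B1 z u := by rw [← mem_Cl, hω1]; exact hu
      have hv' : connIn ω B2 x v := by rw [← mem_Cl, hω2]; exact hv
      refine (hu'.mono h1).trans (connIn.trans (.step (h1 hu'.2.1) (h2 hv'.2.1) ⟨?_, heo⟩) (hv'.mono h2).symm)
      rintro rfl
      exact Set.disjoint_left.1 hB' hu'.2.1 hv'.2.1
    · intro p q hpq
      refine Set.disjoint_left.2 fun ω hω hω' => hpq ?_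
      have a1 : Cl ω B1 z = p.1 := hω.1
      have a2 : Cl ω B2 x = p.2 := hω.2.1
      have a3 : Cl ω B1 z = q.1 := hω'.1
      have a4 : Cl ω B2 x = q.2 := hω'.2.1
      exact Prod.ext (by exact_mod_cast a1.symm.trans a3) (by exact_mod_cast a2.symm.trans a4)
    · exact fun p => hmE _ _
  have hpair : ∀ D D' : Finset (V d), ofReal s * (P β {ω | Cl ω B1 z = D} * D.card) *
      (P β {ω | Cl ω B2 x = D'} * D'.card) ≤ P β (E D D') + ofReal s ^ 2 *
        (P β {ω | Cl ω B1 z = D} * (D.card * D.card)) * (P β {ω | Cl ω B2 x = D'} * (D'.card * D'.card)) := by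
    intro D D'
    by_cases hD : D ⊆ B1
    swap
    · have : {ω : Config d | Cl ω B1 z = D} = ∅ := by
        ext ω; simp only [mem_ofPred_eq, mem_empty_iff_false, iff_false]
        intro h; exact hD (by exact_mod_cast h ▸ Cl_subset (ω := ω) (S := (B1 : Set (V d))) (x := z))
      simp [this]
    by_cases hD' : D' ⊆ B2
    swap
    · have : {ω : Config d | Cl ω B2 x = D'} = ∅ := by
        ext ω; simp only [mem_ofPred_eq, mem_empty_iff_false, iff_false]
        intro h; exact hD' (by exact_mod_cast h ▸ Cl_subset (ω := ω) (S := (B2 : Set (V d))) (x := x))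
      simp [this]
    have hDD : ∀ u ∈ D, ∀ v ∈ D', u ∉ B2 ∧ v ∉ B1 := fun u hu v hv =>
      ⟨Finset.disjoint_left.1 hB (hD hu), Finset.disjoint_right.1 hB (hD' hv)⟩
    have hT : s * (D.card * D'.card) ≤ β * ∑ e ∈ T D D', wt J e := by
      rw [sum_image, mul_sum]
      · calc s * (D.card * D'.card) = ∑ p ∈ D ×ˢ D', s := by simp [mul_comm]
          _ ≤ _ := by
            refine sum_le_sum fun p hp => ?_
            rw [hJ.wt_mk]
            rw [mem_product] at hp
            exact hsJ _ (hD hp.1) _ (hD' hp.2)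
      · intro p hp q hq hpq
        simp only [Finset.coe_product, mem_prod, mem_coe] at hp hq
        simp only [Sym2.eq_iff] at hpq
        rcases hpq with h | h
        · exact Prod.ext h.1 h.2
        · exact absurd (hD hp.1) (h.1 ▸ (hDD _ hp.1 _ hq.2).2)
    have hol := hP.open_lower hJ hβ (T D D') (by positivity) hT
    have hd1 : Disjoint (Ein (B2 : Set (V d))) (T D D' : Set (Sym2 (V d))) := by
      refine Set.disjoint_right.2 fun e he => ?_
      simp only [T, coe_image, Set.mem_image, mem_coe, mem_product] at he
      obtain ⟨p, hp, rfl⟩ := he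
      exact fun h => (hDD _ hp.1 _ hp.2).1 (mk_mem_Ein.1 h).1
    have hd2 : Disjoint (Ein (B1 : Set (V d))) (Ein (B2 : Set (V d)) ∪ (T D D' : Set (Sym2 (V d)))) := by
      rw [Set.disjoint_union_right]
      refine ⟨Ein_disjoint hB', Set.disjoint_right.2 fun e he => ?_⟩
      simp only [T, coe_image, Set.mem_image, mem_coe, mem_product] at he
      obtain ⟨p, hp, rfl⟩ := he
      exact fun h => (hDD _ hp.1 _ hp.2).2 (mk_mem_Ein.1 h).2
    have hE : P β (E D D') = P β {ω | Cl ω B1 z = D} * (P β {ω | Cl ω B2 x = D'} *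
        P β {ω | ∃ e ∈ T D D', ω e = true}) := by
      have hm := measurableSet_of_dep _ (dep_exists (T D D'))
      simp only [E]
      rw [hP.indep_set hd2 (measurableSet_Cl _ _ _) ((measurableSet_Cl _ _ _).inter hm)
        ((Dep_Cl _ _ _).mono sdiff_subset) (((Dep_Cl _ _ _).mono sdiff_subset).inter (dep_exists _)),
        hP.indep_set hd1 (measurableSet_Cl _ _ _) hm ((Dep_Cl _ _ _).mono sdiff_subset) (dep_exists _)]
    rw [hE]
    have e1 : ofReal (s * (D.card * D'.card)) = ofReal s * (D.card * D'.card) := by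
      rw [ofReal_mul hs, ofReal_mul (by positivity)]; simp
    have e2 : ofReal ((s * (D.card * D'.card)) ^ 2) = (ofReal s * (D.card * D'.card)) ^ 2 := by
      rw [ofReal_pow (by positivity), e1]
    rw [e1, e2] at hol
    calc _ = P β {ω | Cl ω B1 z = D} * P β {ω | Cl ω B2 x = D'} * (ofReal s * (D.card * D'.card)) := by ring
      _ ≤ P β {ω | Cl ω B1 z = D} * P β {ω | Cl ω B2 x = D'} * _ := mul_le_mul' le_rfl hol
      _ = _ := by ring
  calc ofReal s * (∫⁻ ω, sz ω B1 z ∂P β) * (∫⁻ ω, sz ω B2 x ∂P β)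
      = ∑' (D : Finset (V d)) (D' : Finset (V d)), ofReal s * (P β {ω | Cl ω B1 z = D} * D.card) *
      (P β {ω | Cl ω B2 x = D'} * D'.card) := by
        simp only [ENNReal.tsum_mul_left, ENNReal.tsum_mul_right]
        rw [sum_Cl_fun B1.finite_toSet z (fun t => t), sum_Cl_fun B2.finite_toSet x (fun t => t)]
    _ ≤ _ := tsum_le_tsum fun D => tsum_le_tsum fun D' => hpair D D'
    _ = ∑' D, ∑' D', P β (E D D') + ofReal s ^ 2 * (∫⁻ ω, sz ω B1 z * sz ω B1 z ∂P β) *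
        (∫⁻ ω, sz ω B2 x * sz ω B2 x ∂P β) := by
        simp only [tsum_add, ENNReal.tsum_mul_left, ENNReal.tsum_mul_right]
        rw [sum_Cl_fun B1.finite_toSet z (fun t => t * t), sum_Cl_fun B2.finite_toSet x (fun t => t * t)]
    _ ≤ _ := by gcongr
noncomputable def Xr (P : ℝ → Measure (Config d)) (β : ℝ) (r : ℕ) : ℝ≥0∞ :=
  (Bx d r).sup fun z => ∫⁻ ω, sz ω (Bx d r) z ∂P β
theorem zero_mem_Bx (r : ℕ) : (0 : V d) ∈ Bx d r := by rw [mem_Bx]; simp [normInf]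
theorem normInf_le_iff {r : ℕ} : normInf x ≤ r ↔ ∀ i, |x i| ≤ r := by
  simp only [normInf, Finset.sup_le_iff, Finset.mem_univ, true_imp_iff]
  refine forall_congr' fun i => ?_
  rw [Int.abs_eq_natAbs]; norm_cast
theorem normInf_add_le (x y : V d) : normInf (x + y) ≤ normInf x + normInf y := by
  rw [normInf_le_iff]; intro i
  have h1 := normInf_le_iff.1 (le_refl (normInf x)) i
  have h2 := normInf_le_iff.1 (le_refl (normInf y)) i
  have := abs_add_le (x i) (y i)
  push_cast; simp only [Pi.add_apply]; linarith
theorem normInf_neg (x : V d) : normInf (-x) = normInf x := by simp [normInf]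
theorem normInf_sub_le (x y : V d) : normInf (x - y) ≤ normInf x + normInf y := by
  rw [sub_eq_add_neg, ← normInf_neg y]; exact normInf_add_le _ _
theorem normInf_pos (hx : x ≠ 0) : 1 ≤ normInf x := by
  by_contra h
  have : normInf x ≤ 0 := by omega
  rw [normInf_le_iff] at this
  exact hx (by ext i; simpa using this i)
theorem sz_translate (hJ : KernelHyp d J α c C) (hP : IsLRP J P) (hβ : 0 ≤ β) (w : V d) :
    ∫⁻ ω, sz ω ((· + w) '' S) (x + w) ∂P β = ∫⁻ ω, sz ω S x ∂P β := by
  simp only [← sz_shift]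
  exact hP.lintegral_shift hJ hβ w (measurable_sz S x)
theorem Xr_le_of (hJ : KernelHyp d J α c C) (hP : IsLRP J P) (hβ : 0 ≤ β) {r : ℕ} (hr : ∀ w, normInf (w - x) ≤ 2 * r → w ∈ S) :
    Xr P β r ≤ ∫⁻ ω, sz ω S x ∂P β := by
  refine Finset.sup_le fun z hz => ?_
  rw [← sz_translate hJ hP hβ (x - z)]
  rw [show z + (x - z) = x by abel]
  refine lintegral_mono fun ω => sz_mono ?_
  rintro _ ⟨w, hw, rfl⟩
  apply hr
  have : w + (x - z) - x = w - z := by abel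
  show normInf (w + (x - z) - x) ≤ 2 * r
  rw [this]
  have h1 := mem_Bx.1 hz
  have h2 := mem_Bx.1 (mem_coe.1 hw)
  have := normInf_sub_le w z
  omega
theorem le_Xr {r : ℕ} (hz : z ∈ Bx d r) : ∫⁻ ω, sz ω (Bx d r) z ∂P β ≤ Xr P β r :=
  le_sup (f := fun z => ∫⁻ ω, sz ω (Bx d r) z ∂P β) hz
theorem Xr_merge (hJ : KernelHyp d J α c C) (hP : IsLRP J P) (hβ : 0 ≤ β) {r : ℕ} (hr : 1 ≤ r) {s : ℝ} (hs : 0 ≤ s)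
    (hsc : s ≤ β * (c * (13 * r : ℝ) ^ (-(d : ℝ) - α))) :
    (Bx d r).card * (ofReal s * Xr P β r ^ 2) ≤ Xr P β (10 * r) +
      (Bx d r).card * (ofReal s ^ 2 * Xr P β (3 * r) ^ 6) := by
  classical
  have hd := hJ.d_pos
  let w : V d := fun _ => 7 * r
  let i0 : Fin d := ⟨0, hd⟩
  let B2 : Finset (V d) := (Bx d (3 * r)).image (· + w)
  have hw : normInf w ≤ 7 * r := by rw [normInf_le_iff]; intro i; simp [w]
  have hB2 : ∀ v ∈ B2, ∃ v' ∈ Bx d (3 * r), v' + w = v := fun v hv => Finset.mem_image.1 hv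
  have hB : Disjoint (Bx d (3 * r)) B2 := by
    rw [Finset.disjoint_left]
    intro u hu hu2
    obtain ⟨v, hv, rfl⟩ := hB2 u hu2
    have h1 := abs_le.1 (normInf_le_iff.1 (mem_Bx.1 hu) i0)
    have h2 := abs_le.1 (normInf_le_iff.1 (mem_Bx.1 hv) i0)
    simp only [Pi.add_apply, w] at h1
    push_cast at h1 h2
    have : (1:ℤ) ≤ r := by exact_mod_cast hr
    linarith [h1.2, h2.1]
  have hsJ : ∀ u ∈ Bx d (3 * r), ∀ v ∈ B2, s ≤ β * J u v := by
    intro u hu v hv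
    have huv : u ≠ v := fun h => Finset.disjoint_left.1 hB hu (h ▸ hv)
    refine hsc.trans ?_
    gcongr
    refine le_trans ?_ (hJ.lower u v huv)
    refine mul_le_mul_of_nonneg_left ?_ hJ.c_pos.le
    obtain ⟨v', hv', rfl⟩ := hB2 v hv
    have h1 := mem_Bx.1 hu
    have h2 := mem_Bx.1 hv'
    have h3 := normInf_sub_le u (v' + w)
    have h4 := normInf_add_le v' w
    have h5 : 1 ≤ normInf (u - (v' + w)) := normInf_pos (sub_ne_zero.2 huv)
    have h6 : normInf (u - (v' + w)) ≤ 13 * r := by omega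
    apply Real.rpow_le_rpow_of_nonpos
    · exact_mod_cast h5
    · exact_mod_cast h6
    · have := hJ.alpha_pos; have : (0:ℝ) ≤ d := by positivity
      linarith
  have key : ∀ x ∈ Bx d r, ofReal s * Xr P β r ^ 2 ≤
      tp P β (Bx d (10 * r)) 0 (x + w) + ofReal s ^ 2 * Xr P β (3 * r) ^ 6 := by
    intro x hx
    have hx3 : x ∈ Bx d (3 * r) := by rw [mem_Bx] at *; omega
    have hxB : x + w ∈ B2 := Finset.mem_image_of_mem _ hx3
    have hm := hP.merge hJ hβ (S := (Bx d (10 * r) : Set (V d))) (z := 0) (x := x + w) hB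
      (Bx_mono (by omega)) (by
        intro v hv
        obtain ⟨v', hv', rfl⟩ := hB2 v hv
        rw [mem_coe, mem_Bx] at *
        have := normInf_add_le v' w
        omega) hs hsJ (zero_mem_Bx _) hxB
    have hcoe : (B2 : Set (V d)) = (· + w) '' (Bx d (3 * r) : Set (V d)) := by simp [B2]
    have e0 : Xr P β r ≤ ∫⁻ ω, sz ω (Bx d (3 * r)) 0 ∂P β := Xr_le_of hJ hP hβ (by
      intro v hv
      rw [mem_coe, mem_Bx]
      simp only [sub_zero] at hv; omega)
    have e1 : Xr P β r ≤ ∫⁻ ω, sz ω B2 (x + w) ∂P β := by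
      rw [hcoe, sz_translate hJ hP hβ]
      refine Xr_le_of hJ hP hβ ?_
      intro v hv
      rw [mem_coe, mem_Bx]
      have h1 := mem_Bx.1 hx
      have h2 := normInf_add_le (v - x) x
      rw [sub_add_cancel] at h2; omega
    have e2 : ∫⁻ ω, sz ω (Bx d (3 * r)) 0 * sz ω (Bx d (3 * r)) 0 ∂P β ≤ Xr P β (3 * r) ^ 3 :=
      hP.sq_le _ (fun z hz => le_Xr hz) (zero_mem_Bx _)
    have e3 : ∫⁻ ω, sz ω B2 (x + w) * sz ω B2 (x + w) ∂P β ≤ Xr P β (3 * r) ^ 3 := by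
      refine hP.sq_le _ (fun v hv => ?_) hxB
      obtain ⟨v', hv', rfl⟩ := hB2 v hv
      rw [hcoe, sz_translate hJ hP hβ]
      exact le_Xr hv'
    calc ofReal s * Xr P β r ^ 2 = ofReal s * Xr P β r * Xr P β r := by ring
      _ ≤ _ := by gcongr
      _ ≤ _ := hm
      _ ≤ tp P β (Bx d (10 * r)) 0 (x + w) + ofReal s ^ 2 * Xr P β (3 * r) ^ 3 * Xr P β (3 * r) ^ 3 := by gcongr
      _ = _ := by ring
  calc _ = ∑ x ∈ Bx d r, ofReal s * Xr P β r ^ 2 := by simp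
    _ ≤ ∑ x ∈ Bx d r, (tp P β (Bx d (10 * r)) 0 (x + w) + ofReal s ^ 2 * Xr P β (3 * r) ^ 6) :=
        sum_le_sum key
    _ = ∑ x ∈ (Bx d r).image (· + w), tp P β (Bx d (10 * r)) 0 x + (Bx d r).card * (ofReal s ^ 2 * Xr P β (3 * r) ^ 6) := by
        rw [sum_add_distrib, sum_image (fun a _ b _ h => by simpa using h)]; simp
    _ ≤ _ := by
        gcongr
        refine le_trans ?_ (le_Xr (zero_mem_Bx _))
        rw [lintegral_sz]
        exact sum_le_tsum _
end Merge
section Boot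
variable {d : ℕ} {J : V d → V d → ℝ} {α c C : ℝ} {P : ℝ → Measure (Config d)} {β : ℝ}
variable {ω ω' : Config d} {S T : Set (V d)} {x y z : V d}
theorem boot (hJ : KernelHyp d J α c C) (hP : IsLRP J P) (hα1 : α < 1) (hα3 : 3 * α < d) {b A κ : ℝ}
    (hb : 0 < b) (hκ : κ = b * (c * (13 : ℝ) ^ (-(d : ℝ) - α))) (hA0 : 0 < A) (hA : 80 ≤ κ * A) :
    ∃ r0 : ℕ, 1 ≤ r0 ∧ ∀ β, b ≤ β → (∀ r, r0 ≤ r → Xr P β r ≤ ofReal (A * (r : ℝ) ^ α)) →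
      ∀ r, r0 ≤ r → Xr P β r ≤ ofReal (A / 2 * (r : ℝ) ^ α) := by
  have hc := hJ.c_pos
  have ha := hJ.alpha_pos
  have hκ0 : 0 < κ := by rw [hκ]; positivity
  have ht : Filter.Tendsto (fun r : ℕ => 3 ^ d * κ ^ 2 * A ^ 6 * 729 * (r : ℝ) ^ (-((d : ℝ) - 3 * α))) atTop (nhds 0) := by
    have := ((tendsto_rpow_neg_atTop (show (0:ℝ) < d - 3 * α by linarith)).comp tendsto_natCast_atTop_atTop).const_mul (3 ^ d * κ ^ 2 * A ^ 6 * 729)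
    simpa using this
  obtain ⟨r0, hr0⟩ := eventually_atTop.1 (ht.eventually (gt_mem_nhds (show (0:ℝ) < 10 * A by positivity)))
  refine ⟨max r0 1, le_max_right _ _, fun β hβ h r hr => ?_⟩
  by_contra hlt
  push Not at hlt
  have hr1 : 1 ≤ r := (le_max_right _ _).trans hr
  have hr1' : (1:ℝ) ≤ r := by exact_mod_cast hr1
  have hrpos : (0:ℝ) < r := by linarith
  have hη := hr0 r ((le_max_left _ _).trans hr)
  set ρ := (r : ℝ) ^ α with hρ
  have hρ0 : 0 < ρ := by positivity
  set D := (r : ℝ) ^ d with hD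
  have hD0 : 0 < D := by positivity
  have hrd : (r : ℝ) ^ (-(d : ℝ) - α) = 1 / (D * ρ) := by
    rw [Real.rpow_sub hrpos, Real.rpow_neg hrpos.le, Real.rpow_natCast, ← hD, ← hρ]; field_simp
  have hη' : (r : ℝ) ^ (-((d : ℝ) - 3 * α)) = ρ ^ 3 / D := by
    rw [neg_sub, Real.rpow_sub hrpos, Real.rpow_natCast, ← hD, mul_comm, Real.rpow_mul hrpos.le, ← hρ]
    norm_cast
  rw [hη'] at hη
  have hm := Xr_merge hJ hP (hb.le.trans hβ) hr1 (s := κ * (1 / (D * ρ))) (by positivity) (by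
    rw [Real.mul_rpow (by norm_num) hrpos.le, hrd, hκ]
    have : (0:ℝ) < 13 ^ (-(d:ℝ) - α) := by positivity
    calc _ = b * (c * (13 ^ (-(d:ℝ) - α) * (1 / (D * ρ)))) := by ring
      _ ≤ _ := by gcongr)
  have h3 := h (3 * r) (hr.trans (by omega))
  have h10 := h (10 * r) (hr.trans (by omega))
  set N : ℝ := ((2 * r + 1 : ℕ) : ℝ) ^ d with hN
  have hNc : ((Bx d r).card : ℝ≥0∞) = ofReal N := by
    rw [card_Bx, hN, ← Nat.cast_pow, ofReal_natCast]
  have hND : D ≤ N := by rw [hN, hD]; gcongr; push_cast; linarith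
  have hND3 : N ≤ 3 ^ d * D := by rw [hN, hD, ← mul_pow]; gcongr; push_cast; linarith
  have hN0 : 0 < N := hD0.trans_le hND
  have hp10 : A * ((10 * r : ℕ) : ℝ) ^ α ≤ A * (10 * ρ) := by
    push_cast
    rw [Real.mul_rpow (by norm_num) hrpos.le]
    gcongr
    calc (10:ℝ) ^ α ≤ 10 ^ (1:ℝ) := Real.rpow_le_rpow_of_exponent_le (by norm_num) hα1.le
      _ = 10 := by simp
  have hp3 : A * ((3 * r : ℕ) : ℝ) ^ α ≤ A * (3 * ρ) := by
    push_cast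
    rw [Real.mul_rpow (by norm_num) hrpos.le]
    gcongr
    calc (3:ℝ) ^ α ≤ 3 ^ (1:ℝ) := Real.rpow_le_rpow_of_exponent_le (by norm_num) hα1.le
      _ = 3 := by simp
  set s := κ * (1 / (D * ρ)) with hs
  have hs0 : 0 ≤ s := by positivity
  have hreal : N * (s * (A / 2 * ρ) ^ 2) ≤ A * (10 * ρ) + N * (s ^ 2 * (A * (3 * ρ)) ^ 6) := by
    rw [← ofReal_le_ofReal_iff (by positivity), ofReal_add (by positivity) (by positivity),
      ofReal_mul hN0.le, ofReal_mul hN0.le, ofReal_mul hs0, ofReal_mul (p := s ^ 2) (by positivity),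
      ofReal_pow (p := A / 2 * ρ) (by positivity), ofReal_pow (p := s) (by positivity), ofReal_pow (p := A * (3 * ρ)) (by positivity), ← hNc]
    calc _ ≤ (Bx d r).card * (ofReal s * Xr P β r ^ 2) := by gcongr
      _ ≤ _ := hm
      _ ≤ _ := by
        gcongr
        · exact h10.trans (ofReal_le_ofReal hp10)
        · exact h3.trans (ofReal_le_ofReal hp3)
  have e1 : N * (s * (A / 2 * ρ) ^ 2) = (N / D) * (κ * A) * A / 4 * ρ := by rw [hs]; field_simp; ring
  have e2 : N * (s ^ 2 * (A * (3 * ρ)) ^ 6) = (N / D) * κ ^ 2 * A ^ 6 * 729 * (ρ ^ 3 / D) * ρ := by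
    rw [hs]; field_simp; ring
  rw [e1, e2] at hreal
  have hq1 : 1 ≤ N / D := by rw [le_div_iff₀ hD0]; linarith
  have hq2 : N / D ≤ 3 ^ d := by rw [div_le_iff₀ hD0]; linarith
  have f1 : 20 * A * ρ ≤ (N / D) * (κ * A) * A / 4 * ρ := by
    have : 1 * 80 ≤ (N / D) * (κ * A) := mul_le_mul hq1 hA (by norm_num) (by positivity)
    have h80 : 80 * A ≤ (N / D) * (κ * A) * A := mul_le_mul_of_nonneg_right (by linarith) hA0.le
    refine mul_le_mul_of_nonneg_right ?_ hρ0.le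
    linarith
  have f2 : (N / D) * κ ^ 2 * A ^ 6 * 729 * (ρ ^ 3 / D) * ρ < 10 * A * ρ := by
    refine mul_lt_mul_of_pos_right (lt_of_le_of_lt ?_ hη) hρ0
    gcongr
  linarith
theorem Xr_le_ch (hJ : KernelHyp d J α c C) (hP : IsLRP J P) (hβ : 0 ≤ β) (r : ℕ) : Xr P β r ≤ ch P β := by
  refine (Xr_le_of hJ hP hβ (x := 0) (S := univ) (by simp)).trans_eq ?_
  rw [lintegral_sz, ch]
theorem Xr_mono (hJ : KernelHyp d J α c C) (hP : IsLRP J P) {β' : ℝ} (hβ : 0 ≤ β) (h : β ≤ β') (r : ℕ) :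
    Xr P β r ≤ Xr P β' r := by
  refine Finset.sup_mono_fun fun z _ => ?_
  rw [lintegral_sz, lintegral_sz]
  exact tsum_le_tsum fun _ => hP.tp_beta_mono hJ hβ h
noncomputable def LX (J : V d → V d → ℝ) (r : ℕ) : ℝ := (Bx d r).card * ∑ e ∈ (Bx d r).sym2, wt J e
theorem LX_nonneg (hJ : KernelHyp d J α c C) (r : ℕ) : 0 ≤ LX J r :=
  mul_nonneg (by positivity) (sum_nonneg fun e _ => hJ.wt_nonneg e)
theorem Xr_lip (hJ : KernelHyp d J α c C) (hP : IsLRP J P) {β' : ℝ} (hβ : 0 ≤ β) (h : β ≤ β') (r : ℕ) :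
    Xr P β' r ≤ Xr P β r + ofReal ((β' - β) * LX J r) := by
  refine Finset.sup_le fun z hz => ?_
  have hw : 0 ≤ ∑ e ∈ (Bx d r).sym2, wt J e := sum_nonneg fun e _ => hJ.wt_nonneg e
  calc ∫⁻ ω, sz ω (Bx d r) z ∂P β' = ∑ y ∈ Bx d r, tp P β' (Bx d r) z y := by
        rw [lintegral_sz]; exact tsum_eq_sum fun y hy => tp_zero (by simpa using hy)
    _ ≤ ∑ y ∈ Bx d r, (tp P β (Bx d r) z y + ofReal ((β' - β) * ∑ e ∈ (Bx d r).sym2, wt J e)) := by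
        refine sum_le_sum fun y _ => ?_
        exact hP.lip hJ hβ h _ (by rw [← Ein_finset]; exact Dep_connIn _ _ _)
    _ = ∑ y ∈ Bx d r, tp P β (Bx d r) z y + ofReal ((β' - β) * LX J r) := by
        rw [sum_add_distrib, sum_const, LX, nsmul_eq_mul]
        congr 1
        rw [← ofReal_natCast, ← ofReal_mul (by positivity)]
        congr 1; ring
    _ ≤ _ := by
        gcongr
        refine (sum_le_tsum _).trans ?_
        rw [← lintegral_sz]; exact le_Xr hz
theorem restricted (hJ : KernelHyp d J α c C) (hP : IsLRP J P) (hα1 : α < 1) (hα3 : 3 * α < d) :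
    ∃ A : ℝ, 0 < A ∧ ∃ r0 : ℕ, 1 ≤ r0 ∧ ∀ β, 0 ≤ β → ch P β ≠ ⊤ → ∀ r, r0 ≤ r →
      Xr P β r ≤ ofReal (A * (r : ℝ) ^ α) := by
  have hc := hJ.c_pos
  have ha := hJ.alpha_pos
  have hj := hJ.Jn_nonneg
  set b : ℝ := 1 / (2 * Jn J + 1) with hb
  have hb0 : 0 < b := by positivity
  set κ : ℝ := b * (c * (13 : ℝ) ^ (-(d : ℝ) - α)) with hκ
  have hκ0 : 0 < κ := by positivity
  set A : ℝ := 80 / κ + 4 with hA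
  have hA4 : 4 ≤ A := by rw [hA]; have : 0 < 80 / κ := by positivity
                         linarith
  have hA80 : 80 ≤ κ * A := by rw [hA, mul_add, mul_div_cancel₀ _ hκ0.ne']; nlinarith
  obtain ⟨r0, hr0, hboot⟩ := boot hJ hP hα1 hα3 hb0 hκ (by linarith) hA80
  refine ⟨A, by linarith, r0, hr0, fun β0 hβ0 hch r hr => ?_⟩
  have hone : ∀ r, r0 ≤ r → 1 ≤ (r : ℝ) ^ α := fun r hr =>
    Real.one_le_rpow (by exact_mod_cast hr0.trans hr) ha.le
  obtain ⟨R, hR⟩ : ∃ R : ℕ, ∀ r, R ≤ r → ch P β0 ≤ ofReal (A * (r : ℝ) ^ α) := by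
    have : Filter.Tendsto (fun r : ℕ => A * (r : ℝ) ^ α) atTop atTop :=
      ((tendsto_rpow_atTop ha).comp tendsto_natCast_atTop_atTop).const_mul_atTop (by linarith)
    obtain ⟨R, hR⟩ := eventually_atTop.1 (this.eventually_ge_atTop (ch P β0).toReal)
    refine ⟨R, fun r hr => ?_⟩
    rw [← ofReal_toReal hch]
    exact ofReal_le_ofReal (hR r hr)
  set L : ℝ := ∑ r ∈ range R, LX J r with hL
  have hL0 : 0 ≤ L := sum_nonneg fun r _ => LX_nonneg hJ r
  set δ : ℝ := 1 / (L + 1) with hδ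
  have hδ0 : 0 < δ := by positivity
  have hind : ∀ k : ℕ, ∀ β, 0 ≤ β → β ≤ β0 → β ≤ b + k * δ → ∀ r, r0 ≤ r →
      Xr P β r ≤ ofReal (A * (r : ℝ) ^ α) := by
    intro k
    induction k with
    | zero =>
      intro β h0 _ h r hr
      refine (Xr_le_ch hJ hP h0 r).trans ((hP.ch_small hJ h0 (by rw [← hb]; simpa using h)).trans ?_)
      rw [show (2:ℝ≥0∞) = ofReal 2 by simp]
      apply ofReal_le_ofReal
      nlinarith [hone r hr]
    | succ k ih =>
      intro β h0 h1 h r hr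
      by_cases hle : β ≤ b + k * δ
      · exact ih β h0 h1 hle r hr
      push Not at hle
      by_cases hrR : R ≤ r
      · exact (Xr_le_ch hJ hP h0 r).trans ((hP.ch_mono hJ h0 h1).trans (hR r hrR))
      push Not at hrR
      have hbk : 0 ≤ b + k * δ := by positivity
      refine (Xr_lip hJ hP hbk hle.le r).trans ?_
      have h2 := hboot (b + k * δ) (le_add_of_nonneg_right (by positivity)) (ih _ hbk (hle.le.trans h1) le_rfl) r hr
      refine (add_le_add_left h2 _).trans ?_
      rw [← ofReal_add (by positivity) (mul_nonneg (by linarith) (LX_nonneg hJ r))]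
      apply ofReal_le_ofReal
      have h3 : LX J r ≤ L := Finset.single_le_sum (f := fun r => LX J r) (fun r _ => LX_nonneg hJ r) (Finset.mem_range.2 hrR)
      have h4 : (β - (b + k * δ)) * LX J r ≤ δ * L := by
        apply mul_le_mul _ h3 (LX_nonneg hJ r) hδ0.le
        push_cast at h; linarith
      have h5 : δ * L ≤ 1 := by rw [hδ, one_div_mul_eq_div, div_le_one (by positivity)]; linarith
      nlinarith [hone r hr]
  obtain ⟨k, hk⟩ := exists_nat_ge (β0 / δ)
  refine hind k β0 hβ0 le_rfl ?_ r hr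
  rw [div_le_iff₀ hδ0] at hk; linarith
theorem normInf_lt_pos_card (hJ : KernelHyp d J α c C) (r : ℕ) : (r : ℝ) ^ (d:ℝ) ≤ (Bx d r).card := by
  rw [card_Bx, Real.rpow_natCast]; push_cast; gcongr; linarith
theorem ch_top (hJ : KernelHyp d J α c C) (hP : IsLRP J P) (hα1 : α < 1) (hα3 : 3 * α < d) :
    ∃ b : ℝ, 0 < b ∧ ∀ β, b ≤ β → ch P β = ⊤ := by
  obtain ⟨A, hA, r0, hr0, h⟩ := restricted hJ hP hα1 hα3
  have hc := hJ.c_pos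
  have ha := hJ.alpha_pos
  have : Filter.Tendsto (fun r : ℕ => (r : ℝ) ^ ((d:ℝ) - α)) atTop atTop :=
      ((tendsto_rpow_atTop (by linarith [hJ.alpha_lt_d])).comp tendsto_natCast_atTop_atTop)
  obtain ⟨R, hR⟩ := eventually_atTop.1 (this.eventually_gt_atTop (2 * A))
  set r := max R r0
  have hr1 : 1 ≤ r := hr0.trans (le_max_right _ _)
  have hrpos : (0:ℝ) < r := by exact_mod_cast hr1
  have hbig : A * (r:ℝ) ^ α < (Bx d r).card / 2 := by
    have h1 := hR r (le_max_left _ _)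
    rw [Real.rpow_sub hrpos, lt_div_iff₀ (by positivity)] at h1
    have h2 := normInf_lt_pos_card hJ r
    linarith
  set m : ℝ := c * (r : ℝ) ^ (-(d:ℝ) - α)
  have hm : 0 < m := by positivity
  refine ⟨Real.log 2 / m, div_pos (Real.log_pos (by norm_num)) hm, fun β hβ => ?_⟩
  have hβ0 : 0 ≤ β := (div_pos (Real.log_pos (by norm_num)) hm).le.trans hβ
  by_contra hne
  have h1 := h β hβ0 hne r (le_max_right _ _)
  have h2 : ∀ y ∈ Bx d r, ofReal (1 / 2) ≤ tp P β (Bx d r) 0 y := by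
    intro y hy
    by_cases hy0 : y = 0
    · subst hy0; rw [hP.tp_self (zero_mem_Bx r)]; simp
    have : P β {ω | ω s(0, y) = true} ≤ tp P β (Bx d r) 0 y :=
      measure_mono fun ω hω => connIn.step (zero_mem_Bx r) hy ⟨Ne.symm hy0, hω⟩
    refine le_trans ?_ this
    rw [hP.open_eq, edgeProb_eq, hJ.wt_mk]
    apply ofReal_le_ofReal
    have hJm : m ≤ J 0 y := by
      refine le_trans ?_ (hJ.lower 0 y (Ne.symm hy0))
      refine mul_le_mul_of_nonneg_left ?_ hc.le
      apply Real.rpow_le_rpow_of_nonpos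
      · exact_mod_cast normInf_pos (sub_ne_zero.2 (Ne.symm hy0))
      · rw [zero_sub, normInf_neg]; exact_mod_cast mem_Bx.1 hy
      · linarith [show (0:ℝ) ≤ d by positivity]
    have h3 : Real.log 2 ≤ β * J 0 y := by
      rw [div_le_iff₀ hm] at hβ
      exact hβ.trans (by gcongr)
    have : exp (-β * J 0 y) ≤ 1 / 2 := by
      rw [neg_mul, Real.exp_neg, ← one_div]
      apply one_div_le_one_div_of_le (by norm_num)
      rw [← Real.exp_log (show (0:ℝ) < 2 by norm_num)]
      exact exp_le_exp.2 h3
    linarith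
  have h3 : ofReal ((Bx d r).card / 2) ≤ Xr P β r := by
    refine le_trans ?_ (le_Xr (zero_mem_Bx r))
    rw [lintegral_sz]
    refine le_trans ?_ (sum_le_tsum (Bx d r))
    refine le_trans (le_of_eq ?_) (sum_le_sum h2)
    rw [sum_const, nsmul_eq_mul, ← ofReal_natCast, ← ofReal_mul (by positivity)]
    congr 1; ring
  have := (ofReal_le_ofReal_iff (by positivity)).1 (h3.trans h1)
  linarith
theorem exists_bT (hJ : KernelHyp d J α c C) (hP : IsLRP J P) (hα1 : α < 1) (hα3 : 3 * α < d) :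
    ∃ bT : ℝ, 0 < bT ∧ (∀ β, 0 ≤ β → β < bT → ch P β ≠ ⊤) ∧ (∀ β, bT < β → ch P β = ⊤) ∧
      (∀ S : Finset (V d), 0 ∈ S → 1 ≤ phi J P bT S) ∧
      ∃ A : ℝ, 0 < A ∧ ∀ r : ℕ, 1 ≤ r → Xr P bT r ≤ ofReal (A * (r : ℝ) ^ α) := by
  obtain ⟨b, hb, hbt⟩ := ch_top hJ hP hα1 hα3
  set X : Set ℝ := {β | 0 ≤ β ∧ ch P β ≠ ⊤}
  have hj := hJ.Jn_nonneg
  have hX1 : 1 / (2 * Jn J + 1) ∈ X := ⟨by positivity, ne_top_of_le_ne_top (by simp) (hP.ch_small hJ (by positivity) le_rfl)⟩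
  have hbdd : BddAbove X := ⟨b, fun β hβ => by
    by_contra h; push Not at h; exact hβ.2 (hbt β h.le)⟩
  have hpos : 0 < sSup X := lt_of_lt_of_le (by positivity) (le_csSup hbdd hX1)
  have hgt : ∀ β, sSup X < β → ch P β = ⊤ := fun β h => by
    by_contra hne
    exact absurd (le_csSup hbdd (show β ∈ X from ⟨hpos.le.trans h.le, hne⟩)) (not_le.2 h)
  have hlt : ∀ β, 0 ≤ β → β < sSup X → ch P β ≠ ⊤ := fun β h0 h => by
    obtain ⟨β', hβ', hlt⟩ := exists_lt_of_lt_csSup ⟨_, hX1⟩ h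
    exact ne_top_of_le_ne_top hβ'.2 (hP.ch_mono hJ h0 hlt.le)
  refine ⟨sSup X, hpos, hlt, hgt, ?_, ?_⟩
  · intro S hS
    by_contra h
    push Not at h
    obtain ⟨β', hβ', h'⟩ := hP.phi_cont hJ hpos.le S h
    have := hP.ch_le_of_phi hJ (hpos.le.trans hβ'.le) S hS h'
    rw [hgt β' hβ', top_le_iff] at this
    refine mul_ne_top (natCast_ne_top _) ?_ this
    exact inv_ne_top.2 (tsub_pos_of_lt h').ne'
  · obtain ⟨A, hA, r0, hr0, h⟩ := restricted hJ hP hα1 hα3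
    have ha := hJ.alpha_pos
    refine ⟨A + (Bx d r0).card, by positivity, fun r hr => ?_⟩
    have hr1 : 1 ≤ (r : ℝ) ^ α := Real.one_le_rpow (by exact_mod_cast hr) ha.le
    by_cases hrr : r0 ≤ r
    · have : Xr P (sSup X) r ≤ ofReal (A * (r : ℝ) ^ α) := by
        have ht : Filter.Tendsto (fun β => ofReal (A * (r : ℝ) ^ α) + ofReal ((sSup X - β) * LX J r))
            (nhdsWithin (sSup X) (Set.Iio (sSup X))) (nhds (ofReal (A * (r : ℝ) ^ α) + ofReal ((sSup X - sSup X) * LX J r))) :=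
          Filter.Tendsto.const_add _ (tendsto_ofReal (Filter.Tendsto.mul_const _
            (Filter.Tendsto.const_sub _ (tendsto_id.mono_left nhdsWithin_le_nhds))))
        simp only [sub_self, zero_mul, ofReal_zero, add_zero] at ht
        refine ge_of_tendsto ht ?_
        filter_upwards [Ioo_mem_nhdsLT hpos] with β hβ
        exact (Xr_lip hJ hP hβ.1.le hβ.2.le r).trans (add_le_add_left (h β hβ.1.le (hlt β hβ.1.le hβ.2) r hrr) _)
      refine this.trans (ofReal_le_ofReal ?_)
      have : (0:ℝ) ≤ (Bx d r0).card := by positivity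
      nlinarith
    · push Not at hrr
      haveI := hP.prob (sSup X)
      have h1 : Xr P (sSup X) r ≤ (Bx d r0).card := by
        refine Finset.sup_le fun z _ => ?_
        calc ∫⁻ ω, sz ω (Bx d r) z ∂P (sSup X) ≤ ∫⁻ ω, ((Bx d r0).card : ℝ≥0∞) ∂P (sSup X) :=
              lintegral_mono fun ω => (sz_mono (Bx_mono hrr.le)).trans (sz_le_card _ _)
          _ = _ := by simp
      refine h1.trans ?_
      rw [← ofReal_natCast]
      apply ofReal_le_ofReal
      have : (0:ℝ) ≤ (Bx d r0).card := by positivity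
      nlinarith
end Boot
section Sprinkle
variable {d : ℕ} {J : V d → V d → ℝ} {α c C : ℝ} {P : ℝ → Measure (Config d)} {β : ℝ}
variable {ω ω' : Config d} {S T : Set (V d)} {x y z : V d}
theorem sum_J_le (hJ : KernelHyp d J α c C) (T : Finset (V d)) (u : V d) : ∑ v ∈ T, J u v ≤ Jn J := by
  rw [← ofReal_le_ofReal_iff hJ.Jn_nonneg, ofReal_sum_of_nonneg fun v _ => hJ.nonneg u v]
  have := hJ.tsum_J zero_le_one u
  simp only [one_mul] at this
  rw [← this]
  exact sum_le_tsum _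
theorem open_lower_inf (hJ : KernelHyp d J α c C) (hP : IsLRP J P) {ε : ℝ} (hε : 0 ≤ ε) {D : Finset (V d)}
    (hD : (D : Set (V d)) ⊆ S) {Q : ℝ} (hQ : D.card * Jn J ≤ Q) :
    ofReal ε * ∑ u ∈ D, ∑' v, kout J 1 S u v ≤
      P ε {ω | ∃ u ∈ D, ∃ v ∉ S, ω s(u, v) = true} + ofReal ((ε * Q) ^ 2) := by
  classical
  rw [← Summable.tsum_finsetSum (fun _ _ => summable), tsum_eq_iSup_sum, mul_iSup]
  refine iSup_le fun T => ?_
  set T' := T.filter (fun v => v ∉ S)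
  have h1 : ∑ v ∈ T, ∑ u ∈ D, kout J 1 S u v = ofReal (∑ u ∈ D, ∑ v ∈ T', J u v) := by
    rw [Finset.sum_comm, ofReal_sum_of_nonneg fun u _ => sum_nonneg fun v _ => hJ.nonneg u v]
    refine sum_congr rfl fun u _ => ?_
    rw [ofReal_sum_of_nonneg fun v _ => hJ.nonneg u v, Finset.sum_filter]
    refine sum_congr rfl fun v _ => ?_
    unfold kout; by_cases h : v ∈ S <;> simp [h]
  rw [h1, ← ofReal_mul hε]
  have hsum0 : 0 ≤ ∑ u ∈ D, ∑ v ∈ T', J u v := sum_nonneg fun u _ => sum_nonneg fun v _ => hJ.nonneg u v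
  let E : Finset (Sym2 (V d)) := (D ×ˢ T').image fun p => s(p.1, p.2)
  have hE : ∑ e ∈ E, wt J e = ∑ u ∈ D, ∑ v ∈ T', J u v := by
    rw [sum_image, ← Finset.sum_product']
    · exact sum_congr rfl fun p _ => hJ.wt_mk _ _
    · intro p hp q hq hpq
      simp only [Finset.coe_product, mem_prod, mem_coe, T', mem_filter] at hp hq
      simp only [Sym2.eq_iff] at hpq
      rcases hpq with h | h
      · exact Prod.ext h.1 h.2
      · exact absurd (hD hp.1) (h.1 ▸ hq.2.2)
  refine (hP.open_lower hJ hε E (mul_nonneg hε hsum0) (by rw [hE])).trans ?_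
  refine add_le_add (measure_mono ?_) (ofReal_le_ofReal ?_)
  · rintro ω ⟨e, he, heo⟩
    simp only [E, T', Finset.mem_image, mem_product, mem_filter] at he
    obtain ⟨⟨u, v⟩, ⟨hu, hv⟩, rfl⟩ := he
    exact ⟨u, hu, v, hv.2, heo⟩
  · have : ∑ u ∈ D, ∑ v ∈ T', J u v ≤ Q := by
      refine le_trans ?_ hQ
      refine (sum_le_sum fun u _ => sum_J_le hJ T' u).trans_eq ?_
      simp
    gcongr
def Esc (B : Set (V d)) : Set (Config d) := {ω | ∃ y, y ∉ B ∧ connIn ω univ 0 y}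
theorem measurableSet_Esc (B : Set (V d)) : MeasurableSet (Esc B) := by
  have : Esc B = ⋃ y : V d, ⋃ _ : y ∉ B, {ω | connIn ω univ 0 y} := by ext; simp [Esc]
  rw [this]
  exact MeasurableSet.iUnion fun y => MeasurableSet.iUnion fun _ => measurableSet_connIn _ _ _
theorem Inc_Esc (B : Set (V d)) : Inc (Esc B) := fun ω ω' h ⟨y, hy, hc⟩ => ⟨y, hy, hc.inc h⟩
def GS (B S : Set (V d)) : Set (Config d) :=
  {ω | (∀ u ∈ S, ∀ v ∉ S, ω s(u, v) = false) ∧ ∀ x ∈ B, x ∉ S → ∃ y, y ∉ B ∧ connIn ω Sᶜ x y}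
theorem measurableSet_GS (B S : Set (V d)) : MeasurableSet (GS B S) := by
  have : GS B S = (⋂ u : V d, ⋂ _ : u ∈ S, ⋂ v : V d, ⋂ _ : v ∉ S, {ω | ω s(u, v) = true}ᶜ) ∩
      (⋂ x : V d, ⋂ _ : x ∈ B, ⋂ _ : x ∉ S, ⋃ y : V d, ⋃ _ : y ∉ B, {ω | connIn ω Sᶜ x y}) := by
    ext; simp [GS]
  rw [this]
  refine MeasurableSet.inter ?_ ?_
  · exact MeasurableSet.iInter fun u => MeasurableSet.iInter fun _ => MeasurableSet.iInter fun v =>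
      MeasurableSet.iInter fun _ => (measurableSet_open _).compl
  · exact MeasurableSet.iInter fun u => MeasurableSet.iInter fun _ => MeasurableSet.iInter fun v =>
      MeasurableSet.iUnion fun _ => MeasurableSet.iUnion fun _ => measurableSet_connIn _ _ _
theorem Dep_GS (B S : Set (V d)) : Dep (GS B S) (Ein S)ᶜ := by
  have key : ∀ ω ω' : Config d, (∀ e ∈ (Ein S)ᶜ, ω e = ω' e) → ω ∈ GS B S → ω' ∈ GS B S := by
    rintro ω ω' h ⟨h1, h2⟩
    refine ⟨fun u hu v hv => ?_, fun x hx hxS => ?_⟩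
    · rw [← h _ (fun hh => hv (mk_mem_Ein.1 hh).2)]; exact h1 u hu v hv
    · obtain ⟨y, hy, hc⟩ := h2 x hx hxS
      refine ⟨y, hy, hc.congr fun e he => h e ?_⟩
      intro he'
      induction e with
      | _ a b => exact (mk_mem_Ein.1 he).1 (mk_mem_Ein.1 he').1
  exact fun ω ω' h => ⟨key ω ω' h, key ω' ω fun e he => (h e he).symm⟩
theorem GS_stay {B S : Set (V d)} (h : ω ∈ GS B S) (hx : x ∈ S) (hc : connIn ω T x y) : y ∈ S := by
  refine connIn_induction hc hx fun a b _ ha _ hab => ?_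
  by_contra hb
  have := h.1 a ha b hb
  rw [hab.2] at this; cases this
theorem GS_disj {B S S' : Set (V d)} (hS : S ⊆ B) (h : ω ∈ GS B S) (h' : ω ∈ GS B S') : S ⊆ S' := by
  intro x hx
  by_contra hx'
  obtain ⟨y, hy, hc⟩ := h'.2 x (hS hx) hx'
  exact hy (hS (GS_stay h hx hc))
theorem GS_cover (B : Set (V d)) (hω : ω ∉ Esc B) : ∃ S ⊆ B, 0 ∈ S ∧ ω ∈ GS B S := by
  have h0 : ∀ y, connIn ω univ 0 y → y ∈ B := fun y hy => by
    by_contra h; exact hω ⟨y, h, hy⟩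
  refine ⟨{x | x ∈ B ∧ ∀ y, connIn ω univ x y → y ∈ B}, fun x hx => hx.1,
    ⟨h0 0 (.refl trivial), h0⟩, ?_, ?_⟩
  · rintro u ⟨hu, hu'⟩ v hv
    by_contra ho
    have ho : ω s(u, v) = true := by simpa using ho
    by_cases huv : u = v
    · subst huv; exact hv ⟨hu, hu'⟩
    have huv' : connIn ω univ u v := .step trivial trivial ⟨huv, ho⟩
    exact hv ⟨hu' v huv', fun y hy => hu' y (huv'.trans hy)⟩
  · intro x hx hxS
    have : ∃ y, connIn ω univ x y ∧ y ∉ B := by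
      by_contra hn; push Not at hn; exact hxS ⟨hx, hn⟩
    obtain ⟨y, hxy, hy⟩ := this
    refine ⟨y, hy, ?_⟩
    have hpre : ∀ a, connIn ω univ x a → a ∈ {x | x ∈ B ∧ ∀ y, connIn ω univ x y → y ∈ B}ᶜ :=
      fun a ha h => hy (h.2 y (ha.symm.trans hxy))
    refine connIn_induction (p := fun b => connIn ω _ x b) hxy (.refl hxS) fun a b ha hp _ hab => ?_
    exact hp.trans (.step hp.2.1 (hpre b (ha.trans (.step trivial trivial hab))) hab)
theorem sprinkle (hJ : KernelHyp d J α c C) (hP : IsLRP J P) (hβ : 0 < β) {ε : ℝ} (hε : 0 ≤ ε) (B : Finset (V d))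
    (hphi : ∀ S : Finset (V d), 0 ∈ S → 1 ≤ phi J P β S) :
    P β (Esc B) + ofReal (ε / β) * P β (Esc B)ᶜ ≤
      P (β + ε) (Esc B) + ofReal ((ε * (B.card * Jn J)) ^ 2) := by
  classical
  haveI := hP.prob
  let O : Finset (V d) → Finset (V d) → Set (Config d) := fun S D => {ω | ∃ u ∈ D, ∃ v ∉ (S : Set (V d)), ω s(u, v) = true}
  let I := B.powerset.filter (fun S => 0 ∈ S)
  let R : Finset (V d) → Finset (V d) → Set (Config d) := fun S D => GS B S ∩ {ω | Cl ω S 0 = D}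
  have hRm : ∀ S D, MeasurableSet (R S D) := fun S D => (measurableSet_GS _ _).inter (measurableSet_Cl _ _ _)
  have hOm : ∀ S D, MeasurableSet (O S D) := by
    intro S D
    have : O S D = ⋃ u : V d, ⋃ _ : u ∈ D, ⋃ v : V d, ⋃ _ : v ∉ (S : Set (V d)), {ω | ω s(u, v) = true} := by
      ext; simp [O]
    rw [this]
    exact MeasurableSet.iUnion fun u => MeasurableSet.iUnion fun _ => MeasurableSet.iUnion fun v =>
      MeasurableSet.iUnion fun _ => measurableSet_open _
  have hI : ∀ S ∈ I, S ⊆ B ∧ 0 ∈ S := fun S hS => by simpa [I] using hS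
  have hcoup : P β (Esc B) + ∑ S ∈ I, ∑' D, P β (R S D) * P ε (O S D) ≤ P (β + ε) (Esc B) := by
    rw [hP.coupling hJ hβ.le hε, Measure.map_apply measurable_cor (measurableSet_Esc _)]
    have e1 : P β (Esc B) = (P β).prod (P ε) (Esc B ×ˢ univ) := by simp
    have e2 : ∑ S ∈ I, ∑' D, P β (R S D) * P ε (O S D) =
        (P β).prod (P ε) (⋃ S ∈ I, ⋃ D, R S D ×ˢ O S D) := by
      rw [measure_biUnion_finset]
      · refine sum_congr rfl fun S hS => ?_
        rw [measure_iUnion]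
        · simp only [Measure.prod_prod]
        · intro D D' hD
          refine Set.disjoint_left.2 fun p hp hp' => hD ?_
          have a1 : Cl p.1 S 0 = D := hp.1.2
          have a2 : Cl p.1 S 0 = D' := hp'.1.2
          exact_mod_cast a1.symm.trans a2
        · exact fun D => (hRm _ _).prod (hOm _ _)
      · intro S hS S' hS' hne
        refine Set.disjoint_left.2 fun p hp hp' => hne ?_
        simp only [mem_iUnion] at hp hp'
        obtain ⟨D, hD⟩ := hp
        obtain ⟨D', hD'⟩ := hp'
        have hSB : (S : Set (V d)) ⊆ B := by exact_mod_cast (hI S hS).1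
        have hSB' : (S' : Set (V d)) ⊆ B := by exact_mod_cast (hI S' hS').1
        have := Set.Subset.antisymm (GS_disj hSB hD.1.1 hD'.1.1) (GS_disj hSB' hD'.1.1 hD.1.1)
        exact_mod_cast this
      · intro S _
        exact MeasurableSet.iUnion fun D => (hRm _ _).prod (hOm _ _)
    rw [e1, e2, ← measure_union']
    · refine measure_mono ?_
      rintro ⟨ω1, ω2⟩ (h | h)
      · exact Inc_Esc _ ω1 _ (fun e he => by simp [cor, he]) h.1
      · simp only [mem_iUnion] at h
        obtain ⟨S, hS, D, ⟨hG, hD⟩, u, hu, v, hv, ho⟩ := h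
        have hD : Cl ω1 S 0 = D := hD
        have h1 : ∀ e, ω1 e = true → cor (ω1, ω2) e = true := fun e he => by simp [cor, he]
        have hu0 : connIn ω1 S 0 u := by rw [← mem_Cl, hD]; exact hu
        have huv : connIn (cor (ω1, ω2)) univ 0 v := by
          refine ((hu0.inc h1).mono (subset_univ _)).trans (.step trivial trivial ⟨?_, ?_⟩)
          · rintro rfl; exact hv hu0.2.1
          · have ho : ω2 s(u, v) = true := ho
            simp [cor, ho]
        by_cases hvB : v ∈ B
        · obtain ⟨y, hy, hc⟩ := hG.2 v hvB hv
          exact ⟨y, hy, huv.trans ((hc.inc h1).mono (subset_univ _))⟩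
        · exact ⟨v, hvB, huv⟩
    · refine Set.disjoint_left.2 fun p hp hp' => ?_
      simp only [mem_iUnion] at hp'
      obtain ⟨S, hS, D, hD⟩ := hp'
      obtain ⟨y, hy, hc⟩ := hp.1
      exact hy ((hI S hS).1 (GS_stay hD.1.1 (hI S hS).2 hc))
    · exact (measurableSet_Esc _).prod MeasurableSet.univ
  have hcompl : P β (Esc B)ᶜ ≤ ∑ S ∈ I, P β (GS B S) := by
    refine le_trans (measure_mono ?_) (measure_biUnion_finset_le _ _)
    intro ω hω
    obtain ⟨S, hS, h0, hG⟩ := GS_cover (B : Set (V d)) hω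
    have hf : S.Finite := B.finite_toSet.subset hS
    simp only [mem_iUnion]
    refine ⟨hf.toFinset, ?_, by simpa using hG⟩
    simp only [I, mem_filter, Finset.mem_powerset, hf.mem_toFinset, h0, and_true]
    intro x hx; exact hS (by simpa using hx)
  have hsum1 : ∑ S ∈ I, P β (GS B S) ≤ 1 := by
    rw [← measure_biUnion_finset]
    · exact prob_le_one
    · intro S hS S' hS' hne
      refine Set.disjoint_left.2 fun p hp hp' => hne ?_
      have hSB : (S : Set (V d)) ⊆ B := by exact_mod_cast (hI S hS).1
      have hSB' : (S' : Set (V d)) ⊆ B := by exact_mod_cast (hI S' hS').1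
      have := Set.Subset.antisymm (GS_disj hSB hp hp') (GS_disj hSB' hp' hp)
      exact_mod_cast this
    · exact fun S _ => measurableSet_GS _ _
  have hS : ∀ S ∈ I, ofReal (ε / β) * P β (GS B S) ≤ ∑' D, P β (R S D) * P ε (O S D) +
      P β (GS B S) * ofReal ((ε * (B.card * Jn J)) ^ 2) := by
    intro S hS
    have hR : ∀ D, P β (R S D) = P β (GS B S) * P β {ω | Cl ω S 0 = D} := fun D =>
      hP.indep_set (S := (Ein (S : Set (V d)))ᶜ) (T := Ein (S : Set (V d))) disjoint_compl_left (measurableSet_GS _ _) (measurableSet_Cl _ _ _) (Dep_GS _ _)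
        ((Dep_Cl _ _ _).mono sdiff_subset)
    have hD : ∀ D : Finset (V d), P β {ω | Cl ω S 0 = D} * (ofReal ε * ∑ u ∈ D, ∑' v, kout J 1 S u v) ≤
        P β {ω | Cl ω S 0 = D} * (P ε (O S D) + ofReal ((ε * (B.card * Jn J)) ^ 2)) := by
      intro D
      by_cases hDS : D ⊆ S
      · refine mul_le_mul' le_rfl (open_lower_inf hJ hP hε (by exact_mod_cast hDS) ?_)
        have := hJ.Jn_nonneg
        gcongr
        exact hDS.trans (hI S hS).1
      · have : {ω : Config d | Cl ω S 0 = D} = ∅ := by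
          ext ω; simp only [mem_ofPred_eq, mem_empty_iff_false, iff_false]
          intro h; exact hDS (by exact_mod_cast h ▸ Cl_subset (ω := ω) (S := (S : Set (V d))) (x := 0))
        simp [this]
    have hphi' : ofReal (1 / β) ≤ ∑' D : Finset (V d), P β {ω | Cl ω S 0 = D} * ∑ u ∈ D, ∑' v, kout J 1 S u v := by
      have e1 : ∀ D : Finset (V d), P β {ω | Cl ω S 0 = D} * ∑ u ∈ D, ∑' v, kout J 1 S u v =
          ∑' u, (if u ∈ D then P β {ω | Cl ω S 0 = D} else 0) * ∑' v, kout J 1 S u v := by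
        intro D
        rw [tsum_eq_sum (s := D) (fun u hu => by simp [hu]), mul_sum]
        exact sum_congr rfl fun u hu => by simp [hu]
      have e2 : ∀ u, tp P β S 0 u = ∑' D : Finset (V d), (if u ∈ D then P β {ω | Cl ω S 0 = D} else 0) := by
        intro u
        have : ∀ D : Finset (V d), (if u ∈ D then P β {ω | Cl ω S 0 = D} else 0) =
            P β ({ω | Cl ω S 0 = D} ∩ {ω | connIn ω S 0 u}) := by
          intro D
          split_ifs with h
          · congr 1; ext ω
            simp only [mem_inter_iff, mem_ofPred_eq]
            refine ⟨fun hh => ⟨hh, ?_⟩, fun hh => hh.1⟩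
            rw [← mem_Cl, hh]; exact h
          · symm
            rw [← nonpos_iff_eq_zero, ← measure_empty (μ := P β)]
            refine measure_mono fun ω hω => h ?_
            have a : Cl ω S 0 = D := hω.1
            have b : u ∈ Cl ω S 0 := hω.2
            rw [a] at b; exact b
        simp only [this]
        rw [← measure_iUnion]
        · rw [tp]; congr 1; ext ω
          simp only [mem_iUnion, mem_inter_iff, mem_ofPred_eq]
          refine ⟨fun h => ⟨(S.finite_toSet.subset (Cl_subset (ω := ω) (x := 0))).toFinset, by simp, h⟩, fun ⟨D, _, h⟩ => h⟩
        · intro D D' hne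
          refine Set.disjoint_left.2 fun ω h h' => hne ?_
          have a1 : Cl ω S 0 = D := h.1
          have a2 : Cl ω S 0 = D' := h'.1
          exact_mod_cast a1.symm.trans a2
        · exact fun D => (measurableSet_Cl _ _ _).inter (measurableSet_connIn _ _ _)
      simp only [e1]
      rw [tsum_comm]
      simp only [ENNReal.tsum_mul_right, ← e2]
      have h1 := hphi S (hI S hS).2
      have h2 : phi J P β S = ofReal β * ∑' u, tp P β S 0 u * ∑' v, kout J 1 S u v := by
        rw [phi, ← ENNReal.tsum_mul_left]
        congr 1; ext u
        rw [ENNReal.tsum_mul_left, mul_left_comm]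
        congr 1
        rw [← ENNReal.tsum_mul_left]
        congr 1; ext v
        unfold kout
        split_ifs
        · simp
        · rw [one_mul, ← ofReal_mul hβ.le]
      rw [h2] at h1
      calc ofReal (1 / β) = ofReal (1 / β) * 1 := by simp
        _ ≤ ofReal (1 / β) * (ofReal β * _) := mul_le_mul' le_rfl h1
        _ = _ := by rw [← mul_assoc, ← ofReal_mul (by positivity), one_div_mul_cancel hβ.ne']; simp
    have hone : ∑' D : Finset (V d), P β {ω | Cl ω S 0 = D} = 1 := by
      have := sum_Cl_fun (P := P) (β := β) S.finite_toSet 0 (fun _ => 1)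
      simpa using this
    calc ofReal (ε / β) * P β (GS B S) = P β (GS B S) * (ofReal ε * ofReal (1 / β)) := by
          rw [← ofReal_mul hε, mul_one_div, mul_comm]
      _ ≤ P β (GS B S) * (ofReal ε * ∑' D : Finset (V d), P β {ω | Cl ω S 0 = D} * ∑ u ∈ D, ∑' v, kout J 1 S u v) := by
          gcongr
      _ = P β (GS B S) * ∑' D : Finset (V d), P β {ω | Cl ω S 0 = D} * (ofReal ε * ∑ u ∈ D, ∑' v, kout J 1 S u v) := by
          rw [← ENNReal.tsum_mul_left]; congr 2; ext D; ring
      _ ≤ P β (GS B S) * ∑' D : Finset (V d), P β {ω | Cl ω S 0 = D} * (P ε (O S D) + ofReal ((ε * (B.card * Jn J)) ^ 2)) :=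
          mul_le_mul' le_rfl (tsum_le_tsum hD)
      _ = _ := by
          simp only [mul_add, tsum_add, ENNReal.tsum_mul_right, hone, one_mul, hR]
          congr 1
          rw [← ENNReal.tsum_mul_left]; congr 1; ext D; ring
  calc P β (Esc B) + ofReal (ε / β) * P β (Esc B)ᶜ
      ≤ P β (Esc B) + ofReal (ε / β) * ∑ S ∈ I, P β (GS B S) := by gcongr
    _ = P β (Esc B) + ∑ S ∈ I, ofReal (ε / β) * P β (GS B S) := by rw [mul_sum]
    _ ≤ P β (Esc B) + ∑ S ∈ I, (∑' D, P β (R S D) * P ε (O S D) +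
      P β (GS B S) * ofReal ((ε * (B.card * Jn J)) ^ 2)) := by gcongr with S hSI; exact hS S hSI
    _ = (P β (Esc B) + ∑ S ∈ I, ∑' D, P β (R S D) * P ε (O S D)) + (∑ S ∈ I, P β (GS B S)) * ofReal ((ε * (B.card * Jn J)) ^ 2) := by
        rw [sum_add_distrib, ← sum_mul, add_assoc]
    _ ≤ P (β + ε) (Esc B) + 1 * ofReal ((ε * (B.card * Jn J)) ^ 2) := by gcongr
    _ = _ := by rw [one_mul]
theorem esc_lower (hJ : KernelHyp d J α c C) (hP : IsLRP J P) {bT b1 : ℝ} (hT : 0 < bT) (hb1 : bT < b1)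
    (hphi : ∀ β, bT ≤ β → ∀ S : Finset (V d), 0 ∈ S → 1 ≤ phi J P β S) (B : Finset (V d)) :
    ofReal (min (1 / 2) ((b1 - bT) / (2 * b1))) ≤ P b1 (Esc B) := by
  haveI := hP.prob
  set f : ℝ → ℝ := fun β => (P β (Esc B)).toReal with hf
  have hfo : ∀ β, P β (Esc B) = ofReal (f β) := fun β => (ofReal_toReal (measure_ne_top _ _)).symm
  have hf0 : ∀ β, 0 ≤ f β := fun β => toReal_nonneg
  have hf1 : ∀ β, f β ≤ 1 := fun β => by
    have := prob_le_one (μ := P β) (s := Esc B)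
    rw [hfo] at this; exact (ofReal_le_one).1 this
  have hmono : ∀ β β', 0 ≤ β → β ≤ β' → f β ≤ f β' := fun β β' h0 h =>
    toReal_mono (measure_ne_top _ _) (hP.mono hJ h0 h (Inc_Esc _) (measurableSet_Esc _))
  obtain ⟨Q, hQdef⟩ : ∃ Q : ℝ, Q = B.card * Jn J := ⟨_, rfl⟩
  have hstep : ∀ β ε, bT ≤ β → 0 ≤ ε → f β + ε / β * (1 - f β) ≤ f (β + ε) + (ε * Q) ^ 2 := by
    intro β ε hβ hε
    have hβ0 : 0 < β := hT.trans_le hβ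
    have := sprinkle hJ hP hβ0 hε B (hphi β hβ)
    have hεβ : 0 ≤ ε / β := div_nonneg hε hβ0.le
    try rw [← hQdef] at this
    rw [prob_compl_eq_one_sub (measurableSet_Esc _), hfo, hfo, ← ofReal_one, ← ofReal_sub _ (hf0 β),
      ← ofReal_mul hεβ, ← ofReal_add (hf0 _) (mul_nonneg hεβ (by linarith [hf1 β])),
      ← ofReal_add (hf0 _) (by positivity)] at this
    exact (ofReal_le_ofReal_iff (add_nonneg (hf0 _) (by positivity))).1 this
  rw [hfo]
  apply ofReal_le_ofReal
  by_cases hh : 1 / 2 ≤ f b1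
  · exact (min_le_left _ _).trans hh
  push Not at hh
  refine (min_le_right _ _).trans ?_
  set η := b1 - bT with hη
  have hη0 : 0 < η := by linarith
  have hb10 : 0 < b1 := by linarith
  have hm : ∀ m : ℕ, η / (2 * b1) ≤ f b1 + η ^ 2 * Q ^ 2 / (m + 1 : ℝ) := by
    intro m
    set ε := η / (m + 1 : ℝ) with hε
    have hε0 : 0 ≤ ε := by positivity
    have hind : ∀ k : ℕ, k ≤ m + 1 → k * (ε / (2 * b1)) ≤ f (bT + k * ε) + k * (ε * Q) ^ 2 := by
      intro k
      induction k with
      | zero => intro _; simpa using hf0 bT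
      | succ k ih =>
        intro hk
        have ih := ih (by omega)
        have hle : bT + k * ε ≤ b1 := by
          have : (k:ℝ) * ε ≤ η := by
            rw [hε, mul_div_assoc', div_le_iff₀ (by positivity)]
            have : (k:ℝ) ≤ m + 1 := by exact_mod_cast (by omega : k ≤ m + 1)
            nlinarith
          linarith
        have hpos : 0 < bT + k * ε := by positivity
        have h1 := hstep (bT + k * ε) ε (le_add_of_nonneg_right (by positivity)) hε0
        have h2 : f (bT + k * ε) ≤ 1 / 2 := (hmono _ _ hpos.le hle).trans hh.le
        have h3 : ε / (2 * b1) ≤ ε / (bT + k * ε) * (1 - f (bT + k * ε)) := by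
          calc ε / (2 * b1) = ε / b1 * (1 / 2) := by field_simp
            _ ≤ _ := by gcongr; linarith
        have e : bT + ((k + 1 : ℕ) : ℝ) * ε = bT + k * ε + ε := by push_cast; ring
        rw [e]; push_cast
        linarith
    have h := hind (m + 1) le_rfl
    have hm1 : ((m + 1 : ℕ) : ℝ) * ε = η := by rw [hε]; push_cast; field_simp
    have e1 : bT + ((m + 1 : ℕ) : ℝ) * ε = b1 := by rw [hm1]; ring
    have e2 : ((m + 1 : ℕ) : ℝ) * (ε / (2 * b1)) = η / (2 * b1) := by rw [← mul_div_assoc, hm1]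
    have e3 : ((m + 1 : ℕ) : ℝ) * (ε * Q) ^ 2 = η ^ 2 * Q ^ 2 / (m + 1 : ℝ) := by
      rw [hε]; push_cast; field_simp
    rwa [e1, e2, e3] at h
  have ht : Filter.Tendsto (fun m : ℕ => f b1 + η ^ 2 * Q ^ 2 / (m + 1 : ℝ)) atTop (nhds (f b1 + 0)) := by
    refine Filter.Tendsto.const_add _ ?_
    have := (tendsto_one_div_add_atTop_nhds_zero_nat (𝕜 := ℝ)).const_mul (η ^ 2 * Q ^ 2)
    simpa [div_eq_mul_inv] using this
  rw [add_zero] at ht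
  exact ge_of_tendsto' ht hm
theorem betaC_eq (hJ : KernelHyp d J α c C) (hP : IsLRP J P) {bT : ℝ} (hT : 0 < bT)
    (hlt : ∀ β, 0 ≤ β → β < bT → ch P β ≠ ⊤) (hgt : ∀ β, bT < β → ch P β = ⊤)
    (hphi : ∀ S : Finset (V d), 0 ∈ S → 1 ≤ phi J P bT S) : betaC P = bT := by
  haveI := hP.prob
  have hphi' : ∀ β, bT ≤ β → ∀ S : Finset (V d), 0 ∈ S → 1 ≤ phi J P β S := by
    intro β hβ S hS
    rcases hβ.eq_or_lt with rfl | h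
    · exact hphi S hS
    by_contra hc
    push Not at hc
    have := hP.ch_le_of_phi hJ (hT.le.trans hβ) S hS hc
    rw [hgt β h, top_le_iff] at this
    refine mul_ne_top (natCast_ne_top _) ?_ this
    exact inv_ne_top.2 (tsub_pos_of_lt hc).ne'
  have hno : ∀ β, 0 ≤ β → β < bT → P β {ω | ∃ x, (cluster ω x).Infinite} = 0 := by
    intro β h0 h
    have hx : ∀ x, P β {ω | (cluster ω x).Infinite} = 0 := by
      intro x
      have h1 : ∫⁻ ω, sz ω univ x ∂P β ≠ ⊤ := by
        rw [lintegral_sz]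
        simp only [hP.tp_univ_zero hJ h0 (x := x)]
        have := (Equiv.subRight x).tsum_eq (fun y => tp P β univ 0 y)
        simp only [Equiv.subRight_apply] at this
        rw [this]; exact hlt β h0 h
      have h2 := ae_lt_top (measurable_sz _ _) h1
      rw [← nonpos_iff_eq_zero, ← (ae_iff.1 h2)]
      refine measure_mono fun ω hω => ?_
      have hω : (cluster ω x).Infinite := hω
      simp [sz, Cl_univ, hω.encard_eq]; exact hω
    have : {ω : Config d | ∃ x, (cluster ω x).Infinite} = ⋃ x, {ω | (cluster ω x).Infinite} := by ext; simp
    rw [this]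
    exact measure_iUnion_null hx
  have hyes : ∀ β, bT < β → 0 < P β {ω | ∃ x, (cluster ω x).Infinite} := by
    intro β h
    have hβ0 : 0 < β := hT.trans h
    have hp : 0 < min (1 / 2) ((β - bT) / (2 * β)) := lt_min (by norm_num) (div_pos (by linarith) (by linarith))
    have hE : ∀ n, ofReal (min (1 / 2) ((β - bT) / (2 * β))) ≤ P β (Esc (Bx d n)) := fun n => esc_lower hJ hP hT h hphi' _
    have hanti : Antitone fun n : ℕ => Esc (Bx d n : Set (V d)) := fun m n hmn ω ⟨y, hy, hc⟩ => ⟨y, fun h => hy (Bx_mono hmn h), hc⟩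
    have h1 := tendsto_measure_iInter_atTop (μ := P β) (fun n => (measurableSet_Esc (Bx d n : Set (V d))).nullMeasurableSet) hanti ⟨0, measure_ne_top _ _⟩
    have h2 := ge_of_tendsto' h1 hE
    refine lt_of_lt_of_le (ofReal_pos.2 hp) (h2.trans (measure_mono ?_))
    intro ω hω
    refine ⟨0, fun hfin => ?_⟩
    have : ∃ n, cluster ω 0 ⊆ (Bx d n : Set (V d)) := by
      refine ⟨hfin.toFinset.sup normInf, fun y hy => ?_⟩
      rw [mem_coe, mem_Bx]
      exact le_sup (f := normInf) (hfin.mem_toFinset.2 hy)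
    obtain ⟨n, hn⟩ := this
    obtain ⟨y, hy, hc⟩ := Set.mem_iInter.1 hω n
    exact hy (hn (connIn_univ.1 hc))
  refine le_antisymm ?_ ?_
  · refine le_of_forall_gt_imp_ge_of_dense fun β hβ => ?_
    exact csInf_le ⟨0, fun _ h => h.1⟩ ⟨hT.le.trans hβ.le, hyes β hβ⟩
  · refine le_csInf ⟨bT + 1, by linarith, hyes _ (by linarith)⟩ fun β hβ => ?_
    by_contra hc
    push Not at hc
    have h2 := hβ.2
    rw [hno β hβ.1 hc] at h2
    exact lt_irrefl _ h2
end Sprinkle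
section Avg
variable {d : ℕ} {J : V d → V d → ℝ} {α c C : ℝ} {P : ℝ → Measure (Config d)} {β : ℝ}
variable {ω ω' : Config d} {S T : Set (V d)} {x y z : V d}
theorem avg_kout (hJ : KernelHyp d J α c C) (R : ℕ) (g : V d → ℝ≥0∞) :
    ∑ ρ ∈ Ico R (2 * R), ∑' u, ∑' v, tp P β (Bx d ρ) 0 u * kout J β (Bx d ρ) u v * g v ≤
      ∑' u, tp P β (Bx d (2 * R)) 0 u * ∑' w, ofReal (β * J 0 w) * (min R (normInf w) : ℕ) * g (u + w) := by
  rw [← Summable.tsum_finsetSum (fun _ _ => summable)]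
  refine tsum_le_tsum fun u => ?_
  rw [← Summable.tsum_finsetSum (fun _ _ => summable)]
  have e := (Equiv.subRight u).tsum_eq (fun w => ofReal (β * J 0 w) * (min R (normInf w) : ℕ) * g (u + w))
  simp only [Equiv.subRight_apply] at e
  rw [← e, ← ENNReal.tsum_mul_left]
  refine tsum_le_tsum fun v => ?_
  have h1 : ∀ ρ ∈ Ico R (2 * R), tp P β (Bx d ρ) 0 u * kout J β (Bx d ρ) u v * g v ≤
      if normInf u ≤ ρ ∧ ρ < normInf v then
        tp P β (Bx d (2 * R)) 0 u * ofReal (β * J 0 (v - u)) * g v else 0 := by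
    intro ρ hρ
    have hρ2 := (mem_Ico.1 hρ).2
    split_ifs with h
    · rw [← hJ.J_zero]
      exact mul_le_mul' (mul_le_mul' (tp_mono (by exact_mod_cast Bx_mono hρ2.le)) (kout_le _ _)) le_rfl
    · rw [not_and_or] at h
      rcases h with h | h
      · rw [tp_zero (by simpa [mem_Bx] using h)]; simp
      · rw [kout, if_pos (by simpa [mem_Bx] using h)]; simp
  refine (sum_le_sum h1).trans ?_
  rw [← Finset.sum_filter, sum_const, nsmul_eq_mul]
  have h2 : ((Ico R (2 * R)).filter (fun ρ => normInf u ≤ ρ ∧ ρ < normInf v)).card ≤ min R (normInf (v - u)) := by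
    refine le_min ((Finset.card_filter_le _ _).trans (by simp; omega)) ?_
    have : (Ico R (2 * R)).filter (fun ρ => normInf u ≤ ρ ∧ ρ < normInf v) ⊆ Ico (normInf u) (normInf v) := by
      intro a ha; simp only [mem_filter] at ha; exact mem_Ico.2 ha.2
    refine (Finset.card_le_card this).trans ?_
    rw [Nat.card_Ico]
    have := normInf_add_le (v - u) u
    rw [sub_add_cancel] at this; omega
  rw [add_sub_cancel]
  calc _ ≤ ((min R (normInf (v - u)) : ℕ) : ℝ≥0∞) * (tp P β (Bx d (2 * R)) 0 u * ofReal (β * J 0 (v - u)) * g v) :=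
        mul_le_mul' (by exact_mod_cast h2) le_rfl
    _ = _ := by ring
theorem near_sum (hJ : KernelHyp d J α c C) (hα1 : α < 1) :
    ∃ C1 : ℝ, 0 < C1 ∧ ∀ n : ℕ, ∑ w ∈ Bx d (2 ^ n), J 0 w * normInf w ≤ C1 * ((2:ℝ) ^ n) ^ (1 - α) := by
  have hC : 0 < C := hJ.c_pos.trans_le hJ.c_le_C
  set q : ℝ := (2:ℝ) ^ (1 - α) with hq
  have hq1 : 1 < q := Real.one_lt_rpow (by norm_num) (by linarith)
  have hq0 : 0 < q - 1 := by linarith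
  have hJw : ∀ w : V d, ∀ k : ℕ, 0 < k → k ≤ normInf w → J 0 w * normInf w ≤ C * (k : ℝ) ^ (-(d:ℝ) - α) * normInf w := by
    intro w k hk hkw
    refine mul_le_mul_of_nonneg_right ?_ (Nat.cast_nonneg _)
    have hne : (0 : V d) ≠ w := by
      rintro rfl
      have : normInf (0 : V d) = 0 := by simpa using (mem_Bx.1 (zero_mem_Bx (d := d) 0))
      omega
    refine (hJ.upper 0 w hne).trans (mul_le_mul_of_nonneg_left ?_ hC.le)
    rw [zero_sub, normInf_neg]
    exact Real.rpow_le_rpow_of_nonpos (by exact_mod_cast hk) (by exact_mod_cast hkw) (by have := hJ.alpha_pos; have : (0:ℝ) ≤ d := Nat.cast_nonneg _; linarith)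
  refine ⟨C * 3 ^ d + 2 * C * 5 ^ d / (q - 1), by positivity, fun n => ?_⟩
  induction n with
  | zero =>
    simp only [pow_zero, Real.one_rpow, mul_one]
    calc ∑ w ∈ Bx d 1, J 0 w * normInf w ≤ ∑ w ∈ Bx d 1, C := by
          refine sum_le_sum fun w hw => ?_
          rw [mem_Bx] at hw
          rcases Nat.eq_zero_or_pos (normInf w) with h | h
          · rw [h]; simp [hC.le]
          · have e : normInf w = 1 := by omega
            have := hJw w 1 one_pos h
            rw [e] at this ⊢; simpa using this
      _ = C * 3 ^ d := by rw [sum_const, card_Bx]; norm_num; ring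
      _ ≤ _ := le_add_of_nonneg_right (by positivity)
  | succ n ih =>
    set X : ℝ := ((2:ℝ) ^ n) ^ (1 - α)
    have hX : ((2:ℝ) ^ (n + 1)) ^ (1 - α) = X * q := by
      rw [pow_succ, Real.mul_rpow (by positivity) (by norm_num)]
    have hX0 : 0 < X := by positivity
    have h1 : ∑ w ∈ Bx d (2 ^ (n+1)) \ Bx d (2 ^ n), J 0 w * normInf w ≤ 2 * C * 5 ^ d * X := by
      calc _ ≤ ∑ w ∈ Bx d (2 ^ (n+1)) \ Bx d (2 ^ n), C * ((2:ℝ)^n) ^ (-(d:ℝ) - α) * 2 ^ (n+1) := by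
            refine sum_le_sum fun w hw => ?_
            rw [Finset.mem_sdiff, mem_Bx, mem_Bx] at hw
            have := hJw w (2 ^ n) (by positivity) (by omega)
            push_cast at this
            refine this.trans (mul_le_mul_of_nonneg_left ?_ (by positivity))
            exact_mod_cast hw.1
        _ ≤ (5 * (2:ℝ)^n) ^ d * (C * ((2:ℝ)^n) ^ (-(d:ℝ) - α) * 2 ^ (n+1)) := by
            rw [sum_const, nsmul_eq_mul]
            refine mul_le_mul_of_nonneg_right ?_ (by positivity)
            have : (Bx d (2 ^ (n+1)) \ Bx d (2 ^ n)).card ≤ (5 * 2 ^ n) ^ d := by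
              refine (Finset.card_le_card Finset.sdiff_subset).trans ?_
              rw [card_Bx]; refine Nat.pow_le_pow_left ?_ _
              have : 1 ≤ 2 ^ n := Nat.one_le_two_pow
              rw [pow_succ]; omega
            exact_mod_cast this
        _ = _ := by
            have : X = ((2:ℝ)^n) ^ (d:ℝ) * ((2:ℝ)^n) ^ (-(d:ℝ) - α) * (2:ℝ) ^ n := by
              rw [← Real.rpow_add (by positivity), ← Real.rpow_add_one (by positivity), show (d:ℝ) + (-(d:ℝ) - α) + 1 = 1 - α by ring]
            rw [this, Real.rpow_natCast, mul_pow]; ring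
    rw [← Finset.sum_sdiff (Bx_mono (d := d) (Nat.pow_le_pow_right (n := 2) (by norm_num) (Nat.le_succ n))), hX]
    have h2 : 2 * C * 5 ^ d / (q - 1) * (q - 1) = 2 * C * 5 ^ d := by field_simp
    have h3 : 0 ≤ C * 3 ^ d * (q - 1) * X := by positivity
    have h4 : 2 * C * 5 ^ d / (q - 1) * (q - 1) * X = 2 * C * 5 ^ d * X := by rw [h2]
    nlinarith
theorem kern_bound (hJ : KernelHyp d J α c C) {C1 : ℝ} (hβ : 0 ≤ β)
    {n : ℕ} (h1 : ∑ w ∈ Bx d (2 ^ n), J 0 w * normInf w ≤ C1 * ((2:ℝ) ^ n) ^ (1 - α))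
    (R : ℕ) (h : V d → ℝ≥0∞) {M : ℝ≥0∞} (hM : ∀ w ∈ Bx d (2 ^ n), h w ≤ M) :
    ∑' w, ofReal (β * J 0 w) * (min R (normInf w) : ℕ) * h w ≤
      ofReal (β * (C1 * ((2:ℝ) ^ n) ^ (1 - α))) * M +
        R * ∑' i : ℕ, ofReal (β * (C * ((2:ℝ) ^ (n + i)) ^ (-(d:ℝ) - α))) * ∑ w ∈ Bx d (2 ^ (n + i + 1)), h w := by
  have hp : ∀ w, ofReal (β * J 0 w) * (min R (normInf w) : ℕ) * h w ≤
      (if w ∈ Bx d (2 ^ n) then ofReal (β * (J 0 w * normInf w)) * M else 0) +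
      R * ∑' i : ℕ, ofReal (β * (C * ((2:ℝ) ^ (n + i)) ^ (-(d:ℝ) - α))) *
        (if w ∈ Bx d (2 ^ (n + i + 1)) then h w else 0) := by
    intro w
    by_cases hw : w ∈ Bx d (2 ^ n)
    · rw [if_pos hw]
      refine le_add_right (mul_le_mul' ?_ (hM w hw))
      rw [← mul_assoc, ofReal_mul (mul_nonneg hβ (hJ.nonneg _ _)), ofReal_natCast]
      exact mul_le_mul' le_rfl (by exact_mod_cast min_le_right _ _)
    · rw [if_neg hw, zero_add]
      rw [mem_Bx, not_le] at hw
      set k := Nat.log 2 (normInf w)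
      have hne : normInf w ≠ 0 := (Nat.pos_of_ne_zero (by rintro h; rw [h] at hw; exact absurd hw (by simp))).ne'
      have hk1 : 2 ^ k ≤ normInf w := Nat.pow_log_le_self 2 hne
      have hk2 : normInf w < 2 ^ (k + 1) := Nat.lt_pow_succ_log_self (by norm_num) _
      have hnk : n ≤ k := by
        by_contra hc
        have := Nat.pow_le_pow_right (n := 2) (by norm_num) (show k + 1 ≤ n by omega)
        omega
      refine le_trans ?_ (mul_le_mul' le_rfl (le_tsum (k - n)))
      rw [show n + (k - n) = k by omega, if_pos (by rw [mem_Bx]; exact hk2.le)]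
      rw [mul_comm (ofReal _) _, mul_assoc]
      refine mul_le_mul' (by exact_mod_cast min_le_left _ _) (mul_le_mul' (ofReal_le_ofReal ?_) le_rfl)
      refine mul_le_mul_of_nonneg_left ?_ hβ
      refine (hJ.upper 0 w (by rintro rfl; simp [normInf] at hne)).trans ?_
      refine mul_le_mul_of_nonneg_left ?_ (hJ.c_pos.le.trans hJ.c_le_C)
      rw [zero_sub, normInf_neg]
      exact Real.rpow_le_rpow_of_nonpos (by positivity) (by exact_mod_cast hk1) (by have := hJ.alpha_pos; have : (0:ℝ) ≤ d := Nat.cast_nonneg _; linarith)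
  refine (tsum_le_tsum hp).trans ?_
  rw [tsum_add, ENNReal.tsum_mul_left, tsum_comm]
  refine add_le_add ?_ (mul_le_mul' le_rfl (tsum_le_tsum fun i => ?_))
  · rw [tsum_eq_sum (s := Bx d (2 ^ n)) (by intro b hb; rw [if_neg hb]),
      sum_congr rfl (fun w hw => if_pos hw), ← sum_mul,
      ← ofReal_sum_of_nonneg (fun w _ => mul_nonneg hβ (mul_nonneg (hJ.nonneg _ _) (Nat.cast_nonneg _))), ← mul_sum]
    exact mul_le_mul' (ofReal_le_ofReal (mul_le_mul_of_nonneg_left h1 hβ)) le_rfl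
  · rw [ENNReal.tsum_mul_left, tsum_eq_sum (s := Bx d (2 ^ (n + i + 1))) (by intro b hb; rw [if_neg hb]),
      sum_congr rfl (fun w hw => if_pos hw)]
def GA (P : ℝ → Measure (Config d)) (β α A : ℝ) : Prop :=
  ∀ (k : ℕ) (z : V d), ∑ x ∈ Bx d (2 ^ k), tp P β univ z x ≤ ofReal (A * ((2:ℝ) ^ k) ^ α)
theorem GA.sum_le (hJ : KernelHyp d J α c C) (hP : IsLRP J P) (hβ : 0 ≤ β) {A : ℝ} (hA : GA P β α A)
    (k : ℕ) (B : Finset (V d)) (u : V d) :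
    ∑ w ∈ Bx d (2 ^ k), ∑ x ∈ B, tp P β univ (u + w) x ≤ B.card * ofReal (A * ((2:ℝ) ^ k) ^ α) := by
  rw [Finset.sum_comm, ← nsmul_eq_mul]
  refine Finset.sum_le_card_nsmul _ _ _ fun x _ => ?_
  refine le_of_eq_of_le (sum_congr rfl fun w _ => ?_) (hA k (x - u))
  rw [tp_comm, hP.tp_univ_zero hJ hβ, hP.tp_univ_zero hJ hβ (x := x - u)]
  congr 1; abel
theorem lemN (hJ : KernelHyp d J α c C) (hP : IsLRP J P) (hα1 : α < 1) {bT A0 : ℝ} (hT : 0 < bT) (hA0 : 0 < A0)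
    (hX : ∀ r : ℕ, 1 ≤ r → Xr P bT r ≤ ofReal (A0 * (r : ℝ) ^ α)) :
    ∃ D : ℝ, 0 < D ∧ ∀ β, 0 ≤ β → β ≤ bT → ∀ (n l : ℕ) (B : Finset (V d)) (z : V d) (M : ℝ≥0∞) (A : ℝ), 0 ≤ A → GA P β α A →
      (∀ v, normInf v ≤ 3 * 2 ^ (n + l) → ∑ x ∈ B, tp P β univ (z + v) x ≤ M) →
      ∑ x ∈ B, tp P β univ z x ≤ ∑ x ∈ B, tp P β (Bx d (2 * 2 ^ (n + l))) 0 (x - z) +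
        ofReal (D * ((2:ℝ) ^ l) ^ (-(1 - α))) * M +
        B.card * ofReal (D * A * ((2:ℝ) ^ (n + l)) ^ α * ((2:ℝ) ^ n) ^ (-(d:ℝ))) := by
  obtain ⟨C1, hC1, hnear⟩ := near_sum hJ hα1
  have hC : 0 < C := hJ.c_pos.trans_le hJ.c_le_C
  have hα0 := hJ.alpha_pos
  refine ⟨A0 * 2 ^ α * bT * C1 + A0 * 2 ^ α * bT * C * 2 ^ α * 2, by positivity, ?_⟩
  intro β hβ hβT n l B z M A hA hGA hM
  set R : ℕ := 2 ^ (n + l) with hR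
  have hR0 : 0 < R := by positivity
  have hRr : (R : ℝ) = (2:ℝ) ^ n * 2 ^ l := by rw [hR]; push_cast; rw [pow_add]
  set g : V d → ℝ≥0∞ := fun z => ∑ x ∈ B, tp P β univ z x with hg
  have hmass : ∑' u, tp P β (Bx d (2 * R)) 0 u ≤ ofReal (A0 * 2 ^ α * (R : ℝ) ^ α) := by
    rw [← lintegral_sz]
    refine (le_Xr (zero_mem_Bx _)).trans ((Xr_mono hJ hP hβ hβT _).trans ((hX _ (by omega)).trans (ofReal_le_ofReal ?_)))
    push_cast
    rw [Real.mul_rpow (by norm_num) (by positivity), mul_assoc]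
  set E1 : ℝ≥0∞ := ofReal (bT * (C1 * ((2:ℝ) ^ n) ^ (1 - α))) * M with hE1
  set E2 : ℝ≥0∞ := B.card * ofReal (bT * C * A * 2 ^ α * 2 * ((2:ℝ) ^ n) ^ (-(d:ℝ))) with hE2
  have hin : ∀ u ∈ Bx d (2 * R), ∑' w, ofReal (β * J 0 w) * (min R (normInf w) : ℕ) * g (z + (u + w)) ≤ E1 + R * E2 := by
    intro u hu
    rw [mem_Bx] at hu
    refine (kern_bound hJ hβ (hnear n) R (fun w => g (z + (u + w))) (M := M) ?_).trans ?_
    · intro w hw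
      rw [mem_Bx] at hw
      refine hM _ ((normInf_add_le _ _).trans ?_)
      have : 2 ^ n ≤ R := Nat.pow_le_pow_right (by norm_num) (by omega)
      omega
    · refine add_le_add (mul_le_mul' (ofReal_le_ofReal (mul_le_mul_of_nonneg_right hβT (by positivity))) le_rfl) (mul_le_mul' le_rfl ?_)
      calc _ ≤ ∑' i : ℕ, B.card * ofReal (bT * C * A * 2 ^ α * ((2:ℝ) ^ n) ^ (-(d:ℝ)) * (1/2) ^ i) := by
            refine tsum_le_tsum fun i => ?_
            have h2 := GA.sum_le hJ hP hβ hGA (n + i + 1) B (z + u)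
            simp only [add_assoc z u] at h2
            refine (mul_le_mul' le_rfl h2).trans ?_
            rw [mul_left_comm, ← ofReal_mul (by positivity)]
            refine mul_le_mul' le_rfl (ofReal_le_ofReal ?_)
            have e1 : ((2:ℝ) ^ (n + i + 1)) ^ α = ((2:ℝ) ^ (n+i)) ^ α * 2 ^ α := by
              rw [pow_succ, Real.mul_rpow (by positivity) (by norm_num)]
            have e2 : ((2:ℝ) ^ (n + i)) ^ (-(d:ℝ) - α) * ((2:ℝ) ^ (n+i)) ^ α = ((2:ℝ)^n) ^ (-(d:ℝ)) * ((2:ℝ)^i) ^ (-(d:ℝ)) := by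
              rw [← Real.rpow_add (by positivity), ← Real.mul_rpow (by positivity) (by positivity), ← pow_add]; congr 1; ring
            have e3 : ((2:ℝ)^i) ^ (-(d:ℝ)) ≤ (1/2) ^ i := by
              rw [one_div, inv_pow, ← Real.rpow_neg_one]
              refine Real.rpow_le_rpow_of_exponent_le (one_le_pow₀ (by norm_num)) ?_
              have : (1:ℝ) ≤ d := by exact_mod_cast hJ.d_pos
              linarith
            calc _ = β * (C * A * 2 ^ α * (((2:ℝ) ^ (n + i)) ^ (-(d:ℝ) - α) * ((2:ℝ) ^ (n+i)) ^ α)) := by rw [e1]; ring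
              _ ≤ bT * (C * A * 2 ^ α * (((2:ℝ)^n) ^ (-(d:ℝ)) * (1/2) ^ i)) := by
                rw [e2]
                refine mul_le_mul hβT ?_ (by positivity) hT.le
                exact mul_le_mul_of_nonneg_left (mul_le_mul_of_nonneg_left e3 (by positivity)) (by positivity)
              _ = _ := by ring
        _ = E2 := by
            rw [ENNReal.tsum_mul_left, ← ofReal_tsum_of_nonneg (fun i => by positivity)
              ((summable_geometric_of_lt_one (by norm_num) (by norm_num)).mul_left _), tsum_mul_left, tsum_geometric_two]
            rw [hE2]; congr 2; ring
  have havg : (R : ℝ≥0∞) * g z ≤ R * ∑ x ∈ B, tp P β (Bx d (2 * R)) 0 (x - z) +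
      ofReal (A0 * 2 ^ α * (R : ℝ) ^ α) * (E1 + R * E2) := by
    calc (R : ℝ≥0∞) * g z = ∑ ρ ∈ Ico R (2 * R), g z := by
          rw [sum_const, Nat.card_Ico, nsmul_eq_mul]; congr 2; omega
      _ ≤ ∑ ρ ∈ Ico R (2 * R), (∑ x ∈ B, tp P β (Bx d (2 * R)) 0 (x - z) +
            ∑' u, ∑' v, tp P β (Bx d ρ) 0 u * kout J β (Bx d ρ) u v * g (z + v)) := by
          refine sum_le_sum fun ρ hρ => (hP.simon_sum hJ hβ (Finset.finite_toSet (Bx d ρ)) (by exact_mod_cast zero_mem_Bx ρ) B z).trans ?_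
          refine add_le_add (sum_le_sum fun x _ => tp_mono ?_) le_rfl
          exact_mod_cast Bx_mono (mem_Ico.1 hρ).2.le
      _ ≤ _ := by
          rw [sum_add_distrib, sum_const, Nat.card_Ico, nsmul_eq_mul]
          refine add_le_add (mul_le_mul' (by exact_mod_cast (by omega)) le_rfl) ?_
          refine (avg_kout hJ R (fun v => g (z + v))).trans ?_
          calc _ ≤ ∑' u, tp P β (Bx d (2 * R)) 0 u * (E1 + R * E2) := by
                refine tsum_le_tsum fun u => ?_
                by_cases hu : u ∈ Bx d (2 * R)
                · exact mul_le_mul' le_rfl (hin u hu)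
                · rw [tp_zero (by exact_mod_cast hu)]; simp
            _ ≤ _ := by rw [ENNReal.tsum_mul_right]; exact mul_le_mul' hmass le_rfl
  have hRne : (R : ℝ≥0∞) ≠ 0 := by exact_mod_cast hR0.ne'
  have hRt : (R : ℝ≥0∞) ≠ ⊤ := natCast_ne_top R
  rw [← ENNReal.mul_le_mul_iff_right hRne hRt]
  refine havg.trans ?_
  rw [mul_add, mul_add, mul_add, ← add_assoc]
  have hRpos : (0:ℝ) < R := by exact_mod_cast hR0
  have hRE : (R : ℝ≥0∞) = ofReal R := (ofReal_natCast R).symm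
  refine add_le_add (add_le_add le_rfl ?_) ?_
  · rw [hE1, ← mul_assoc, ← ofReal_mul (by positivity), hRE, ← mul_assoc (ofReal (R:ℝ)), ← ofReal_mul (by positivity)]
    refine mul_le_mul' (ofReal_le_ofReal ?_) le_rfl
    have : (R:ℝ) ^ α * ((2:ℝ) ^ n) ^ (1 - α) = R * ((2:ℝ) ^ l) ^ (-(1 - α)) := by
      rw [hRr, Real.mul_rpow (by positivity) (by positivity)]
      have a1 : ((2:ℝ)^n) ^ α * ((2:ℝ)^n) ^ (1 - α) = (2:ℝ)^n := by
        rw [← Real.rpow_add (by positivity)]; simp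
      have a2 : ((2:ℝ)^l) ^ α = (2:ℝ) ^ l * ((2:ℝ) ^ l) ^ (-(1 - α)) := by
        rw [mul_comm, ← Real.rpow_add_one (by positivity)]; congr 1; ring
      calc _ = (((2:ℝ)^n) ^ α * ((2:ℝ)^n) ^ (1 - α)) * ((2:ℝ)^l) ^ α := by ring
        _ = _ := by rw [a1, a2]; ring
    calc _ = A0 * 2 ^ α * bT * C1 * ((R:ℝ) ^ α * ((2:ℝ) ^ n) ^ (1 - α)) := by ring
      _ = A0 * 2 ^ α * bT * C1 * (R * ((2:ℝ) ^ l) ^ (-(1 - α))) := by rw [this]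
      _ ≤ (A0 * 2 ^ α * bT * C1 + A0 * 2 ^ α * bT * C * 2 ^ α * 2) * (R * ((2:ℝ) ^ l) ^ (-(1 - α))) :=
          mul_le_mul_of_nonneg_right (le_add_of_nonneg_right (by positivity)) (by positivity)
      _ = _ := by ring
  · rw [hE2, mul_left_comm, mul_left_comm (ofReal _), ← ofReal_mul (by positivity)]
    refine mul_le_mul' le_rfl (mul_le_mul' le_rfl (ofReal_le_ofReal ?_))
    rw [show ((2:ℝ) ^ (n + l)) = R by rw [hRr, pow_add]]
    calc _ = A0 * 2 ^ α * bT * C * 2 ^ α * 2 * (A * (R:ℝ) ^ α * ((2:ℝ) ^ n) ^ (-(d:ℝ))) := by ring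
      _ ≤ (A0 * 2 ^ α * bT * C1 + A0 * 2 ^ α * bT * C * 2 ^ α * 2) * (A * (R:ℝ) ^ α * ((2:ℝ) ^ n) ^ (-(d:ℝ))) :=
          mul_le_mul_of_nonneg_right (le_add_of_nonneg_left (by positivity)) (by positivity)
      _ = _ := by ring
end Avg
section Unr
variable {d : ℕ} {J : V d → V d → ℝ} {α c C : ℝ} {P : ℝ → Measure (Config d)} {β : ℝ}
variable {ω ω' : Config d} {S T : Set (V d)} {x y z : V d}
theorem exists_small {e ε : ℝ} (he : 0 < e) (hε : 0 < ε) : ∃ l : ℕ, ((2:ℝ) ^ l) ^ (-e) ≤ ε := by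
  obtain ⟨l, hl⟩ := exists_pow_lt_of_lt_one hε (Real.rpow_lt_one_of_one_lt_of_neg (by norm_num : (1:ℝ) < 2) (neg_lt_zero.2 he))
  refine ⟨l, ?_⟩
  rw [← Real.rpow_natCast, ← Real.rpow_mul (by norm_num), mul_comm, Real.rpow_mul (by norm_num), Real.rpow_natCast]
  exact hl.le
theorem exists_GA (hJ : KernelHyp d J α c C) (hP : IsLRP J P) (hα1 : α < 1) {bT A0 : ℝ} (hT : 0 < bT) (hA0 : 0 < A0)
    (hlt : ∀ β, 0 ≤ β → β < bT → ch P β ≠ ⊤)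
    (hX : ∀ r : ℕ, 1 ≤ r → Xr P bT r ≤ ofReal (A0 * (r : ℝ) ^ α)) :
    ∃ A : ℝ, 0 < A ∧ GA P bT α A := by
  obtain ⟨D, hD, hN⟩ := lemN hJ hP hα1 hT hA0 hX
  have hα0 := hJ.alpha_pos
  have hαd := hJ.alpha_lt_d
  obtain ⟨l, hl⟩ := exists_small (e := 1 - α) (ε := 1 / (4 * D)) (by linarith) (by positivity)
  set K : ℝ := 3 ^ d * D * ((2:ℝ) ^ l) ^ α with hK
  have hK0 : 0 < K := by positivity
  obtain ⟨M, hM⟩ := exists_small (e := d - α) (ε := 1 / (4 * K)) (by linarith) (by positivity)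
  set A1 : ℝ := A0 * (2 * (2:ℝ) ^ (M + l)) ^ α with hA1
  have hA10 : 0 < A1 := by positivity
  have step : ∀ β, 0 ≤ β → β < bT → ∀ A, 0 ≤ A → GA P β α A → GA P β α (A1 + A / 2) := by
    intro β hβ hβT A hA hGA k z
    have h := hN β hβ hβT.le (k + M) l (Bx d (2 ^ k)) z (ofReal (A * ((2:ℝ) ^ k) ^ α)) A hA hGA (fun v _ => hGA k (z + v))
    refine h.trans ?_
    have e0 : 0 ≤ ((2:ℝ) ^ k) ^ α := by positivity
    have t1 : ∑ x ∈ Bx d (2 ^ k), tp P β (Bx d (2 * 2 ^ (k + M + l))) 0 (x - z) ≤ ofReal (A1 * ((2:ℝ) ^ k) ^ α) := by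
      refine (sum_le_tsum _).trans ?_
      have e := (Equiv.subRight z).tsum_eq (fun v => tp P β (Bx d (2 * 2 ^ (k + M + l))) 0 v)
      simp only [Equiv.subRight_apply] at e
      rw [e, ← lintegral_sz]
      have hp : 0 < 2 ^ (k + M + l) := by positivity
      refine (le_Xr (zero_mem_Bx _)).trans ((Xr_mono hJ hP hβ hβT.le _).trans ((hX _ (by omega)).trans (ofReal_le_ofReal (le_of_eq ?_))))
      rw [hA1, mul_assoc, ← Real.mul_rpow (by positivity) (by positivity)]
      push_cast; congr 2; ring
    have t2 : ofReal (D * ((2:ℝ) ^ l) ^ (-(1 - α))) * ofReal (A * ((2:ℝ) ^ k) ^ α) ≤ ofReal (A / 4 * ((2:ℝ) ^ k) ^ α) := by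
      rw [← ofReal_mul (by positivity)]
      refine ofReal_le_ofReal ?_
      have : D * ((2:ℝ) ^ l) ^ (-(1 - α)) ≤ 1 / 4 := by
        refine (mul_le_mul_of_nonneg_left hl hD.le).trans (le_of_eq ?_)
        field_simp
      refine (mul_le_mul_of_nonneg_right this (by positivity)).trans (le_of_eq ?_)
      ring
    have t3 : (Bx d (2 ^ k)).card * ofReal (D * A * ((2:ℝ) ^ (k + M + l)) ^ α * ((2:ℝ) ^ (k + M)) ^ (-(d:ℝ))) ≤
        ofReal (A / 4 * ((2:ℝ) ^ k) ^ α) := by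
      rw [← ofReal_natCast, ← ofReal_mul (by positivity)]
      refine ofReal_le_ofReal ?_
      have c1 : ((Bx d (2 ^ k)).card : ℝ) ≤ 3 ^ d * ((2:ℝ) ^ k) ^ (d:ℝ) := by
        rw [card_Bx, Real.rpow_natCast, ← mul_pow]; push_cast
        have : (1:ℝ) ≤ 2 ^ k := one_le_pow₀ (by norm_num)
        exact pow_le_pow_left₀ (by positivity) (by linarith) _
      have c2 : ((2:ℝ) ^ (k + M + l)) ^ α = ((2:ℝ) ^ k) ^ α * ((2:ℝ) ^ M) ^ α * ((2:ℝ) ^ l) ^ α := by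
        rw [pow_add, pow_add, Real.mul_rpow (by positivity) (by positivity), Real.mul_rpow (by positivity) (by positivity)]
      have c3 : ((2:ℝ) ^ (k + M)) ^ (-(d:ℝ)) = ((2:ℝ) ^ k) ^ (-(d:ℝ)) * ((2:ℝ) ^ M) ^ (-(d:ℝ)) := by
        rw [pow_add, Real.mul_rpow (by positivity) (by positivity)]
      have c4 : ((2:ℝ) ^ k) ^ (d:ℝ) * ((2:ℝ) ^ k) ^ (-(d:ℝ)) = 1 := by
        rw [← Real.rpow_add (by positivity)]; simp
      have c5 : ((2:ℝ) ^ M) ^ α * ((2:ℝ) ^ M) ^ (-(d:ℝ)) = ((2:ℝ) ^ M) ^ (-(d - α)) := by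
        rw [← Real.rpow_add (by positivity)]; congr 1; ring
      calc _ ≤ 3 ^ d * ((2:ℝ) ^ k) ^ (d:ℝ) * (D * A * ((2:ℝ) ^ (k + M + l)) ^ α * ((2:ℝ) ^ (k + M)) ^ (-(d:ℝ))) :=
            mul_le_mul_of_nonneg_right c1 (by positivity)
        _ = K * (((2:ℝ) ^ M) ^ α * ((2:ℝ) ^ M) ^ (-(d:ℝ))) * (A * ((2:ℝ) ^ k) ^ α) * (((2:ℝ) ^ k) ^ (d:ℝ) * ((2:ℝ) ^ k) ^ (-(d:ℝ))) := by
            rw [c2, c3, hK]; ring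
        _ ≤ K * (1 / (4 * K)) * (A * ((2:ℝ) ^ k) ^ α) * 1 := by
            rw [c4, c5]
            refine mul_le_mul_of_nonneg_right (mul_le_mul_of_nonneg_right (mul_le_mul_of_nonneg_left hM hK0.le) (by positivity)) zero_le_one
        _ = _ := by field_simp
    refine (add_le_add (add_le_add t1 t2) t3).trans (le_of_eq ?_)
    rw [← ofReal_add (by positivity) (by positivity), ← ofReal_add (by positivity) (by positivity)]
    congr 1; ring
  have hall : ∀ β, 0 ≤ β → β < bT → GA P β α (2 * A1) := by
    intro β hβ hβT
    set X := ch P β with hXd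
    have h0 : GA P β α X.toReal := by
      intro k z
      calc _ ≤ X := by
            refine (sum_le_tsum _).trans ?_
            simp only [hP.tp_univ_zero hJ hβ (x := z)]
            have e := (Equiv.subRight z).tsum_eq (fun v => tp P β univ 0 v)
            simp only [Equiv.subRight_apply] at e
            rw [e]; exact le_rfl
        _ = ofReal (X.toReal * 1) := by rw [mul_one, ofReal_toReal (hlt β hβ hβT)]
        _ ≤ _ := ofReal_le_ofReal (mul_le_mul_of_nonneg_left (Real.one_le_rpow (one_le_pow₀ (by norm_num)) hα0.le) toReal_nonneg)
    have hi : ∀ i : ℕ, GA P β α (2 * A1 + X.toReal * (1/2) ^ i) := by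
      intro i
      induction i with
      | zero =>
        intro k z
        refine (h0 k z).trans (ofReal_le_ofReal (mul_le_mul_of_nonneg_right ?_ (by positivity)))
        rw [pow_zero, mul_one]; linarith
      | succ i ih =>
        have := step β hβ hβT _ (by positivity) ih
        convert this using 1; rw [pow_succ]; ring
    intro k z
    refine ge_of_tendsto' (x := atTop) (f := fun i : ℕ => ofReal ((2 * A1 + X.toReal * (1/2) ^ i) * ((2:ℝ) ^ k) ^ α)) ?_ (fun i => hi i k z)
    refine tendsto_ofReal (Filter.Tendsto.mul_const _ ?_)
    have := ((tendsto_pow_atTop_nhds_zero_of_lt_one (by norm_num : (0:ℝ) ≤ 1/2) (by norm_num)).const_mul X.toReal).const_add (2 * A1)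
    simpa using this
  refine ⟨2 * A1, by positivity, fun k z => ?_⟩
  exact hP.left_lim hJ (Bx d (2 ^ k)) (fun x => {ω | connIn ω univ z x}) (fun x => Appr_connIn z x) hT (fun β h0 h => hall β h0 h k z)
theorem pointwise (hJ : KernelHyp d J α c C) (hP : IsLRP J P) (hα1 : α < 1) {bT A0 A : ℝ} (hT : 0 < bT) (hA0 : 0 < A0)
    (hX : ∀ r : ℕ, 1 ≤ r → Xr P bT r ≤ ofReal (A0 * (r : ℝ) ^ α)) (hA : 0 < A) (hGA : GA P bT α A) :
    ∃ B : ℝ, 0 < B ∧ ∀ (k : ℕ) (x : V d), 2 ^ k ≤ normInf x → tp P bT univ 0 x ≤ ofReal (B * ((2:ℝ) ^ k) ^ (α - d)) := by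
  obtain ⟨D, hD, hN⟩ := lemN hJ hP hα1 hT hA0 hX
  have hα0 := hJ.alpha_pos
  have hαd := hJ.alpha_lt_d
  obtain ⟨l, hl⟩ := exists_small (e := 1 - α) (ε := 1 / (2 * D * 2 ^ d)) (by linarith) (by positivity)
  set D3 : ℝ := D * A * ((2:ℝ) ^ (l + 2)) ^ (d : ℝ) with hD3
  have hD30 : 0 < D3 := by positivity
  have hq : (1:ℝ) / 2 ^ d ≤ 2 ^ (α - d) := by
    rw [one_div, ← Real.rpow_natCast, ← Real.rpow_neg (by norm_num)]
    exact Real.rpow_le_rpow_of_exponent_le (by norm_num) (by linarith)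
  set B : ℝ := 2 * 2 ^ d * D3 + ((2:ℝ) ^ (l + 2)) ^ (d - α) with hB
  have hB0 : 0 < B := by positivity
  refine ⟨B, hB0, fun k => ?_⟩
  have base : ∀ k, k ≤ l + 2 → ∀ x : V d, 2 ^ k ≤ normInf x → tp P bT univ 0 x ≤ ofReal (B * ((2:ℝ) ^ k) ^ (α - d)) := by
    intro k hk x _
    refine hP.tp_le_one.trans (one_le_ofReal.2 ?_)
    have h1 : ((2:ℝ) ^ k) ^ (d - α) ≤ B := by
      refine (Real.rpow_le_rpow (by positivity) (pow_le_pow_right₀ (by norm_num) hk) (by linarith)).trans ?_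
      exact le_add_of_nonneg_left (by positivity)
    calc (1:ℝ) = ((2:ℝ) ^ k) ^ (d - α) * ((2:ℝ) ^ k) ^ (α - d) := by rw [← Real.rpow_add (by positivity)]; simp
      _ ≤ _ := mul_le_mul_of_nonneg_right h1 (by positivity)
  induction k with
  | zero => exact base 0 (by omega)
  | succ k ih =>
    intro x hx
    by_cases hk : k + 1 ≤ l + 2
    · exact base _ hk x hx
    obtain ⟨n, rfl⟩ : ∃ n, k = n + l + 2 := ⟨k - l - 2, by omega⟩
    have hx' : 8 * 2 ^ (n + l) ≤ normInf x := by
      rw [show n + l + 2 + 1 = n + l + 3 by ring, pow_add] at hx; omega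
    have hp : 0 < 2 ^ (n + l) := by positivity
    have h := hN bT hT.le le_rfl n l {x} 0 (ofReal (B * ((2:ℝ) ^ (n + l + 2)) ^ (α - d))) A hA.le hGA (by
      intro v hv
      rw [Finset.sum_singleton, zero_add, hP.tp_univ_zero hJ hT.le]
      refine ih _ ?_
      have := normInf_add_le (x - v) v
      rw [sub_add_cancel] at this
      rw [pow_add]; omega)
    simp only [Finset.sum_singleton, sub_zero, Finset.card_singleton, Nat.cast_one, one_mul] at h
    have hz : tp P bT (Bx d (2 * 2 ^ (n + l)) : Set (V d)) 0 x = 0 := tp_zero (by rw [mem_coe, mem_Bx]; omega)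
    rw [hz, zero_add, ← ofReal_mul (by positivity), ← ofReal_add (by positivity) (by positivity)] at h
    refine h.trans (ofReal_le_ofReal ?_)
    set Y : ℝ := ((2:ℝ) ^ (n + l + 2)) ^ (α - d) with hY
    have hY0 : 0 < Y := by positivity
    have e1 : ((2:ℝ) ^ (n + l + 2 + 1)) ^ (α - d) = Y * 2 ^ (α - d) := by
      rw [pow_succ, Real.mul_rpow (by positivity) (by norm_num)]
    have e2 : D * A * ((2:ℝ) ^ (n + l)) ^ α * ((2:ℝ) ^ n) ^ (-(d:ℝ)) ≤ D3 * Y := by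
      have a1 : ((2:ℝ) ^ (n + l)) ^ α ≤ ((2:ℝ) ^ (n + l + 2)) ^ α :=
        Real.rpow_le_rpow (by positivity) (pow_le_pow_right₀ (by norm_num) (by omega)) hα0.le
      have a2 : ((2:ℝ) ^ n) ^ (-(d:ℝ)) = ((2:ℝ) ^ (l + 2)) ^ (d : ℝ) * ((2:ℝ) ^ (n + l + 2)) ^ (-(d:ℝ)) := by
        rw [add_assoc n, pow_add 2 n, Real.mul_rpow (by positivity) (by positivity), mul_left_comm,
          ← Real.rpow_add (by positivity)]; simp
      have a3 : Y = ((2:ℝ) ^ (n + l + 2)) ^ α * ((2:ℝ) ^ (n + l + 2)) ^ (-(d:ℝ)) := by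
        rw [← Real.rpow_add (by positivity), hY]; congr 1
      calc _ ≤ D * A * ((2:ℝ) ^ (n + l + 2)) ^ α * ((2:ℝ) ^ n) ^ (-(d:ℝ)) :=
            mul_le_mul_of_nonneg_right (mul_le_mul_of_nonneg_left a1 (by positivity)) (by positivity)
        _ = _ := by rw [a2, a3, hD3]; ring
    have e3 : D * ((2:ℝ) ^ l) ^ (-(1 - α)) ≤ 1 / 2 ^ d / 2 := by
      refine (mul_le_mul_of_nonneg_left hl hD.le).trans (le_of_eq ?_)
      field_simp
    have e4 : D3 ≤ B * (1 / 2 ^ d / 2) := by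
      have : D3 = 2 * 2 ^ d * D3 * (1 / 2 ^ d / 2) := by field_simp
      rw [this]
      refine mul_le_mul_of_nonneg_right ?_ (by positivity)
      exact le_add_of_nonneg_right (by positivity)
    rw [e1]
    calc _ ≤ 1 / 2 ^ d / 2 * (B * Y) + B * (1 / 2 ^ d / 2) * Y :=
          add_le_add (mul_le_mul_of_nonneg_right e3 (by positivity)) (e2.trans (mul_le_mul_of_nonneg_right e4 hY0.le))
      _ = B * Y * (1 / 2 ^ d) := by ring
      _ ≤ B * Y * 2 ^ (α - d) := mul_le_mul_of_nonneg_left hq (by positivity)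
      _ = _ := by ring
end Unr
section Tri
variable {d : ℕ} {J : V d → V d → ℝ} {α c C : ℝ} {P : ℝ → Measure (Config d)} {β : ℝ}
variable {ω ω' : Config d} {S T : Set (V d)} {x y z : V d}
theorem amgm3 {a b c t : ℝ} (ha : 0 ≤ a) (hb : 0 ≤ b) (hc : 0 ≤ c) (ht : 0 < t) :
    a ^ 2 * b ^ 2 * c ^ 2 ≤ t ^ 3 * (a ^ 3 * b ^ 3) + t ^ 3 * (a ^ 3 * c ^ 3) + (t ^ 6)⁻¹ * (b ^ 3 * c ^ 3) := by
  have key : ∀ x y z : ℝ, 0 ≤ x → 0 ≤ y → 0 ≤ z → x * y * z ≤ x ^ 3 + y ^ 3 + z ^ 3 := by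
    intro x y z hx hy hz
    have h1 : 0 ≤ (x + y + z) * ((x - y) ^ 2 + (y - z) ^ 2 + (z - x) ^ 2) := by positivity
    have h2 : 0 ≤ x * y * z := by positivity
    nlinarith
  have := key (t * (a * b)) (t * (a * c)) ((t ^ 2)⁻¹ * (b * c)) (by positivity) (by positivity) (by positivity)
  calc _ = t * (a * b) * (t * (a * c)) * ((t ^ 2)⁻¹ * (b * c)) := by field_simp
    _ ≤ _ := this
    _ = _ := by field_simp
noncomputable def sg (P : ℝ → Measure (Config d)) (β : ℝ) (x : V d) : ℝ≥0∞ :=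
  ofReal (sqrt (tp P β univ 0 x).toReal ^ 3)
theorem sg_sum (hJ : KernelHyp d J α c C) (hP : IsLRP J P) (hα3 : 3 * α < d) {bT A B : ℝ} (hA : 0 < A) (hGA : GA P bT α A)
    (hB : 0 < B) (hpt : ∀ (k : ℕ) (x : V d), 2 ^ k ≤ normInf x → tp P bT univ 0 x ≤ ofReal (B * ((2:ℝ) ^ k) ^ (α - d))) :
    ∑' x, sg P bT x ≠ ⊤ := by
  have hα0 := hJ.alpha_pos
  set q : ℝ := (2:ℝ) ^ ((3 * α - d) / 2) with hq
  have hq0 : 0 < q := by positivity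
  have hq1 : q < 1 := Real.rpow_lt_one_of_one_lt_of_neg (by norm_num) (by linarith)
  have hp : ∀ x, sg P bT x ≤ (if x = 0 then sg P bT 0 else 0) + ∑' k : ℕ, ofReal (sqrt (B * ((2:ℝ) ^ k) ^ (α - d))) *
      (if x ∈ Bx d (2 ^ (k+1)) then tp P bT univ 0 x else 0) := by
    intro x
    by_cases hx : x = 0
    · rw [if_pos hx, hx]; exact le_add_right le_rfl
    rw [if_neg hx, zero_add]
    have h1 := normInf_pos hx
    refine le_trans ?_ (le_tsum (Nat.log 2 (normInf x)))
    have hk1 := Nat.pow_log_le_self 2 (show normInf x ≠ 0 by omega)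
    have hk2 : normInf x < 2 ^ (Nat.log 2 (normInf x) + 1) := Nat.lt_pow_succ_log_self (by norm_num) _
    rw [if_pos (by rw [mem_Bx]; exact hk2.le)]
    have ht : tp P bT univ 0 x ≠ ⊤ := ne_top_of_le_ne_top one_ne_top hP.tp_le_one
    rw [sg, pow_succ', sq_sqrt toReal_nonneg, ofReal_mul (sqrt_nonneg _), ofReal_toReal ht]
    refine mul_le_mul' (ofReal_le_ofReal (Real.sqrt_le_sqrt ?_)) le_rfl
    exact toReal_le_of_le_ofReal (by positivity) (hpt _ x hk1)
  refine ne_top_of_le_ne_top ?_ (tsum_le_tsum hp)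
  rw [tsum_add, tsum_ite_eq, tsum_comm]
  refine add_ne_top.2 ⟨ofReal_ne_top, ?_⟩
  refine ne_top_of_le_ne_top (b := ∑' k : ℕ, ofReal (sqrt B * A * 2 ^ α * q ^ k)) ?_ (tsum_le_tsum fun k => ?_)
  · rw [← ofReal_tsum_of_nonneg (fun i => by positivity) ((summable_geometric_of_lt_one hq0.le hq1).mul_left _)]
    exact ofReal_ne_top
  · rw [ENNReal.tsum_mul_left, tsum_eq_sum (s := Bx d (2 ^ (k + 1))) (by intro b hb; rw [if_neg hb]),
      sum_congr rfl (fun w hw => if_pos hw)]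
    refine (mul_le_mul' le_rfl (hGA (k+1) 0)).trans ?_
    rw [← ofReal_mul (sqrt_nonneg _)]
    refine ofReal_le_ofReal (le_of_eq ?_)
    have e1 : sqrt (((2:ℝ) ^ k) ^ (α - d)) = ((2:ℝ)^k) ^ ((α - d) / 2) := by
      rw [Real.sqrt_eq_rpow, ← Real.rpow_mul (by positivity)]; congr 1; ring
    have e2 : q ^ k = ((2:ℝ)^k) ^ ((α - d) / 2) * ((2:ℝ)^k) ^ α := by
      rw [← Real.rpow_add (by positivity), hq, ← Real.rpow_natCast, ← Real.rpow_natCast, ← Real.rpow_mul (by norm_num), ← Real.rpow_mul (by norm_num)]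
      congr 1; ring
    rw [sqrt_mul hB.le, e1, e2, pow_succ, Real.mul_rpow (by positivity) (by norm_num)]; ring
theorem tri_small (hJ : KernelHyp d J α c C) (hP : IsLRP J P) {bT : ℝ} (hT : 0 ≤ bT) (hs : ∑' x, sg P bT x ≠ ⊤) {ε : ℝ} (hε : 0 < ε) :
    ∃ ρ : ℕ, ∀ u v : V d, ρ < normInf (v - u) →
      ∑' w, ∑' a, tp P bT univ u w * tp P bT univ w a * tp P bT univ a v ≤ ofReal ε := by
  set G : ℝ := (∑' x, sg P bT x).toReal with hG
  have hGe : ∑' x, sg P bT x = ofReal G := (ofReal_toReal hs).symm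
  have hG0 : 0 ≤ G := toReal_nonneg
  set t : ℝ := 1 + 6 * G ^ 2 / ε with ht
  have ht1 : 1 ≤ t := le_add_of_nonneg_right (by positivity)
  have ht0 : 0 < t := by linarith
  set η : ℝ := ε / (12 * t ^ 3 * (G + 1)) with hη
  have hη0 : 0 < η := by positivity
  have htail := ENNReal.tendsto_tsum_compl_atTop_zero hs
  obtain ⟨s, hsη⟩ := (htail.eventually (gt_mem_nhds (ofReal_pos.2 hη0))).exists
  set s' : V d → ℝ≥0∞ := indicator {x | x ∉ s} (sg P bT) with hs'
  have hs'sum : ∑' x, s' x ≤ ofReal η := by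
    rw [hs', ← tsum_subtype]; exact hsη.le
  have main : ∀ v : V d, 3 * s.sup normInf < normInf v →
      ∑' w, ∑' a, tp P bT univ 0 w * tp P bT univ 0 (a - w) * tp P bT univ 0 (v - a) ≤ ofReal ε := by
    intro v hv
    set σ := sg P bT with hσ
    set k1 : ℝ≥0∞ := ofReal (t ^ 3) with hk1
    set k2 : ℝ≥0∞ := ofReal ((t ^ 6)⁻¹) with hk2
    have hb : ∀ x y z : V d, tp P bT univ 0 x * tp P bT univ 0 y * tp P bT univ 0 z ≤
        k1 * (σ x * σ y) + k1 * (σ x * σ z) + k2 * (σ y * σ z) := by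
      intro x y z
      have hr : ∀ x, tp P bT univ 0 x = ofReal (sqrt (tp P bT univ 0 x).toReal ^ 2) := by
        intro x
        rw [sq_sqrt toReal_nonneg, ofReal_toReal (ne_top_of_le_ne_top one_ne_top hP.tp_le_one)]
      have := amgm3 (sqrt_nonneg (tp P bT univ 0 x).toReal) (sqrt_nonneg (tp P bT univ 0 y).toReal)
        (sqrt_nonneg (tp P bT univ 0 z).toReal) ht0
      rw [hr x, hr y, hr z, ← ofReal_mul (by positivity), ← ofReal_mul (by positivity)]
      refine (ofReal_le_ofReal this).trans ?_
      rw [ofReal_add (by positivity) (by positivity), ofReal_add (by positivity) (by positivity),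
        ofReal_mul (by positivity), ofReal_mul (by positivity), ofReal_mul (by positivity),
        ofReal_mul (by positivity), ofReal_mul (by positivity), ofReal_mul (by positivity)]
      exact le_rfl
    have hp : ∀ w a, tp P bT univ 0 w * tp P bT univ 0 (a - w) * tp P bT univ 0 (v - a) ≤
        k1 * ((s' w * σ (a - w) + s' w * σ (v - a)) + (σ w * s' (a - w) + s' (a - w) * σ (v - a)) +
          (σ w * s' (v - a) + σ (a - w) * s' (v - a))) +
        k2 * (σ (a - w) * σ (v - a) + σ w * σ (v - a) + σ w * σ (a - w)) := by
      intro w a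
      have hsn : w ∉ s ∨ a - w ∉ s ∨ v - a ∉ s := by
        by_contra hc
        push Not at hc
        have h1 := le_sup (f := normInf) hc.1
        have h2 := le_sup (f := normInf) hc.2.1
        have h3 := le_sup (f := normInf) hc.2.2
        have h4 := normInf_add_le (v - a) (a - w)
        have h5 := normInf_add_le ((v - a) + (a - w)) w
        rw [show v - a + (a - w) + w = v by abel] at h5
        omega
      have hid : ∀ x, x ∉ s → s' x = σ x := fun x hx => indicator_of_mem (s := {x | x ∉ s}) hx _
      rcases hsn with h | h | h
      · rw [hid _ h]
        refine (hb w (a - w) (v - a)).trans ?_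
        rw [← mul_add, add_assoc (σ w * _ + _)]
        exact add_le_add (mul_le_mul' le_rfl (le_add_right le_rfl)) (mul_le_mul' le_rfl (by rw [add_assoc]; exact le_add_right le_rfl))
      · rw [hid _ h, mul_comm (tp _ _ _ _ w)]
        refine (hb (a - w) w (v - a)).trans ?_
        rw [← mul_add, mul_comm (σ (a - w)) (σ w)]
        refine add_le_add (mul_le_mul' le_rfl ?_) (mul_le_mul' le_rfl ?_)
        · exact le_add_right (le_add_left le_rfl)
        · exact le_add_right (le_add_left le_rfl)
      · rw [hid _ h, mul_comm]
        refine (le_of_eq (mul_assoc _ _ _).symm).trans ((hb (v - a) w (a - w)).trans ?_)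
        rw [← mul_add, mul_comm (σ (v - a)) (σ w), mul_comm (σ (v - a))]
        exact add_le_add (mul_le_mul' le_rfl (le_add_left le_rfl)) (mul_le_mul' le_rfl (le_add_left le_rfl))
    have t12 : ∀ f g : V d → ℝ≥0∞, ∑' w, ∑' a, f w * g (a - w) = (∑' x, f x) * ∑' x, g x := by
      intro f g
      rw [← ENNReal.tsum_mul_right]
      congr 1; ext w
      rw [ENNReal.tsum_mul_left]
      have e := (Equiv.subRight w).tsum_eq g
      simp only [Equiv.subRight_apply] at e; rw [e]
    have eL : ∀ g : V d → ℝ≥0∞, ∑' a, g (v - a) = ∑' a, g a := fun g => (Equiv.subLeft v).tsum_eq g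
    have t13 : ∀ f g : V d → ℝ≥0∞, ∑' w, ∑' a, f w * g (v - a) = (∑' x, f x) * ∑' x, g x := by
      intro f g
      simp only [ENNReal.tsum_mul_left, eL]; rw [ENNReal.tsum_mul_right]
    have t23 : ∀ f g : V d → ℝ≥0∞, ∑' w, ∑' a, f (a - w) * g (v - a) = (∑' x, f x) * ∑' x, g x := by
      intro f g
      rw [tsum_comm]
      have : ∀ a, ∑' w, f (a - w) * g (v - a) = (∑' x, f x) * g (v - a) := by
        intro a
        rw [ENNReal.tsum_mul_right, ← (Equiv.subLeft a).tsum_eq f]; rfl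
      simp only [this]; rw [ENNReal.tsum_mul_left, eL]
    refine (tsum_le_tsum fun w => tsum_le_tsum fun a => hp w a).trans ?_
    simp only [tsum_add, ENNReal.tsum_mul_left (a := k1), ENNReal.tsum_mul_left (a := k2)]
    simp only [t12, t13, t23]
    rw [hGe]
    have e6 : ofReal ε = k1 * ((ofReal η * ofReal (G+1) + ofReal η * ofReal (G+1)) +
        (ofReal (G+1) * ofReal η + ofReal η * ofReal (G+1)) +
        (ofReal (G+1) * ofReal η + ofReal (G+1) * ofReal η)) + ofReal (ε / 2) := by
      simp only [← ofReal_mul hη0.le, ← ofReal_mul (show 0 ≤ G + 1 by positivity)]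
      rw [← ofReal_add (by positivity) (by positivity), ← ofReal_add (by positivity) (by positivity),
        ← ofReal_add (by positivity) (by positivity), ← ofReal_add (by positivity) (by positivity),
        ← ofReal_add (by positivity) (by positivity), ← ofReal_mul (by positivity),
        ← ofReal_add (by positivity) (by positivity)]
      congr 1; rw [hη]; field_simp; ring
    rw [e6]
    have hG1 : ofReal G ≤ ofReal (G + 1) := ofReal_le_ofReal (by linarith)
    refine add_le_add (mul_le_mul' le_rfl (add_le_add (add_le_add (add_le_add ?_ ?_) (add_le_add ?_ ?_)) (add_le_add ?_ ?_))) ?_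
    any_goals exact mul_le_mul' (by assumption) (by assumption)
    simp only [← ofReal_mul hG0]
    rw [← ofReal_add (by positivity) (by positivity), ← ofReal_add (by positivity) (by positivity), ← ofReal_mul (by positivity)]
    refine ofReal_le_ofReal ?_
    rw [inv_mul_le_iff₀ (by positivity)]
    have h1 : t ≤ t ^ 6 := le_self_pow₀ ht1 (by norm_num)
    have h2 : 6 * G ^ 2 / ε * ε = 6 * G ^ 2 := by field_simp
    have h3 : 6 * G ^ 2 / ε * ε ≤ t ^ 6 * ε := mul_le_mul_of_nonneg_right (by linarith) hε.le
    nlinarith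
  refine ⟨3 * s.sup normInf, fun u v huv => ?_⟩
  refine le_trans (le_of_eq ?_) (main (v - u) huv)
  have e := (Equiv.subRight u).tsum_eq (fun w => ∑' a, tp P bT univ 0 w * tp P bT univ 0 (a - w) * tp P bT univ 0 (v - u - a))
  rw [← e]
  congr 1; ext w
  have e := (Equiv.subRight u).tsum_eq (fun a => tp P bT univ 0 (w - u) * tp P bT univ 0 (a - (w - u)) * tp P bT univ 0 (v - u - a))
  simp only [Equiv.subRight_apply] at e ⊢
  rw [← e]
  congr 1; ext a
  rw [hP.tp_univ_zero hJ hT (x := u), hP.tp_univ_zero hJ hT (x := w), hP.tp_univ_zero hJ hT (x := a)]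
  rw [sub_sub_sub_cancel_right, sub_sub_sub_cancel_right]
end Tri
section Upper
variable {d : ℕ} {J : V d → V d → ℝ} {α c C : ℝ} {P : ℝ → Measure (Config d)} {β : ℝ}
variable {ω ω' : Config d} {S T : Set (V d)} {x y z : V d}
open scoped Classical in
noncomputable def fz (n : ℕ) (s : ℝ≥0∞) : ℝ≥0∞ := if s ≤ n then s else 0
theorem fz_le (n : ℕ) (s : ℝ≥0∞) : fz n s ≤ min s n := by
  unfold fz; split_ifs with h
  · exact le_min le_rfl h
  · exact zero_le
theorem measurable_fz (n : ℕ) : Measurable (fz n) :=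
  Measurable.ite measurableSet_Iic measurable_id measurable_const
theorem measurable_fsz (n : ℕ) (S : Set (V d)) (x : V d) : Measurable fun ω => fz n (sz ω S x) :=
  (measurable_fz n).comp (measurable_sz S x)
theorem fz_ne_top (n : ℕ) (s : ℝ≥0∞) : fz n s ≠ ⊤ :=
  ne_top_of_le_ne_top (natCast_ne_top n) ((fz_le n s).trans (min_le_right _ _))
theorem sz_of_Cl {D : Finset (V d)} (h : Cl ω S x = D) : sz ω S x = D.card := by
  rw [sz, h, encard_coe_eq_coe_finsetCard]; rfl
theorem sz_top (h : ¬ (Cl ω S x).Finite) : sz ω S x = ⊤ := by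
  rw [sz, Set.Infinite.encard_eq h]; rfl
theorem fz_top (n : ℕ) : fz n ⊤ = 0 := by simp [fz]
theorem sum_fz (n : ℕ) (S : Set (V d)) (z : V d) (μ : Measure (Config d)) (h : Config d → ℝ≥0∞) :
    ∑' D : Finset (V d), fz n D.card * ∫⁻ ω in {ω | Cl ω S z = D}, h ω ∂μ =
      ∫⁻ ω, fz n (sz ω S z) * h ω ∂μ := by
  have h1 : ∀ D : Finset (V d), fz n D.card * ∫⁻ ω in {ω | Cl ω S z = D}, h ω ∂μ =
      ∫⁻ ω in {ω | Cl ω S z = D}, fz n (sz ω S z) * h ω ∂μ := fun D => by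
    rw [← lintegral_const_mul' _ _ (fz_ne_top _ _)]
    exact setLIntegral_congr_fun (measurableSet_Cl S z D) fun ω hω => by
      rw [sz_of_Cl (show Cl ω S z = D from hω)]
  simp_rw [h1]
  rw [sum_Cl]
  refine setLIntegral_eq_of_support_subset ?_
  intro ω hω
  by_contra hf
  exact hω (by simp [sz_top hf, fz_top])
theorem G_shift (hJ : KernelHyp d J α c C) (hP : IsLRP J P) (hβ : 0 ≤ β) {f : ℝ≥0∞ → ℝ≥0∞}
    (hf : Measurable f) (v : V d) :
    ∫⁻ ω, f (sz ω univ v) ∂P β = ∫⁻ ω, f (sz ω univ 0) ∂P β := by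
  rw [← hP.lintegral_shift hJ hβ v (f := fun ω => f (sz ω univ 0)) (hf.comp (measurable_sz univ 0))]
  simp only [sz_shift]
  rw [Set.image_univ, Set.range_eq_univ.2 (fun y => ⟨y - v, sub_add_cancel y v⟩), zero_add]
theorem Fn_shift (hJ : KernelHyp d J α c C) (hP : IsLRP J P) (hβ : 0 ≤ β) (n : ℕ) (v : V d) :
    Fn P β univ v n = Fn P β univ 0 n :=
  G_shift hJ hP hβ (f := fun s => min s n) (by fun_prop) v
theorem lemE (hJ : KernelHyp d J α c C) (hP : IsLRP J P) (hβ : 0 ≤ β) (n : ℕ) (A : Finset (V d))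
    (v : V d) : ∫⁻ ω, fz n (sz ω univ v) ∂P β ≤ ∫⁻ ω, fz n (sz ω (A : Set (V d))ᶜ v) ∂P β +
      Fn P β univ 0 n * ∑ a ∈ A, tp P β univ v a := by
  classical
  let B : Finset (V d) → V d → Set (Config d) := fun D a =>
    if a = v then univ else {ω | ∃ e ∈ D.image (fun u => s(u, a)), ω e = true}
  have hBm : ∀ D a, MeasurableSet (B D a) := fun D a => by
    simp only [B]; split_ifs
    · exact .univ
    · exact measurableSet_of_dep _ (dep_exists _)
  have hBd : ∀ D a, Dep (B D a) (Ein (D : Set (V d))ᶜ)ᶜ := fun D a => by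
    simp only [B]; split_ifs
    · exact fun _ _ _ => Iff.rfl
    · refine (dep_exists _).mono fun e he => ?_
      simp only [coe_image] at he
      obtain ⟨u, hu, rfl⟩ := he
      intro hh
      exact (mk_mem_Ein.1 hh).1 hu
  have hconn : ∀ (D : Finset (V d)) a ω, Cl ω (A : Set (V d))ᶜ v = D → a ∈ A → ω ∈ B D a → connIn ω univ v a := by
    intro D a ω hD ha hB
    by_cases hav : a = v
    · rw [hav]; exact connIn.refl trivial
    have hB' : ∃ e ∈ D.image (fun u => s(u, a)), ω e = true := by simpa [B, hav] using hB
    obtain ⟨e, he, hωe⟩ := hB'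
    obtain ⟨u, hu, rfl⟩ := Finset.mem_image.1 he
    have hu' : u ∈ Cl ω (A : Set (V d))ᶜ v := hD ▸ hu
    refine (connIn.mono hu' (subset_univ _)).trans (.step trivial trivial ⟨?_, hωe⟩)
    rintro rfl
    exact Cl_subset hu' ha
  have hpt : ∀ (D : Finset (V d)) (ω : Config d), Cl ω (A : Set (V d))ᶜ v = D → fz n (sz ω univ v) ≤
      fz n (sz ω (A : Set (V d))ᶜ v) + ∑ a ∈ A, (B D a).indicator (fun ω => min (sz ω (D : Set (V d))ᶜ a) n) ω := by
    intro D ω hD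
    by_cases hn : sz ω univ v ≤ n
    swap
    · simp [fz, hn]
    have hn' : sz ω (A : Set (V d))ᶜ v ≤ n := (sz_mono (subset_univ _)).trans hn
    have h3 : sz ω univ v ≤ sz ω (A : Set (V d))ᶜ v +
        ∑ a ∈ A, (B D a).indicator (fun ω => sz ω (D : Set (V d))ᶜ a) ω := by
      have e1 : ∀ a, (B D a).indicator (fun ω => sz ω (D : Set (V d))ᶜ a) ω =
          ∑' y, (B D a).indicator (fun ω => {ω | connIn ω (D : Set (V d))ᶜ a y}.indicator (fun x => 1) ω) ω := by
        intro a
        by_cases hB : ω ∈ B D a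
        · simp only [indicator_of_mem hB]; exact sz_eq_tsum
        · simp [indicator_of_notMem hB]
      simp_rw [e1]
      rw [sz_eq_tsum, sz_eq_tsum, ← Summable.tsum_finsetSum (fun _ _ => summable),
        ← tsum_add]
      refine tsum_le_tsum fun y => ?_
      by_cases hy : connIn ω univ v y
      swap
      · rw [indicator_of_notMem (by exact hy)]; exact zero_le
      rw [indicator_of_mem (by exact hy)]
      by_cases hy2 : connIn ω (A : Set (V d))ᶜ v y
      · rw [indicator_of_mem (by exact hy2)]; exact le_add_right le_rfl
      have : ∃ a ∈ A, ω ∈ B D a ∧ connIn ω (D : Set (V d))ᶜ a y := by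
        by_cases hvA : v ∈ A
        · refine ⟨v, hvA, by simp [B], ?_⟩
          have : (D : Set (V d)) = ∅ := by
            rw [← hD]; ext q
            simp only [mem_Cl, mem_empty_iff_false, iff_false]
            exact fun h => h.1 hvA
          rw [this, Set.compl_empty]; exact hy
        · obtain ⟨u, a, hu, -, ha, -, had, hay⟩ := last_exit (Cl ω (A : Set (V d))ᶜ v) hy
            (connIn.refl hvA) hy2
          have haA : a ∈ A := by
            by_contra haA
            exact ha (connIn.trans hu (.step (Cl_subset hu) haA had))
          refine ⟨a, haA, ?_, ?_⟩
          · by_cases hav : a = v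
            · simp [B, hav]
            · simp only [B, hav, if_false]
              exact ⟨s(u, a), Finset.mem_image.2 ⟨u, by rw [hD] at hu; exact hu, rfl⟩, had.2⟩
          · rw [hD] at hay
            exact hay.mono fun q hq => hq.2
      obtain ⟨a, ha, hB, hc⟩ := this
      refine le_add_left ?_
      refine le_trans ?_ (Finset.single_le_sum (fun _ _ => zero_le) ha)
      rw [indicator_of_mem hB, indicator_of_mem (by exact hc)]
    simp only [fz, hn, hn', if_true]
    refine h3.trans (add_le_add le_rfl (sum_le_sum fun a ha => ?_))
    by_cases hB : ω ∈ B D a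
    · simp only [indicator_of_mem hB]
      refine le_min le_rfl (le_trans ?_ hn)
      have h5 := hconn D a ω hD ha hB
      have : sz ω univ a = sz ω univ v := by
        rw [sz, sz, Cl_eq_of_mem h5]
      rw [← this]; exact sz_mono (subset_univ _)
    · simp [indicator_of_notMem hB]
  have hI : ∀ (D : Finset (V d)) a, ∫⁻ ω in {ω | Cl ω (A : Set (V d))ᶜ v = D},
      (B D a).indicator (fun ω => min (sz ω (D : Set (V d))ᶜ a) n) ω ∂P β ≤
      Fn P β univ 0 n * P β ({ω | Cl ω (A : Set (V d))ᶜ v = D} ∩ B D a) := by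
    intro D a
    rw [setLIntegral_indicator (hBm D a), inter_comm, hP.indep_set_fun (S := (Ein (D : Set (V d))ᶜ)ᶜ)
      (T := Ein (D : Set (V d))ᶜ) disjoint_compl_left ((measurableSet_Cl _ _ _).inter (hBm D a))
      ((measurable_sz _ _).min measurable_const)
      ((Set.union_self (Ein (D : Set (V d))ᶜ)ᶜ) ▸ Dep.inter (Dep.mono (T := (Ein (D : Set (V d))ᶜ)ᶜ) (Dep_Cl _ _ _) fun e he => he.2) (hBd D a)) (fun ω ω' h => by
        rw [sz_congr fun e he => h e he]), mul_comm]
    exact mul_le_mul' ((Fn_mono (subset_univ _) n).trans_eq (Fn_shift hJ hP hβ n a)) le_rfl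
  have hle : ∫⁻ ω, fz n (sz ω univ v) ∂P β ≤
      ∫⁻ ω in {ω | (Cl ω (A : Set (V d))ᶜ v).Finite}, fz n (sz ω univ v) ∂P β := by
    refine le_of_eq (setLIntegral_eq_of_support_subset ?_).symm
    intro ω hω
    by_contra hf
    have := sz_mono (ω := ω) (x := v) (subset_univ (A : Set (V d))ᶜ)
    rw [sz_top hf, top_le_iff] at this
    exact hω (by simp [this, fz_top])
  have hPsum : ∀ a ∈ A, ∑' D : Finset (V d), P β ({ω | Cl ω (A : Set (V d))ᶜ v = D} ∩ B D a) ≤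
      tp P β univ v a := by
    intro a ha
    rw [tp, ← measure_iUnion]
    · exact measure_mono (iUnion_subset fun D ω hω => hconn D a ω hω.1 ha hω.2)
    · intro D D' hD
      refine Set.disjoint_left.2 fun ω h h' => hD ?_
      exact_mod_cast (show Cl ω (A : Set (V d))ᶜ v = D from h.1).symm.trans h'.1
    · exact fun D => (measurableSet_Cl _ _ _).inter (hBm D a)
  refine hle.trans ?_
  rw [← sum_Cl]
  calc _ ≤ ∑' D : Finset (V d), (∫⁻ ω in {ω | Cl ω (A : Set (V d))ᶜ v = D}, fz n (sz ω (A : Set (V d))ᶜ v) ∂P β +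
        ∑ a ∈ A, Fn P β univ 0 n * P β ({ω | Cl ω (A : Set (V d))ᶜ v = D} ∩ B D a)) := by
        refine tsum_le_tsum fun D => ?_
        refine (setLIntegral_mono' (measurableSet_Cl _ _ _) fun ω hω => hpt D ω hω).trans ?_
        rw [lintegral_add_left (measurable_fsz n _ _), lintegral_finsetSum']
        · exact add_le_add le_rfl (sum_le_sum fun a _ => hI D a)
        · exact fun a _ => (((measurable_sz _ _).min measurable_const).indicator (hBm D a)).aemeasurable
    _ ≤ _ := by
        rw [tsum_add, sum_Cl, Summable.tsum_finsetSum (fun _ _ => summable), mul_sum]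
        refine add_le_add (setLIntegral_le_lintegral _ _) (sum_le_sum fun a ha => ?_)
        rw [ENNReal.tsum_mul_left]
        exact mul_le_mul' le_rfl (hPsum a ha)
noncomputable def tri (P : ℝ → Measure (Config d)) (β : ℝ) (u v : V d) : ℝ≥0∞ :=
  ∑' w, ∑' a, tp P β univ u w * tp P β univ w a * tp P β univ a v
theorem Ex_tri (hJ : KernelHyp d J α c C) (hP : IsLRP J P) (hβ : 0 ≤ β) (n : ℕ) (S : Set (V d))
    (v w : V d) : ∑' D : Finset (V d), P β {ω | Cl ω S v = D} * fz n D.card * ∑ a ∈ D, tp P β univ w a ≤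
      Fn P β univ 0 n * tri P β v w := by
  classical
  have h1 : ∀ D : Finset (V d), P β {ω | Cl ω S v = D} * fz n D.card * ∑ a ∈ D, tp P β univ w a =
      fz n D.card * ∫⁻ ω in {ω | Cl ω S v = D}, ∑' a, tp P β univ w a *
        {ω | connIn ω S v a}.indicator (fun _ => 1) ω ∂P β := by
    intro D
    rw [setLIntegral_congr_fun (g := fun _ => ∑ a ∈ D, tp P β univ w a) (measurableSet_Cl S v D), setLIntegral_const]
    · ring
    · intro ω hω
      have hω' : Cl ω S v = D := hω
      simp only
      rw [tsum_eq_sum (s := D)]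
      · refine sum_congr rfl fun a ha => ?_
        have : connIn ω S v a := by
          have : a ∈ Cl ω S v := by rw [hω']; exact ha
          exact this
        rw [indicator_of_mem (by exact this), mul_one]
      · intro a ha
        have : ¬ connIn ω S v a := by
          intro h
          have : a ∈ Cl ω S v := h
          rw [hω'] at this; exact ha this
        rw [indicator_of_notMem (by exact this), mul_zero]
  simp_rw [h1]
  rw [sum_fz]
  have hm : ∀ a, Measurable fun ω : Config d => {ω | connIn ω S v a}.indicator (fun _ => (1:ℝ≥0∞)) ω :=
    fun a => measurable_const.indicator (measurableSet_connIn _ _ _)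
  calc _ = ∑' a, tp P β univ w a * ∫⁻ ω in {ω | connIn ω S v a}, fz n (sz ω S v) ∂P β := by
        simp_rw [← ENNReal.tsum_mul_left]
        rw [lintegral_tsum (f := fun a ω => fz n (sz ω S v) * (tp P β univ w a * {ω | connIn ω S v a}.indicator (fun x => 1) ω))
          fun a => ((measurable_fsz n S v).mul ((hm a).const_mul _)).aemeasurable]
        refine tsum_congr fun a => ?_
        rw [← lintegral_indicator (measurableSet_connIn _ _ _), ← lintegral_const_mul]
        · refine lintegral_congr fun ω => ?_
          by_cases h : connIn ω S v a
          · rw [indicator_of_mem (by exact h), indicator_of_mem (by exact h)]; ring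
          · rw [indicator_of_notMem (by exact h), indicator_of_notMem (by exact h)]; ring
        · exact (measurable_fsz n S v).indicator (measurableSet_connIn _ _ _)
    _ ≤ ∑' a, tp P β univ w a * ∑' b, tp P β univ v b * tp P β univ b a * Fn P β univ 0 n := by
        refine tsum_le_tsum fun a => mul_le_mul' le_rfl ?_
        refine le_trans ?_ ((hP.tree (β := β) v a n).trans_eq ?_)
        · refine (lintegral_mono_set (t := {ω | connIn ω univ v a})
            fun ω (h : connIn ω S v a) => h.mono (subset_univ _)).trans (lintegral_mono fun ω => ?_)
          exact (fz_le _ _).trans (min_le_min (sz_mono (subset_univ _)) le_rfl)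
        · exact tsum_congr fun b => by rw [Fn_shift hJ hP hβ n b]
    _ = _ := by
        simp_rw [tri, ← ENNReal.tsum_mul_left]
        rw [tsum_comm]
        refine tsum_congr fun a => tsum_congr fun b => ?_
        rw [tp_comm (x := w)]; ring
end Upper
section Upper2
variable {d : ℕ} {J : V d → V d → ℝ} {α c C : ℝ} {P : ℝ → Measure (Config d)} {β : ℝ}
variable {ω ω' : Config d} {S T : Set (V d)} {x y z : V d}
open scoped Classical in
noncomputable def T3 (P : ℝ → Measure (Config d)) (β : ℝ) (n : ℕ) (u v w : V d) : ℝ≥0∞ :=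
  ∑' C : Finset (V d), P β {ω | Cl ω univ u = C} * fz n C.card *
    ∑' D : Finset (V d), P β {ω | Cl ω (C : Set (V d))ᶜ v = D} * fz n D.card *
      ∫⁻ ω, fz n (sz ω ((C ∪ D : Finset (V d)) : Set (V d))ᶜ w) ∂P β
theorem sum_fz_one (n : ℕ) (S : Set (V d)) (v : V d) :
    ∑' D : Finset (V d), P β {ω | Cl ω S v = D} * fz n D.card = ∫⁻ ω, fz n (sz ω S v) ∂P β := by
  have := sum_fz n S v (P β) (fun _ => 1)
  simp only [setLIntegral_one, mul_one] at this
  rw [← this]; exact tsum_congr fun D => mul_comm _ _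
theorem g_le (n : ℕ) (S : Set (V d)) (v : V d) : ∫⁻ ω, fz n (sz ω S v) ∂P β ≤ Fn P β S v n :=
  lintegral_mono fun ω => fz_le _ _
theorem T3_lower (hJ : KernelHyp d J α c C) (hP : IsLRP J P) (hβ : 0 ≤ β) (n : ℕ) (u v w : V d)
    {G F : ℝ≥0∞} (hG : G = ∫⁻ ω, fz n (sz ω univ 0) ∂P β) (hF : F = Fn P β univ 0 n) :
    G * (G * G) ≤ T3 P β n u v w + F ^ 3 * (tri P β u v + tri P β u w + tri P β v w) := by
  classical
  have hGv : ∀ v, G = ∫⁻ ω, fz n (sz ω univ v) ∂P β := fun v => by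
    rw [hG]; exact (G_shift hJ hP hβ (measurable_fz n) v).symm
  have hGF : G ≤ F := by rw [hG, hF]; exact g_le _ _ _
  let s : V d → Finset (V d) → ℝ≥0∞ := fun v A => ∑ a ∈ A, tp P β univ v a
  have hE : ∀ v (A : Finset (V d)), G ≤ ∫⁻ ω, fz n (sz ω (A : Set (V d))ᶜ v) ∂P β + F * s v A :=
    fun v A => by rw [hGv v, hF]; exact lemE hJ hP hβ n A v
  have hgF : ∀ (A : Finset (V d)), ∫⁻ ω, fz n (sz ω (A : Set (V d))ᶜ v) ∂P β ≤ F := fun A => by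
    rw [hF, ← Fn_shift hJ hP hβ n v]; exact (g_le _ _ _).trans (Fn_mono (subset_univ _) n)
  have hC : ∀ A : Finset (V d), G * G ≤ (∑' D : Finset (V d), P β {ω | Cl ω (A : Set (V d))ᶜ v = D} * fz n D.card *
      ∫⁻ ω, fz n (sz ω ((A ∪ D : Finset (V d)) : Set (V d))ᶜ w) ∂P β) +
      F ^ 2 * s v A + F ^ 2 * s w A + F ^ 2 * tri P β v w := by
    intro A
    calc G * G ≤ (∫⁻ ω, fz n (sz ω (A : Set (V d))ᶜ v) ∂P β) * G + F * s v A * F := by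
          refine (mul_le_mul' (hE v A) le_rfl).trans ?_
          rw [add_mul]; exact add_le_add le_rfl (mul_le_mul' le_rfl hGF)
      _ ≤ (∑' D : Finset (V d), P β {ω | Cl ω (A : Set (V d))ᶜ v = D} * fz n D.card *
          (∫⁻ ω, fz n (sz ω ((A ∪ D : Finset (V d)) : Set (V d))ᶜ w) ∂P β + F * (s w A + s w D)))
          + F * s v A * F := by
          rw [← sum_fz_one, ← ENNReal.tsum_mul_right]
          refine add_le_add (tsum_le_tsum fun D => mul_le_mul' le_rfl ?_) le_rfl
          refine (hE w (A ∪ D)).trans (add_le_add le_rfl (mul_le_mul' le_rfl ?_))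
          rw [← Finset.sum_union_inter]; exact le_add_right le_rfl
      _ ≤ _ := by
          have e1 : ∀ D : Finset (V d), P β {ω | Cl ω (A : Set (V d))ᶜ v = D} * fz n D.card *
              (∫⁻ ω, fz n (sz ω ((A ∪ D : Finset (V d)) : Set (V d))ᶜ w) ∂P β + F * (s w A + s w D)) =
              P β {ω | Cl ω (A : Set (V d))ᶜ v = D} * fz n D.card *
              ∫⁻ ω, fz n (sz ω ((A ∪ D : Finset (V d)) : Set (V d))ᶜ w) ∂P β +
              F * s w A * (P β {ω | Cl ω (A : Set (V d))ᶜ v = D} * fz n D.card) +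
              F * (P β {ω | Cl ω (A : Set (V d))ᶜ v = D} * fz n D.card * s w D) := fun D => by ring
          simp_rw [e1]
          rw [tsum_add, tsum_add, ENNReal.tsum_mul_left, ENNReal.tsum_mul_left, sum_fz_one]
          have h1 := hgF A
          have h2 : ∑' D : Finset (V d), P β {ω | Cl ω (A : Set (V d))ᶜ v = D} * fz n D.card * s w D ≤ F * tri P β v w := by
            rw [hF]; exact Ex_tri hJ hP hβ n _ v w
          calc _ ≤ (∑' D : Finset (V d), P β {ω | Cl ω (A : Set (V d))ᶜ v = D} * fz n D.card *
                ∫⁻ ω, fz n (sz ω ((A ∪ D : Finset (V d)) : Set (V d))ᶜ w) ∂P β) + F * s w A * F +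
                F * (F * tri P β v w) + F * s v A * F :=
                add_le_add (add_le_add (add_le_add le_rfl (mul_le_mul' le_rfl h1)) (mul_le_mul' le_rfl h2)) le_rfl
            _ = _ := by ring
  have hu : ∀ v, ∑' A : Finset (V d), P β {ω | Cl ω univ u = A} * fz n A.card * s v A ≤ F * tri P β u v := fun v => by
    rw [hF]; exact Ex_tri hJ hP hβ n _ u v
  have hGu : G = ∑' A : Finset (V d), P β {ω | Cl ω univ u = A} * fz n A.card := by rw [sum_fz_one, hGv u]
  calc G * (G * G) = ∑' A : Finset (V d), P β {ω | Cl ω univ u = A} * fz n A.card * (G * G) := by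
        rw [ENNReal.tsum_mul_right, ← hGu]
    _ ≤ ∑' A : Finset (V d), P β {ω | Cl ω univ u = A} * fz n A.card * (_ + _ + _ + _) :=
        tsum_le_tsum fun A => mul_le_mul' le_rfl (hC A)
    _ = T3 P β n u v w + F ^ 2 * (∑' A : Finset (V d), P β {ω | Cl ω univ u = A} * fz n A.card * s v A)
        + F ^ 2 * (∑' A : Finset (V d), P β {ω | Cl ω univ u = A} * fz n A.card * s w A) +
        F ^ 2 * tri P β v w * G := by
        conv_rhs => rw [hGu]
        rw [T3, ← ENNReal.tsum_mul_left, ← ENNReal.tsum_mul_left, ← ENNReal.tsum_mul_left,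
          ← tsum_add, ← tsum_add, ← tsum_add]
        exact tsum_congr fun A => by ring
    _ ≤ T3 P β n u v w + F ^ 2 * (F * tri P β u v) + F ^ 2 * (F * tri P β u w) + F ^ 2 * tri P β v w * F :=
        add_le_add (add_le_add (add_le_add le_rfl (mul_le_mul' le_rfl (hu v))) (mul_le_mul' le_rfl (hu w)))
          (mul_le_mul' le_rfl hGF)
    _ = _ := by ring
theorem Cl_compl {Z : Set (V d)} (h : ∀ a ∈ Z, ∀ b, adj ω a b → b ∈ Z) (hx : x ∉ Z) :
    Cl ω Zᶜ x = Cl ω univ x := by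
  refine Set.Subset.antisymm (fun y hy => connIn.mono hy (subset_univ _)) fun y hy => ?_
  by_contra hy2
  obtain ⟨a, b, ha, -, hb, -, hab, -⟩ := last_exit (Cl ω Zᶜ x) hy (connIn.refl hx) hy2
  have hbZ : b ∈ Z := by
    by_contra hbZ
    exact hb (connIn.trans ha (.step (Cl_subset ha) hbZ hab))
  exact Cl_subset ha (h b hbZ a hab.symm)
theorem Cl_closed (u : V d) : ∀ a ∈ Cl ω univ u, ∀ b, adj ω a b → b ∈ Cl ω univ u :=
  fun _ ha _ hab => connIn.trans ha (.step trivial trivial hab)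
theorem Cl_empty (h : x ∉ S) : Cl ω S x = ∅ := by
  ext y; simp only [mem_Cl, mem_empty_iff_false, iff_false]; exact fun hh => h hh.1
def Ndis (u v w : V d) : Set (Config d) :=
  {ω | ¬ connIn ω univ u v ∧ ¬ connIn ω univ u w ∧ ¬ connIn ω univ v w}
theorem measurableSet_Ndis (u v w : V d) : MeasurableSet (Ndis u v w) :=
  (measurableSet_connIn _ _ _).compl.inter
    ((measurableSet_connIn _ _ _).compl.inter (measurableSet_connIn _ _ _).compl)
theorem T3_upper (hP : IsLRP J P) (n : ℕ) (u v w : V d) : T3 P β n u v w ≤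
    ∫⁻ ω, fz n (sz ω univ u) * (fz n (sz ω univ v) *
      (Ndis u v w).indicator (fun ω => fz n (sz ω univ w)) ω) ∂P β := by
  classical
  rw [← sum_fz]
  have fz0 : fz n 0 = 0 := by simp [fz]
  refine tsum_le_tsum fun A => ?_
  rw [mul_comm (P β _), mul_assoc]
  refine mul_le_mul' le_rfl ?_
  set EA : Set (Config d) := {ω | Cl ω univ u = A} with hEA
  refine le_trans ?_ (setLIntegral_le_lintegral {ω | (Cl ω (A : Set (V d))ᶜ v).Finite} _)
  rw [← sum_Cl, ← ENNReal.tsum_mul_left]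
  refine tsum_le_tsum fun D => ?_
  set ED : Set (Config d) := {ω | Cl ω (A : Set (V d))ᶜ v = D} with hED
  rw [Measure.restrict_restrict (measurableSet_Cl _ _ _)]
  by_cases hAD : Disjoint A D
  swap
  · have : ED = ∅ := by
      ext ω
      simp only [hED, mem_ofPred_eq, mem_empty_iff_false, iff_false]
      intro h
      obtain ⟨a, ha, ha'⟩ := Finset.not_disjoint_iff.1 hAD
      exact (Cl_subset (h ▸ (mem_coe.2 ha') : a ∈ Cl ω (A : Set (V d))ᶜ v)) ha
    simp [this]
  have hsub : ∀ Z : Finset (V d), Z ⊆ A ∪ D → Ein ((A ∪ D : Finset (V d)) : Set (V d))ᶜ ⊆ Ein (Z : Set (V d))ᶜ := by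
    intro Z hZ e
    induction e with
    | _ a b =>
      rw [mk_mem_Ein, mk_mem_Ein]
      exact fun h => ⟨fun h' => h.1 (hZ h'), fun h' => h.2 (hZ h')⟩
  have hd1 : Disjoint (Ein univ \ Ein (A : Set (V d))ᶜ) (Ein (A : Set (V d))ᶜ \ Ein (D : Set (V d))ᶜ) :=
    Set.disjoint_left.2 fun e h h' => h.2 h'.1
  have hi := hP.indep_set (β := β) hd1 (measurableSet_Cl _ _ _) (measurableSet_Cl _ _ _)
    (Dep_Cl univ u (A : Set (V d))) (Dep_Cl (A : Set (V d))ᶜ v (D : Set (V d)))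
  have hdep := (Dep_Cl univ u (A : Set (V d))).inter (Dep_Cl (A : Set (V d))ᶜ v (D : Set (V d)))
  have hi2 := hP.indep_set_fun (β := β) (g := fun ω => fz n (sz ω ((A ∪ D : Finset (V d)) : Set (V d))ᶜ w))
    (T := Ein ((A ∪ D : Finset (V d)) : Set (V d))ᶜ) (Set.disjoint_left.2 ?_)
    ((measurableSet_Cl _ _ _).inter (measurableSet_Cl _ _ _)) (measurable_fsz n _ _) hdep
    (fun ω ω' h => by simp only; rw [sz_congr fun e he => h e he])
  swap
  · rintro e (h | h) h'
    · exact h.2 (hsub A Finset.subset_union_left h')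
    · exact h.2 (hsub D Finset.subset_union_right h')
  rw [hi] at hi2
  calc _ = fz n D.card * (P β EA * P β ED * ∫⁻ ω, fz n (sz ω ((A ∪ D : Finset (V d)) : Set (V d))ᶜ w) ∂P β) := by ring
    _ = ∫⁻ ω in EA ∩ ED, fz n D.card * fz n (sz ω ((A ∪ D : Finset (V d)) : Set (V d))ᶜ w) ∂P β := by
        rw [← hi2, lintegral_const_mul' _ _ (fz_ne_top _ _)]
    _ ≤ _ := by
        rw [inter_comm]
        refine setLIntegral_mono' ((measurableSet_Cl _ _ _).inter (measurableSet_Cl _ _ _)) fun ω hω => ?_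
        have hA : Cl ω univ u = A := hω.2
        have hD : Cl ω (A : Set (V d))ᶜ v = D := hω.1
        by_cases hv : v ∈ A
        · have : D = ∅ := by
            rw [Cl_empty (by simpa using hv)] at hD; exact_mod_cast hD.symm
          simp [this, fz0]
        have hDv : Cl ω univ v = D := by
          rw [← hD, ← hA, Cl_compl (Cl_closed u) (by rw [hA]; exact hv)]
        rw [sz_of_Cl hDv]
        refine mul_le_mul' le_rfl ?_
        by_cases hw : w ∈ A ∪ D
        · have hw' : w ∉ ((A ∪ D : Finset (V d)) : Set (V d))ᶜ := fun h => h (mem_coe.2 hw)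
          rw [sz, Cl_empty hw']; simp [fz0]
        have h1 : Cl ω ((A ∪ D : Finset (V d)) : Set (V d))ᶜ w = Cl ω univ w := by
          refine Cl_compl ?_ hw
          rw [Finset.coe_union, ← hA, ← hDv]
          rintro a (ha | ha) b hab
          · exact Or.inl (Cl_closed u a ha b hab)
          · exact Or.inr (Cl_closed v a ha b hab)
        rw [Finset.mem_union, not_or] at hw
        rw [indicator_of_mem, sz, h1, sz]
        refine ⟨fun h => hv ?_, fun h => hw.1 ?_, fun h => hw.2 ?_⟩
        · exact mem_coe.1 (hA ▸ h : v ∈ (A : Set (V d)))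
        · exact mem_coe.1 (hA ▸ h : w ∈ (A : Set (V d)))
        · exact mem_coe.1 (hDv ▸ h : w ∈ (D : Set (V d)))
end Upper2
section Surgery
variable {d : ℕ} {J : V d → V d → ℝ} {α c C : ℝ} {P : ℝ → Measure (Config d)} {β : ℝ}
variable {ω ω' : Config d} {S T : Set (V d)} {x y z : V d}
def Ac (n : ℕ) (x y : V d) : Set (Config d) := {ω | connIn ω univ x y ∧ sz ω univ x ≤ n}
def Om (n : ℕ) (a b t s x y : V d) : Set (Config d) :=
  Ac n t s ∩ (Ac n (t + a) x ∩ (Ndis t (t + a) (t + b) ∩ Ac n (t + b) y))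
open scoped Classical in
noncomputable def cls (a b t : V d) (ω : Config d) : Config d :=
  fun e => if e = s(t, t + a) ∨ e = s(t, t + b) then false else ω e
theorem measurableSet_Ac (n : ℕ) (x y : V d) : MeasurableSet (Ac n x y) :=
  (measurableSet_connIn _ _ _).inter (measurable_sz _ _ measurableSet_Iic)
theorem measurableSet_Om (n : ℕ) (a b t s x y : V d) : MeasurableSet (Om n a b t s x y) :=
  (measurableSet_Ac _ _ _).inter ((measurableSet_Ac _ _ _).inter
    ((measurableSet_Ndis _ _ _).inter (measurableSet_Ac _ _ _)))
theorem closed_sub {Z : Set (V d)} (h : ∀ a ∈ Z, ∀ b, adj ω a b → b ∈ Z) (hx : x ∈ Z)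
    (hy : connIn ω univ x y) : y ∈ Z := by
  by_contra hyZ
  obtain ⟨a, b, ha, -, hb, -, hab, -⟩ := last_exit Z hy hx hyZ
  exact hb (h a ha b hab)
theorem cls_le {a b t : V d} {e : Sym2 (V d)} (h : cls a b t ω e = true) : ω e = true := by
  unfold cls at h; split_ifs at h; exact h
theorem cls_adj {a b t u v : V d} (h : adj ω u v) (hu : u ≠ t) (hv : v ≠ t) :
    adj (cls a b t ω) u v := by
  refine ⟨h.1, ?_⟩
  unfold cls
  rw [if_neg, h.2]
  simp only [Sym2.eq_iff]
  tauto
theorem persist {a b t p q : V d} {L : Config d} (hL : ∀ e, L e = true → ω e = true)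
    (h : connIn L univ p q) (ht : ¬ connIn L univ p t) :
    connIn (cls a b t ω) univ p q := by
  refine (closed_sub (Z := {u | connIn L univ p u ∧ connIn (cls a b t ω) univ p u}) ?_
    ⟨connIn.refl trivial, connIn.refl trivial⟩ h).2
  rintro u ⟨h1, h2⟩ v huv
  have h3 := h1.trans (.step trivial trivial huv)
  refine ⟨h3, h2.trans (.step trivial trivial (cls_adj ⟨huv.1, hL _ huv.2⟩ ?_ ?_))⟩
  · rintro rfl; exact ht h1
  · rintro rfl; exact ht h3
variable {n : ℕ} {a b t t' : V d}
theorem surg_uniq (h1 : a + a ≠ 0) (h2 : b + b ≠ 0) (h3 : a + b ≠ 0) 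
    (ha : ω s(t, t + a) = true) (hb : ω s(t, t + b) = true)
    (ha' : ω s(t', t' + a) = true) (hb' : ω s(t', t' + b) = true)
    (h : cls a b t ω ∈ Om n a b t 0 x y) (h' : cls a b t' ω ∈ Om n a b t' 0 x y) : t = t' := by
  by_contra hne
  have a0 : a ≠ 0 := fun h => h1 (by simp [h])
  have b0 : b ≠ 0 := fun h => h2 (by simp [h])
  have key : ∀ t t' : V d, t ≠ t' → ω s(t, t + a) = true → ω s(t, t + b) = true →
      connIn (cls a b t' ω) univ t (t + a) ∧ connIn (cls a b t' ω) univ t (t + b) := by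
    intro t t' hne ha hb
    have aux : ∀ p q : V d, p + q ≠ 0 → s(t, t + p) ≠ s(t', t' + q) := by
      intro p q hpq h
      rcases Sym2.eq_iff.1 h with h | h
      · exact hne h.1
      · apply hpq
        have h5 := h.2
        rw [h.1, add_assoc] at h5
        rw [add_comm]; simpa using h5
    constructor
    · refine .step trivial trivial ⟨by simpa using a0, ?_⟩
      unfold cls; rw [if_neg (not_or.2 ⟨aux _ _ h1, aux _ _ h3⟩), ha]
    · refine .step trivial trivial ⟨by simpa using b0, ?_⟩
      unfold cls; rw [if_neg (not_or.2 ⟨aux _ _ (by rwa [add_comm]), aux _ _ h2⟩), hb]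
  obtain ⟨ka, kb⟩ := key t t' hne ha hb
  obtain ⟨⟨c0, -⟩, ⟨c1, -⟩, ⟨n1, n2, n3⟩, c2, -⟩ := h
  obtain ⟨⟨c0', -⟩, ⟨c1', -⟩, ⟨n1', n2', n3'⟩, c2', -⟩ := h'
  have hL : ∀ e, cls a b t ω e = true → ω e = true := fun e => cls_le
  by_cases q0 : connIn (cls a b t ω) univ t t'
  · have q1 : ¬ connIn (cls a b t ω) univ (t + a) t' := fun q1 => n1 (q0.trans q1.symm)
    have q2 : ¬ connIn (cls a b t ω) univ (t + b) t' := fun q2 => n2 (q0.trans q2.symm)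
    exact n3' ((c1'.trans (persist hL c1 q1).symm).trans
      ((ka.symm.trans kb).trans ((persist hL c2 q2).trans c2'.symm)))
  have r0 := persist (a := a) (b := b) hL c0 q0
  by_cases q1 : connIn (cls a b t ω) univ (t + a) t'
  · have q2 : ¬ connIn (cls a b t ω) univ (t + b) t' := fun q2 => n3 (q1.trans q2.symm)
    exact n2' ((c0'.trans r0.symm).trans (kb.trans ((persist hL c2 q2).trans c2'.symm)))
  · exact n1' ((c0'.trans r0.symm).trans (ka.trans ((persist hL c1 q1).trans c1'.symm)))
theorem surg_size (a0 : a ≠ 0) (b0 : b ≠ 0)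
    (ha : ω s(t, t + a) = true) (hb : ω s(t, t + b) = true)
    (h : cls a b t ω ∈ Om n a b t 0 x y) :
    connIn ω univ 0 x ∧ connIn ω univ 0 y ∧ sz ω univ 0 ≤ 3 * n := by
  have hL : ∀ e, cls a b t ω e = true → ω e = true := fun e => cls_le
  obtain ⟨⟨c0, s0⟩, ⟨c1, s1⟩, -, c2, s2⟩ := h
  have d0 := (c0.inc hL).symm
  have ea : connIn ω univ t (t + a) := .step trivial trivial ⟨by simpa using a0, ha⟩
  have eb : connIn ω univ t (t + b) := .step trivial trivial ⟨by simpa using b0, hb⟩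
  refine ⟨(d0.trans ea).trans (c1.inc hL), (d0.trans eb).trans (c2.inc hL), ?_⟩
  set L := cls a b t ω
  have hsub : Cl ω univ 0 ⊆ Cl L univ t ∪ (Cl L univ (t + a) ∪ Cl L univ (t + b)) := by
    intro v hv
    refine closed_sub ?_ (Or.inl c0) hv
    intro p hp q hpq
    by_cases hc : s(p, q) = s(t, t + a) ∨ s(p, q) = s(t, t + b)
    · rcases hc with hc | hc <;> rcases Sym2.eq_iff.1 hc with ⟨-, rfl⟩ | ⟨-, rfl⟩
      · exact Or.inr (Or.inl (connIn.refl trivial))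
      · exact Or.inl (connIn.refl trivial)
      · exact Or.inr (Or.inr (connIn.refl trivial))
      · exact Or.inl (connIn.refl trivial)
    · have hL' : adj L p q := ⟨hpq.1, by simp only [L, cls]; rw [if_neg hc]; exact hpq.2⟩
      rcases hp with hp | hp | hp
      · exact Or.inl (Cl_closed _ _ hp _ hL')
      · exact Or.inr (Or.inl (Cl_closed _ _ hp _ hL'))
      · exact Or.inr (Or.inr (Cl_closed _ _ hp _ hL'))
  have h1 : sz ω univ 0 ≤ sz L univ t + (sz L univ (t + a) + sz L univ (t + b)) := by
    unfold sz
    have := (encard_le_encard hsub).trans ((encard_union_le _ _).trans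
      (add_le_add le_rfl (encard_union_le _ _)))
    exact_mod_cast this
  refine h1.trans ((add_le_add s0 (add_le_add s1 s2)).trans_eq (by ring))
theorem edge_transl (hJ : KernelHyp d J α c C) (t a : V d) :
    edgeProb J β s(t, t + a) = edgeProb J β s(0, a) := by
  rw [edgeProb_eq, edgeProb_eq, hJ.wt_mk, hJ.wt_mk, ← hJ.transInv 0 a t, zero_add, add_comm a t]
theorem surg_prob (hJ : KernelHyp d J α c C) (hP : IsLRP J P) (a0 : a ≠ 0) (b0 : b ≠ 0) (hab : a ≠ b)
    (n : ℕ) (t x y : V d) :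
    edgeProb J β s(0, a) * edgeProb J β s(0, b) * P β (Om n a b t 0 x y) ≤
    P β ({ω | ω s(t, t + a) = true} ∩ {ω | ω s(t, t + b) = true} ∩ {ω | cls a b t ω ∈ Om n a b t 0 x y}) := by
  have hm : Measurable (cls a b t) := measurable_pi_iff.2 fun e => by
    unfold cls; split_ifs
    · exact measurable_const
    · exact measurable_pi_apply e
  have hne : s(t, t + a) ≠ s(t, t + b) := by
    intro h
    rcases Sym2.eq_iff.1 h with h | h
    · exact hab (by simpa using h.2)
    · exact b0 (by simpa using h.1.symm)
  have hd := (dep_open s(t, t + a)).inter (dep_open (d := d) s(t, t + b))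
  rw [hP.indep_set (T := ({s(t, t + a)} ∪ {s(t, t + b)})ᶜ) disjoint_compl_right
    ((measurableSet_open _).inter (measurableSet_open _)) (show MeasurableSet {ω | cls a b t ω ∈ Om n a b t 0 x y} from hm (measurableSet_Om _ _ _ _ _ _ _)) hd,
    hP.indep_set (Set.disjoint_singleton.2 hne) (measurableSet_open _) (measurableSet_open _) (dep_open _) (dep_open _),
    hP.open_eq, hP.open_eq, edge_transl hJ, edge_transl hJ]
  · refine mul_le_mul' le_rfl (measure_mono fun ω hω => ?_)
    have : cls a b t ω = ω := by
      ext e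
      unfold cls
      split_ifs with h
      · symm
        rw [Bool.eq_false_iff]
        intro he
        obtain ⟨-, -, ⟨n1, n2, -⟩, -⟩ := hω
        rcases h with rfl | rfl
        · exact n1 (.step trivial trivial ⟨by simpa using a0, he⟩)
        · exact n2 (.step trivial trivial ⟨by simpa using b0, he⟩)
      · rfl
    show cls a b t ω ∈ Om n a b t 0 x y
    rw [this]; exact hω
  · intro ω ω' h
    have : cls a b t ω = cls a b t ω' := by
      ext e
      unfold cls
      split_ifs with he
      · rfl
      · exact h e (by simpa [and_comm] using he)
    show cls a b t ω ∈ Om n a b t 0 x y ↔ cls a b t ω' ∈ Om n a b t 0 x y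
    rw [this]
theorem ind_mul (A B : Set (Config d)) (ω : Config d) : (A ∩ B).indicator (fun _ => (1:ℝ≥0∞)) ω =
    A.indicator (fun _ => 1) ω * B.indicator (fun _ => 1) ω := by
  by_cases h : ω ∈ A <;> by_cases h' : ω ∈ B <;> simp [h, h']
theorem fz_eq_tsum (n : ℕ) (x : V d) : fz n (sz ω univ x) = ∑' y, (Ac n x y).indicator (fun _ => 1) ω := by
  unfold fz
  split_ifs with h
  · rw [sz_eq_tsum]
    refine tsum_congr fun y => ?_
    by_cases hc : connIn ω univ x y
    · rw [indicator_of_mem (by exact hc), indicator_of_mem (by exact ⟨hc, h⟩)]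
    · rw [indicator_of_notMem (by exact hc), indicator_of_notMem (fun h => hc h.1)]
  · exact (tsum_eq_zero.2 fun y => indicator_of_notMem (fun hh => h hh.2) _).symm
theorem univ_img (w : V d) : (fun x => x + w) '' (univ : Set (V d)) = univ := by
  rw [Set.image_univ, Set.range_eq_univ.2 (fun y => ⟨y - w, sub_add_cancel y w⟩)]
theorem Om_shift (hJ : KernelHyp d J α c C) (hP : IsLRP J P) (hβ : 0 ≤ β) (n : ℕ) (a b s x y : V d) :
    P β (Om n a b 0 s x y) = P β (Om n a b (-s) 0 (x - s) (y - s)) := by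
  have := hP.map_shift hJ hβ (-s)
  conv_lhs => rw [← this]
  rw [Measure.map_apply (measurable_shift _) (measurableSet_Om _ _ _ _ _ _ _)]
  congr 1
  ext ω
  simp only [Om, Ac, Ndis, Set.mem_preimage, mem_inter_iff, mem_ofPred_eq, connIn_shift, sz_shift, univ_img]
  simp only [zero_add, add_neg_cancel, sub_eq_add_neg, add_comm (-s)]
theorem surg_bound (hJ : KernelHyp d J α c C) (hP : IsLRP J P) (hβ : 0 ≤ β)
    (h1 : a + a ≠ 0) (h2 : b + b ≠ 0) (h3 : a + b ≠ 0) (hab : a ≠ b) (n : ℕ) :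
    edgeProb J β s(0, a) * edgeProb J β s(0, b) * T3 P β n 0 a b ≤ 9 * n * Fn P β univ 0 n := by
  have a0 : a ≠ 0 := fun h => h1 (by simp [h])
  have b0 : b ≠ 0 := fun h => h2 (by simp [h])
  have hT : T3 P β n 0 a b ≤ ∑' t, ∑' x, ∑' y, P β (Om n a b t 0 x y) := by
    refine (T3_upper hP n 0 a b).trans_eq ?_
    have e1 : ∀ ω : Config d, fz n (sz ω univ 0) * (fz n (sz ω univ a) *
      (Ndis 0 a b).indicator (fun ω => fz n (sz ω univ b)) ω) =
        ∑' s, ∑' x, ∑' y, (Om n a b 0 s x y).indicator (fun _ => 1) ω := by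
      intro ω
      have : (Ndis 0 a b).indicator (fun ω => fz n (sz ω univ b)) ω =
        (Ndis 0 a b).indicator (fun _ => 1) ω * fz n (sz ω univ b) := by
        by_cases h : ω ∈ Ndis 0 a b <;> simp [h]
      rw [this]
      simp only [Om, ind_mul, zero_add, ENNReal.tsum_mul_left, ENNReal.tsum_mul_right, ← fz_eq_tsum]
    simp_rw [e1]
    have hm : ∀ s x y, Measurable fun ω => (Om n a b 0 s x y).indicator (fun _ => (1:ℝ≥0∞)) ω :=
      fun s x y => measurable_const.indicator (measurableSet_Om _ _ _ _ _ _ _)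
    rw [lintegral_tsum fun s => (Measurable.ennreal_tsum fun x => Measurable.ennreal_tsum fun y => hm s x y).aemeasurable]
    conv_rhs => rw [← (Equiv.neg (V d)).tsum_eq]
    refine tsum_congr fun s => ?_
    rw [lintegral_tsum fun x => (Measurable.ennreal_tsum fun y => hm s x y).aemeasurable]
    conv_rhs => rw [← (Equiv.subRight s).tsum_eq]
    refine tsum_congr fun x => ?_
    rw [lintegral_tsum fun y => (hm s x y).aemeasurable]
    conv_rhs => rw [← (Equiv.subRight s).tsum_eq]
    refine tsum_congr fun y => ?_
    rw [lintegral_indicator_const (measurableSet_Om _ _ _ _ _ _ _), one_mul, Om_shift hJ hP hβ]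
    rfl
  let W : V d → V d → V d → Set (Config d) := fun t x y =>
    {ω | ω s(t, t + a) = true} ∩ {ω | ω s(t, t + b) = true} ∩ {ω | cls a b t ω ∈ Om n a b t 0 x y}
  have hW : ∀ t x y, MeasurableSet (W t x y) := by
    intro t x y
    refine ((measurableSet_open _).inter (measurableSet_open _)).inter ?_
    refine (measurable_pi_iff.2 fun e => ?_ : Measurable (cls a b t)) (measurableSet_Om _ _ _ _ _ _ _)
    unfold cls; split_ifs
    · exact measurable_const
    · exact measurable_pi_apply e
  have hU : ∀ x y, ∑' t, P β (W t x y) ≤ P β (Ac (3 * n) 0 x ∩ Ac (3 * n) 0 y) := by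
    intro x y
    rw [← measure_iUnion _ fun t => hW t x y]
    · refine measure_mono (iUnion_subset fun t ω hω => ?_)
      obtain ⟨p, q, r⟩ := surg_size a0 b0 hω.1.1 hω.1.2 hω.2
      exact ⟨⟨p, by push_cast; exact r⟩, ⟨q, by push_cast; exact r⟩⟩
    · intro t t' hne
      exact Set.disjoint_left.2 fun ω h h' => hne (surg_uniq h1 h2 h3 h.1.1 h.1.2 h'.1.1 h'.1.2 h.2 h'.2)
  have hm : ∀ x y : V d, Measurable fun ω => (Ac (3 * n) 0 y ∩ Ac (3 * n) 0 x).indicator (fun _ => (1:ℝ≥0∞)) ω :=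
    fun x y => measurable_const.indicator ((measurableSet_Ac (3 * n) 0 y).inter (measurableSet_Ac (3 * n) 0 x))
  calc _ ≤ ∑' t, ∑' x, ∑' y, P β (W t x y) := by
        refine (mul_le_mul' le_rfl hT).trans ?_
        simp_rw [← ENNReal.tsum_mul_left]
        exact tsum_le_tsum fun t => tsum_le_tsum fun x => tsum_le_tsum fun y =>
          surg_prob hJ hP a0 b0 hab n t x y
    _ ≤ ∑' x, ∑' y, P β (Ac (3 * n) 0 x ∩ Ac (3 * n) 0 y) := by
        rw [tsum_comm]
        refine tsum_le_tsum fun x => ?_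
        rw [tsum_comm]
        exact tsum_le_tsum fun y => hU x y
    _ = ∫⁻ ω, fz (3 * n) (sz ω univ 0) * fz (3 * n) (sz ω univ 0) ∂P β := by
        simp_rw [fz_eq_tsum, ← ENNReal.tsum_mul_left, ← ENNReal.tsum_mul_right, ← ind_mul]
        rw [lintegral_tsum fun x => (Measurable.ennreal_tsum fun y => hm x y).aemeasurable]
        refine tsum_congr fun x => ?_
        rw [lintegral_tsum fun y => (hm x y).aemeasurable]
        refine tsum_congr fun y => ?_
        rw [lintegral_indicator_const ((measurableSet_Ac _ _ _).inter (measurableSet_Ac _ _ _)), one_mul, inter_comm]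
    _ ≤ ∫⁻ ω, 9 * n * min (sz ω univ 0) n ∂P β := by
        refine lintegral_mono fun ω => ?_
        have h1 := fz_le (3 * n) (sz ω univ 0)
        have h2 : min (sz ω univ 0) ((3 * n : ℕ) : ℝ≥0∞) ≤ 3 * min (sz ω univ 0) n := by
          push_cast
          rcases le_total (sz ω univ 0) n with h | h
          · rw [min_eq_left h]; exact (min_le_left _ _).trans (le_mul_of_one_le_left zero_le (by norm_num))
          · rw [min_eq_right h]; exact min_le_right _ _
        refine (mul_le_mul' (h1.trans (min_le_right _ _)) (h1.trans h2)).trans_eq ?_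
        push_cast; ring
    _ = _ := by
        rw [lintegral_const_mul _ ((measurable_sz _ _).min measurable_const)]; rfl
end Surgery
section UpF
variable {d : ℕ} {J : V d → V d → ℝ} {α c C : ℝ} {P : ℝ → Measure (Config d)} {β : ℝ}
variable {ω ω' : Config d} {S T : Set (V d)} {x y z : V d}
theorem real_F {f g q : ℕ → ℝ} {K M : ℝ} (hK : 0 < K) (h1 : ∀ n, f (n+1) = f n + q n)
    (h2 : ∀ n, f n = g n + n * q n) (hf : ∀ n, 0 ≤ f n) (hM : ∀ n, f n ≤ M)
    (hg : ∀ n, f n ≤ 2 * g n → f n ^ 2 ≤ K * n) {n : ℕ} (hn : 1 ≤ n) : f n ^ 2 ≤ K * n := by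
  by_contra hc
  push Not at hc
  have key : ∀ m, n ≤ m → K * m < f m ^ 2 := by
    intro m hm
    induction m, hm using Nat.le_induction with
    | base => exact hc
    | succ m hm ih =>
      have hm0 : (0:ℝ) < m := by exact_mod_cast hn.trans hm
      have hb : 2 * g m < f m := by
        by_contra hb; push Not at hb
        exact absurd (hg m hb) (not_le.2 ih)
      have hq : f m ≤ 2 * (m * q m) := by have := h2 m; linarith
      have hq0 : 0 ≤ q m := by
        by_contra hq0; push Not at hq0
        have := mul_neg_of_pos_of_neg hm0 hq0
        have := hf m; nlinarith
      have h3 : f m * f m ≤ 2 * (m * q m) * f m := mul_le_mul_of_nonneg_right hq (hf m)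
      have h4 : f m ^ 2 / m ≤ 2 * (f m * q m) := by
        rw [div_le_iff₀ hm0]; nlinarith
      have h5 : K < f m ^ 2 / m := by rw [lt_div_iff₀ hm0]; exact ih
      rw [h1 m]; push_cast
      nlinarith [sq_nonneg (q m)]
  obtain ⟨m, hm⟩ := exists_nat_gt (M ^ 2 / K)
  have h6 := key (max n m) (le_max_left _ _)
  have h7 : f (max n m) ^ 2 ≤ M ^ 2 := by
    have := hM (max n m); have := hf (max n m); gcongr
  have h8 : (m:ℝ) ≤ ((max n m : ℕ) : ℝ) := by exact_mod_cast le_max_right n m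
  rw [div_lt_iff₀ hK] at hm
  nlinarith
theorem Fn_split (hP : IsLRP J P) (n : ℕ) : Fn P β univ 0 n =
    ∫⁻ ω, fz n (sz ω univ (0 : V d)) ∂P β +
      n * P β {ω | ((n + 1 : ℕ) : ℝ≥0∞) ≤ sz ω univ (0 : V d)} := by
  have hm := measurableSet_sz ((n + 1 : ℕ) : ℝ≥0∞) univ (0 : V d)
  have h : ∀ ω : Config d, min (sz ω univ 0) (n:ℝ≥0∞) = fz n (sz ω univ 0) +
      indicator {ω | ((n + 1 : ℕ) : ℝ≥0∞) ≤ sz ω univ (0 : V d)} (fun _ => (n:ℝ≥0∞)) ω := by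
    intro ω
    have h0 : sz ω univ (0 : V d) ≤ n ↔ ¬ ((n + 1 : ℕ) : ℝ≥0∞) ≤ sz ω univ (0 : V d) := by
      by_cases hf : (Cl ω univ (0 : V d)).Finite
      · rw [sz_of_Cl (D := hf.toFinset) (by simp)]
        norm_cast; omega
      · rw [sz_top hf]; simp
    by_cases hs : sz ω univ (0 : V d) ≤ n
    · rw [indicator_of_notMem (by exact h0.1 hs), add_zero, min_eq_left hs, fz, if_pos hs]
    · have h3 : ((n + 1 : ℕ) : ℝ≥0∞) ≤ sz ω univ (0 : V d) := by
        by_contra h4; exact hs (h0.2 h4)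
      rw [indicator_of_mem (by exact h3), fz, if_neg hs, zero_add, min_eq_right (not_le.1 hs).le]
  rw [Fn]
  simp_rw [h]
  rw [lintegral_add_left (measurable_fsz n univ 0), lintegral_indicator_const hm]
theorem Fn_le_ch (n : ℕ) : Fn P β univ 0 n ≤ ch P β := by
  rw [ch, ← lintegral_sz]
  exact lintegral_mono fun ω => min_le_left _ _
theorem edgeProb_mono (hJ : KernelHyp d J α c C) {β' : ℝ} (h : β ≤ β') (e : Sym2 (V d)) :
    edgeProb J β e ≤ edgeProb J β' e := by
  rw [edgeProb_eq, edgeProb_eq]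
  refine ofReal_le_ofReal (sub_le_sub_left (exp_le_exp.2 ?_) _)
  have := mul_le_mul_of_nonneg_right h (hJ.wt_nonneg e)
  linarith
theorem edgeProb_pos (hJ : KernelHyp d J α c C) (hβ : 0 < β) (h : x ≠ y) :
    0 < edgeProb J β s(x, y) := by
  rw [edgeProb_eq, hJ.wt_mk, ofReal_pos, sub_pos, Real.exp_lt_one_iff]
  have h1 : 0 < normInf (x - y) := by
    rw [Nat.pos_iff_ne_zero]; intro h0
    have h2 := (normInf_le_iff (x := x - y) (r := 0)).1 h0.le
    refine h (funext fun i => ?_)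
    have := h2 i
    simp at this; omega
  have : 0 < J x y := lt_of_lt_of_le (mul_pos hJ.c_pos (Real.rpow_pos_of_pos (by exact_mod_cast h1) _)) (hJ.lower x y h)
  have := mul_pos hβ this
  linarith
theorem F_upper (hJ : KernelHyp d J α c C) (hP : IsLRP J P) {bT : ℝ} (hT : 0 < bT)
    (hlt : ∀ β, 0 ≤ β → β < bT → ch P β ≠ ⊤) (hs : ∑' x, sg P bT x ≠ ⊤) :
    ∃ K > 0, ∀ n : ℕ, Fn P bT univ 0 n ≤ ofReal (K * sqrt n) := by
  obtain ⟨ρ, hρ⟩ := tri_small hJ hP hT.le hs (show (0:ℝ) < 1/48 by norm_num)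
  let i0 : Fin d := ⟨0, hJ.d_pos⟩
  set a : V d := fun _ => (ρ:ℤ) + 1 with ha
  set b : V d := fun _ => 2 * (ρ:ℤ) + 2 with hb
  have big : ∀ {w : V d}, (ρ:ℤ) < |w i0| → ρ < normInf w := by
    intro w hw; by_contra hc
    exact absurd (normInf_le_iff.1 (not_lt.1 hc) i0) (not_le.2 hw)
  have d1 : ρ < normInf (a - 0) := big (by simp only [ha, Pi.sub_apply, Pi.zero_apply]; rw [abs_of_nonneg] <;> omega)
  have d2 : ρ < normInf (b - 0) := big (by simp only [hb, Pi.sub_apply, Pi.zero_apply]; rw [abs_of_nonneg] <;> omega)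
  have d3 : ρ < normInf (b - a) := big (by simp only [ha, hb, Pi.sub_apply]; rw [abs_of_nonneg] <;> omega)
  have ne1 : ∀ {u v : V d}, u i0 ≠ v i0 → u ≠ v := fun h e => h (by rw [e])
  set p0 := edgeProb J (bT/2) s(0,a) * edgeProb J (bT/2) s(0,b) with hp0
  have hp0pos : 0 < p0 := ENNReal.mul_pos
    (edgeProb_pos hJ (by linarith) (ne1 (by simp [ha]; omega))).ne'
    (edgeProb_pos hJ (by linarith) (ne1 (by simp [hb]; omega))).ne'
  have hp01 : p0 ≤ 1 := mul_le_one' (edgeProb_le_one _) (edgeProb_le_one _)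
  have hp0t : p0 ≠ ⊤ := ne_top_of_le_ne_top one_ne_top hp01
  set p := p0.toReal with hp
  have hppos : 0 < p := toReal_pos hp0pos.ne' hp0t
  have hK : 0 < 144 / p := by positivity
  have key : ∀ β, bT/2 ≤ β → β < bT → ∀ n : ℕ, 1 ≤ n → Fn P β univ 0 n ≤ ofReal (sqrt (144/p) * sqrt n) := by
    intro β hβ1 hβ2 n hn
    have hβ : 0 ≤ β := by linarith
    have := hP.prob β
    have hch := hlt β hβ hβ2
    have hFt : ∀ n, Fn P β univ (0 : V d) n ≠ ⊤ := fun n => ne_top_of_le_ne_top hch (Fn_le_ch n)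
    have hGF : ∀ n, ∫⁻ ω, fz n (sz ω univ (0 : V d)) ∂P β ≤ Fn P β univ 0 n := fun n => g_le _ _ _
    have hGt : ∀ n, ∫⁻ ω, fz n (sz ω univ (0 : V d)) ∂P β ≠ ⊤ := fun n => ne_top_of_le_ne_top (hFt n) (hGF n)
    have htri : ∀ u v : V d, ρ < normInf (v - u) → tri P β u v ≤ ofReal (1/48) := by
      intro u v huv
      refine le_trans ?_ (hρ u v huv)
      rw [tri]
      refine tsum_le_tsum fun w => tsum_le_tsum fun a => ?_
      exact mul_le_mul' (mul_le_mul' (hP.tp_beta_mono hJ hβ hβ2.le) (hP.tp_beta_mono hJ hβ hβ2.le)) (hP.tp_beta_mono hJ hβ hβ2.le)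
    have main := real_F (f := fun n => (Fn P β univ (0 : V d) n).toReal)
      (g := fun n => (∫⁻ ω, fz n (sz ω univ (0 : V d)) ∂P β).toReal)
      (q := fun n => (P β {ω | ((n + 1 : ℕ) : ℝ≥0∞) ≤ sz ω univ (0 : V d)}).toReal)
      (K := 144/p) (M := (ch P β).toReal) hK
      (fun n => by
        rw [← toReal_add (hFt n) (measure_ne_top _ _), Fn_eq, Fn_eq, Finset.sum_range_succ])
      (fun n => by
        rw [Fn_split hP n, toReal_add (hGt n) (mul_ne_top (natCast_ne_top n) (measure_ne_top _ _)),
          toReal_mul, ENNReal.toReal_natCast])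
      (fun n => toReal_nonneg) (fun n => toReal_mono hch (Fn_le_ch n))
      (fun m hm => by
        have e1 := surg_bound hJ hP hβ (a := a) (b := b) (ne1 (by simp [ha]; omega)) (ne1 (by simp [hb]; omega))
          (ne1 (by simp [ha, hb]; omega)) (ne1 (by simp [ha, hb]; omega)) m
        have e2 := T3_lower hJ hP hβ m 0 a b rfl rfl
        have e3 : p0 ≤ edgeProb J β s(0,a) * edgeProb J β s(0,b) :=
          mul_le_mul' (edgeProb_mono hJ hβ1 _) (edgeProb_mono hJ hβ1 _)
        set G := ∫⁻ ω, fz m (sz ω univ (0 : V d)) ∂P β with hGd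
        set F := Fn P β univ (0 : V d) m with hFd
        have e4 : tri P β 0 a + tri P β 0 b + tri P β a b ≤ ofReal (1/16) := by
          refine (add_le_add (add_le_add (htri _ _ d1) (htri _ _ d2)) (htri _ _ d3)).trans ?_
          rw [← ofReal_add (by norm_num) (by norm_num), ← ofReal_add (by norm_num) (by norm_num)]
          exact ofReal_le_ofReal (by norm_num)
        have e5 : p0 * (G * (G * G)) ≤ 9 * m * F + p0 * (F ^ 3 * ofReal (1/16)) := by
          refine (mul_le_mul' le_rfl e2).trans ?_
          rw [mul_add]
          exact add_le_add ((mul_le_mul' e3 le_rfl).trans e1) (mul_le_mul' le_rfl (mul_le_mul' le_rfl e4))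
        have t1 : 9 * (m:ℝ≥0∞) * F ≠ ⊤ := mul_ne_top (mul_ne_top (by norm_num) (natCast_ne_top m)) (hFt m)
        have t2 : p0 * (F ^ 3 * ofReal (1/16)) ≠ ⊤ :=
          mul_ne_top hp0t (mul_ne_top (ENNReal.pow_ne_top (hFt m)) ofReal_ne_top)
        have e6 := toReal_mono (add_ne_top.2 ⟨t1, t2⟩) e5
        rw [toReal_add t1 t2] at e6
        simp only [toReal_mul, ENNReal.toReal_pow, ENNReal.toReal_natCast, ENNReal.toReal_ofNat,
          ENNReal.toReal_ofReal (show (0:ℝ) ≤ 1/16 by norm_num)] at e6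
        change F.toReal ≤ 2 * G.toReal at hm
        change F.toReal ^ 2 ≤ 144 / p * m
        have hF0 : 0 ≤ F.toReal := toReal_nonneg
        generalize F.toReal = f at *
        generalize G.toReal = g at *
        rw [← hp] at e6
        rcases hF0.eq_or_lt with h0 | h0
        · rw [← h0, zero_pow two_ne_zero]; positivity
        have h3 : (f/2)^3 ≤ g^3 := by have : f/2 ≤ g := by linarith
                                      gcongr
        have h4 : p * (f/2)^3 ≤ p * g^3 := mul_le_mul_of_nonneg_left h3 hppos.le
        have h5 : f * (p * f^2) ≤ f * (144 * m) := by nlinarith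
        have h6 := le_of_mul_le_mul_left h5 h0
        rw [div_mul_eq_mul_div, le_div_iff₀ hppos]; linarith)
      hn
    rw [← sqrt_mul hK.le, ← ofReal_toReal (hFt n)]
    exact ofReal_le_ofReal (Real.le_sqrt_of_sq_le main)
  refine ⟨sqrt (144/p), Real.sqrt_pos.2 hK, fun n => ?_⟩
  rcases Nat.eq_zero_or_pos n with rfl | hn
  · simp [Fn]
  rw [Fn_eq]
  refine hP.left_lim hJ (range n) _ (fun k => Appr_sz (k+1) 0) hT fun β hβ hβT => ?_
  refine le_trans ?_ (key (max β (bT/2)) (le_max_right _ _) (max_lt hβT (by linarith)) n hn)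
  rw [Fn_eq]
  exact sum_le_sum fun k _ => hP.mono hJ hβ (le_max_left _ _) (Inc_sz _ _ _) (measurableSet_sz _ _ _)
end UpF
section LowT
variable {d : ℕ} {J : V d → V d → ℝ} {α c C : ℝ} {P : ℝ → Measure (Config d)} {β : ℝ}
variable {ω ω' : Config d} {S T : Set (V d)} {x y z : V d}
theorem ch_le_Xr {M : ℝ≥0∞} (h : ∀ r, Xr P β r ≤ M) : ch P β ≤ M := by
  rw [ch, tsum_eq_iSup_sum]
  refine iSup_le fun B => ?_
  have hm : ∀ y : V d, Monotone fun n : ℕ => {ω | connIn ω (Bx d n) 0 y} :=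
    fun y m n hmn ω h => connIn.mono h (Bx_mono hmn)
  have h1 : ∀ y, tp P β univ 0 y = ⨆ n : ℕ, tp P β (Bx d n) 0 y := fun y => by
    simp only [tp]
    rw [← (hm y).measure_iUnion]
    congr 1; ext ω; simp [conn_iff_Bx]
  simp only [h1]
  rw [finsetSum_iSup_of_monotone (f := fun y (n : ℕ) => tp P β (Bx d n) 0 y) (fun y m n hmn => measure_mono (hm y hmn))]
  refine iSup_le fun n => (sum_le_tsum B).trans ?_
  rw [← lintegral_sz]
  exact (le_Xr (zero_mem_Bx n)).trans (h n)
theorem ch_crit (hJ : KernelHyp d J α c C) (hP : IsLRP J P) {bT : ℝ} (hT : 0 < bT)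
    (hphi : ∀ S : Finset (V d), 0 ∈ S → 1 ≤ phi J P bT S) : ch P bT = ⊤ := by
  classical
  by_contra hne
  set f : V d → ℝ≥0∞ := fun v => ∑' u, tp P bT univ 0 u * ofReal (bT * J u v) with hf
  have hs : ∑' v, f v ≠ ⊤ := by
    simp only [hf]
    rw [tsum_comm]
    simp only [ENNReal.tsum_mul_left, hJ.tsum_J hT.le]
    rw [ENNReal.tsum_mul_right]
    exact mul_ne_top hne ofReal_ne_top
  have ht := ENNReal.tendsto_tsum_compl_atTop_zero hs
  have h1 := (ht.eventually_lt_const (show (0:ℝ≥0∞) < 1 by norm_num)).and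
    (Filter.eventually_ge_atTop ({0} : Finset (V d)))
  obtain ⟨S, hS, h0⟩ := h1.exists
  refine absurd (hphi S (h0 (by simp))) (not_le.2 (lt_of_le_of_lt ?_ hS))
  have h2 := tsum_subtype (α := ℝ≥0∞) {v : V d | v ∉ S} f
  refine le_trans ?_ h2.symm.le
  rw [phi, tsum_comm]
  refine tsum_le_tsum fun v => ?_
  by_cases hv : v ∈ S
  · simp [kout, hv]
  · rw [indicator_of_mem (by exact hv)]
    refine tsum_le_tsum fun u => ?_
    rw [kout, if_neg (by simpa using hv)]
    exact mul_le_mul' (measure_mono fun ω h => connIn.mono h (subset_univ _)) le_rfl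
theorem F_lower (hJ : KernelHyp d J α c C) (hP : IsLRP J P) {bT : ℝ} (hT : 0 < bT)
    (hphi : ∀ S : Finset (V d), 0 ∈ S → 1 ≤ phi J P bT S) {n : ℕ} (hn : 16 ≤ n) :
    ofReal (3/8 * sqrt n) ≤ Fn P bT univ 0 n := by
  set s : ℝ := sqrt n / 2 with hs
  have hn' : (16:ℝ) ≤ n := by exact_mod_cast hn
  have hsq : sqrt n ^ 2 = n := sq_sqrt (by linarith)
  have hs4 : 4 ≤ sqrt n := Real.le_sqrt_of_sq_le (by norm_num; linarith)
  obtain ⟨r, hr⟩ : ∃ r, ofReal s < Xr P bT r := by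
    by_contra hc; push Not at hc
    have := ch_le_Xr hc
    rw [ch_crit hJ hP hT hphi, top_le_iff] at this
    exact ofReal_ne_top this
  have h0 : Xr P 0 r ≤ 2 := (Xr_le_ch hJ hP le_rfl r).trans
    (hP.ch_small hJ le_rfl (by have := hJ.Jn_nonneg; positivity))
  have hfin : ∀ β, 0 ≤ β → Xr P β r ≠ ⊤ := fun β hβ =>
    ne_top_of_le_ne_top (add_ne_top.2 ⟨ne_top_of_le_ne_top (by norm_num) h0, ofReal_ne_top⟩)
      (Xr_lip hJ hP le_rfl hβ r)
  have hL := LX_nonneg hJ r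
  have hlip : LipschitzOnWith (LX J r).toNNReal (fun β => (Xr P β r).toReal) (Set.Icc 0 bT) := by
    refine LipschitzOnWith.of_le_add_mul _ fun x hx y hy => ?_
    simp only [Real.coe_toNNReal _ hL]
    rcases le_total x y with h | h
    · have := toReal_mono (hfin y hy.1) (Xr_mono hJ hP hx.1 h r)
      have := mul_nonneg hL (dist_nonneg (x := x) (y := y))
      linarith
    · have e := toReal_mono (add_ne_top.2 ⟨hfin y hy.1, ofReal_ne_top⟩) (Xr_lip hJ hP hy.1 h r)
      rw [toReal_add (hfin y hy.1) ofReal_ne_top,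
        ENNReal.toReal_ofReal (mul_nonneg (sub_nonneg.2 h) hL)] at e
      rw [Real.dist_eq, abs_of_nonneg (sub_nonneg.2 h), mul_comm]
      exact e
  obtain ⟨β, hβ, hX⟩ := intermediate_value_Icc hT.le hlip.continuousOn (show s ∈ Set.Icc _ _ from
    ⟨(toReal_mono (by norm_num) h0).trans (by simp; linarith),
      (ENNReal.ofReal_le_iff_le_toReal (hfin bT hT.le)).1 hr.le⟩)
  have hX' : Xr P β r = ofReal s := by rw [← hX, ofReal_toReal (hfin β hβ.1)]
  obtain ⟨z, hz, hz'⟩ := Finset.exists_mem_eq_sup (Bx d r) ⟨0, zero_mem_Bx r⟩ fun z => ∫⁻ ω, sz ω (Bx d r) z ∂P β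
  have hz2 : ∫⁻ ω, sz ω (Bx d r) z ∂P β = ofReal s := by rw [← hX', Xr]; exact hz'.symm
  have h2 := hP.sq_le (β := β) (Bx d r) (X := ofReal s) (fun w hw => hX' ▸ le_Xr hw) hz
  have h3 : n * ofReal s ≤ n * Fn P β (Bx d r) z n + ofReal s ^ 3 := by
    refine le_trans ?_ (add_le_add_right h2 _)
    rw [← hz2, Fn, ← lintegral_const_mul _ (measurable_sz _ _), ← lintegral_const_mul _ ((measurable_sz _ _).min measurable_const),
      ← lintegral_add_right (g := fun ω => sz ω (Bx d r) z * sz ω (Bx d r) z) _ ((measurable_sz _ _).mul (measurable_sz _ _))]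
    refine lintegral_mono fun ω => ?_
    rcases le_total (sz ω (Bx d r) z) n with h | h
    · simp only [min_eq_left h]; exact le_self_add
    · exact le_add_left (mul_le_mul' h le_rfl)
  have h4 : Fn P β (Bx d r) z n ≤ Fn P bT univ 0 n := by
    refine (Fn_mono (subset_univ _) n).trans ?_
    rw [Fn_shift hJ hP hβ.1, Fn_eq, Fn_eq]
    exact sum_le_sum fun k _ => hP.mono hJ hβ.1 hβ.2 (Inc_sz _ _ _) (measurableSet_sz _ _ _)
  refine le_trans ?_ h4
  by_cases hFt : Fn P β (Bx d r) z n = ⊤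
  · rw [hFt]; exact le_top
  rw [ENNReal.ofReal_le_iff_le_toReal hFt]
  have t1 : (n:ℝ≥0∞) * Fn P β (Bx d r) z n ≠ ⊤ := mul_ne_top (natCast_ne_top n) hFt
  have t2 : ofReal s ^ 3 ≠ ⊤ := ENNReal.pow_ne_top ofReal_ne_top
  have h5 := toReal_mono (add_ne_top.2 ⟨t1, t2⟩) h3
  rw [toReal_add t1 t2, toReal_mul, toReal_mul, ENNReal.toReal_pow,
    ENNReal.toReal_ofReal (by positivity), ENNReal.toReal_natCast, hs] at h5
  generalize (Fn P β (Bx d r) z n).toReal = F at *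
  have e3 : (sqrt n / 2) ^ 3 = n * (sqrt n / 8) := by
    rw [← hsq, Real.sqrt_sq (sqrt_nonneg _)]; ring
  rw [e3, ← mul_add] at h5
  have := le_of_mul_le_mul_left h5 (by linarith)
  linarith
theorem final_tail (hJ : KernelHyp d J α c C) (hP : IsLRP J P) {bT K : ℝ} (hK : 0 < K)
    (hU : ∀ n : ℕ, Fn P bT univ 0 n ≤ ofReal (K * sqrt n))
    (hL : ∀ n : ℕ, 16 ≤ n → ofReal (3/8 * sqrt n) ≤ Fn P bT univ 0 n) :
    ∃ c₁ C₁ : ℝ, 0 < c₁ ∧ c₁ ≤ C₁ ∧ ∀ n : ℕ, 1 ≤ n →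
      ofReal (c₁ * (n : ℝ) ^ (-(1/2) : ℝ)) ≤ P bT {ω | (n : ℝ≥0∞) ≤ sz ω univ (0 : V d)} ∧
      P bT {ω | (n : ℝ≥0∞) ≤ sz ω univ (0 : V d)} ≤ ofReal (C₁ * (n : ℝ) ^ (-(1/2) : ℝ)) := by
  haveI := hP.prob bT
  obtain ⟨L0, hL0⟩ := exists_nat_ge ((8/3 * (K+1))^2)
  set L := L0 + 16 with hLd
  have hL1 : (1:ℝ) ≤ L := by rw [hLd]; push_cast; linarith [(Nat.cast_nonneg L0 : (0:ℝ) ≤ L0)]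
  have hLK : K + 1 ≤ 3/8 * sqrt L := by
    have : 8/3 * (K+1) ≤ sqrt L := Real.le_sqrt_of_sq_le (by rw [hLd]; push_cast; linarith)
    linarith
  refine ⟨1 / L, K + 1, by positivity, ?_, fun m hm => ?_⟩
  · rw [div_le_iff₀ (by linarith)]; nlinarith
  have hm0 : (0:ℝ) < m := by exact_mod_cast hm
  have hr0 : 0 < sqrt m := Real.sqrt_pos.2 hm0
  have hpow : (m:ℝ) ^ (-(1/2) : ℝ) = 1 / sqrt m := by
    rw [Real.rpow_neg hm0.le, ← Real.sqrt_eq_rpow, one_div]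
  have hmm : (m:ℝ) = sqrt m * sqrt m := (Real.mul_self_sqrt hm0.le).symm
  set q := P bT {ω | (m : ℝ≥0∞) ≤ sz ω univ (0 : V d)} with hq
  have hqt : q ≠ ⊤ := measure_ne_top _ _
  have hanti : ∀ {k l : ℕ}, k ≤ l → P bT {ω | (l : ℝ≥0∞) ≤ sz ω univ (0 : V d)} ≤
      P bT {ω | (k : ℝ≥0∞) ≤ sz ω univ (0 : V d)} := fun {k l} hkl =>
    measure_mono fun ω (h : (l : ℝ≥0∞) ≤ _) => show (k : ℝ≥0∞) ≤ _ from le_trans (by exact_mod_cast hkl) h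
  rw [hpow]
  constructor
  · rw [ENNReal.ofReal_le_iff_le_toReal hqt]
    have h1 : Fn P bT univ (0 : V d) (L * m) ≤ Fn P bT univ 0 m + (L * m : ℕ) * q := by
      rw [Fn_eq, Fn_eq, ← Finset.sum_range_add_sum_Ico _ (show m ≤ L * m by nlinarith [show 1 ≤ L by omega])]
      refine add_le_add_right ((Finset.sum_le_card_nsmul _ _ q fun k hk => ?_).trans ?_) _
      · exact hanti ((mem_Ico.1 hk).1.trans (Nat.le_succ k))
      · rw [nsmul_eq_mul, Nat.card_Ico]
        exact mul_le_mul' (by exact_mod_cast Nat.sub_le _ _) le_rfl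
    have h2 := (hL (L * m) (by nlinarith)).trans (h1.trans (add_le_add_left (hU m) _))
    have t : ((L * m : ℕ) : ℝ≥0∞) * q ≠ ⊤ := mul_ne_top (natCast_ne_top _) hqt
    have h3 := toReal_mono (add_ne_top.2 ⟨ofReal_ne_top, t⟩) h2
    rw [toReal_add ofReal_ne_top t, toReal_mul, ENNReal.toReal_ofReal (by positivity),
      ENNReal.toReal_ofReal (by positivity), ENNReal.toReal_natCast, Nat.cast_mul, sqrt_mul (by linarith)] at h3
    generalize q.toReal = t at *
    have h4 : (K + 1) * sqrt m ≤ 3/8 * sqrt L * sqrt m := mul_le_mul_of_nonneg_right hLK hr0.le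
    have h5 : sqrt m ≤ L * m * t := by linarith
    rw [div_mul_div_comm, one_mul, div_le_iff₀ (by positivity)]
    have h6 : sqrt m * 1 ≤ sqrt m * (t * (L * sqrt m)) := by
      rw [hmm] at h5
      simp only [Real.sqrt_mul_self hr0.le] at h5
      linarith
    exact le_of_mul_le_mul_left h6 hr0
  · have h1 : (m:ℝ≥0∞) * q ≤ Fn P bT univ 0 m := by
      rw [Fn_eq]
      refine le_trans ?_ (Finset.card_nsmul_le_sum _ _ q fun k hk => hanti (Finset.mem_range.1 hk))
      rw [nsmul_eq_mul, Finset.card_range]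
    have h3 := toReal_mono ofReal_ne_top (h1.trans (hU m))
    rw [toReal_mul, ENNReal.toReal_natCast, ENNReal.toReal_ofReal (by positivity)] at h3
    rw [← ofReal_toReal hqt]
    refine ofReal_le_ofReal ?_
    generalize q.toReal = t at *
    rw [mul_one_div, le_div_iff₀ hr0]
    have h6 : sqrt m * (t * sqrt m) ≤ sqrt m * K := by
      have : sqrt m * (t * sqrt m) = sqrt m * sqrt m * t := by ring
      rw [this, ← hmm]; linarith
    have := le_of_mul_le_mul_left h6 hr0
    linarith
end LowT

/-- If `0 < α < d` and `α < min(1, d/3)` then the critical cluster-size tail has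
mean-field behaviour: `ℙ_{β_c}(|K| ≥ n) ≍ n^{-1/2}`. -/
theorem cluster_tail_mean_field {d : ℕ} {J : V d → V d → ℝ} {α c C : ℝ}
    (hJ : KernelHyp d J α c C)
    (P : ℝ → Measure (Config d)) (hP : IsLRP J P)
    (hα : α < min 1 ((d : ℝ) / 3)) :
    ∃ c₁ C₁ : ℝ, 0 < c₁ ∧ c₁ ≤ C₁ ∧ ∀ n : ℕ, 1 ≤ n →
      ENNReal.ofReal (c₁ * (n : ℝ) ^ (-(1/2) : ℝ)) ≤
        P (betaC P) {ω | (n : ℕ∞) ≤ (cluster ω 0).encard} ∧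
      P (betaC P) {ω | (n : ℕ∞) ≤ (cluster ω 0).encard} ≤
        ENNReal.ofReal (C₁ * (n : ℝ) ^ (-(1/2) : ℝ)) := by
  have hα1 : α < 1 := hα.trans_le (min_le_left _ _)
  have hα3 : 3 * α < d := by have := hα.trans_le (min_le_right _ _); linarith
  obtain ⟨bT, hT, hlt, hgt, hphi, A0, hA0, hX⟩ := exists_bT hJ hP hα1 hα3
  obtain ⟨A, hA, hGA⟩ := exists_GA hJ hP hα1 hT hA0 hlt hX
  obtain ⟨B, hB, hpt⟩ := pointwise hJ hP hα1 hT hA0 hX hA hGA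
  obtain ⟨K, hK, hU⟩ := F_upper hJ hP hT hlt (sg_sum hJ hP hα3 hA hGA hB hpt)
  have h := final_tail hJ hP hK hU fun n hn => F_lower hJ hP hT hphi hn
  have he : ∀ n : ℕ, {ω : Config d | (n : ℕ∞) ≤ (cluster ω 0).encard} =
      {ω | (n : ℝ≥0∞) ≤ sz ω Set.univ (0 : V d)} := fun n => by
    ext ω
    simp only [Set.mem_ofPred_eq, sz, Cl_univ]
    rw [← ENat.toENNReal_le, ENat.toENNReal_coe]
  rw [betaC_eq hJ hP hT hlt hgt hphi]
  simp only [he]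
  exact h

end LRP
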